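/- arXiv:2411.16218 — 7 statements merged into one kernel-verified Lean document; each statement's English description precedes it below -/
import Mathlib

section
/- For all sufficiently large t, every colouring φ: E(K^{(3)}_{n,n,n}) → ℕ of the edges of the complete 3-partite 3-uniform hypergraph with all three vertex classes of size n = t^{30t^3} yields a canonical copy of K^{(3)}_{t,t,t}; in other words, ER(K^{(3)}_{t,t,t}) ≤ t^{30t^3}. -/
/-- Greedy dependent choice: if every `x ∈ X` allows at least `a` ways of extending each good set
of fewer than `t` elements of `Y`, then some `t`-element set is good for many `x`. -/
theorem exists_card_mul_pow_le_card_good {α β : Type*} [DecidableEq β]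
    (X : Finset α) (Y : Finset β) (Good : α → Finset β → Prop) [∀ P, DecidablePred (Good · P)]
    [∀ x, DecidablePred (Good x)] (t a : ℕ) (hX : X.Nonempty) (ha : 0 < a)
    (h0 : ∀ x ∈ X, Good x ∅)
    (hs : ∀ x ∈ X, ∀ P ⊆ Y, P.card < t → Good x P →
      a ≤ (Y.filter fun y => y ∉ P ∧ Good x (insert y P)).card) :
    ∃ P ⊆ Y, P.card = t ∧ X.card * a ^ t ≤ (X.filter fun x => Good x P).card * Y.card ^ t := by
  suffices H : ∀ k ≤ t, ∃ P ⊆ Y, P.card = k ∧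
      X.card * a ^ k ≤ (X.filter fun x => Good x P).card * Y.card ^ k from H t le_rfl
  intro k
  induction k with
  | zero =>
    intro _
    refine ⟨∅, by simp, by simp, ?_⟩
    rw [Finset.filter_true_of_mem h0]
    simp
  | succ k ih =>
    intro hk
    obtain ⟨P, hPY, hPc, hP⟩ := ih (by omega)
    set G := X.filter fun x => Good x P with hG
    have hGpos : 0 < G.card := by
      have : 0 < X.card * a ^ k := Nat.mul_pos hX.card_pos (pow_pos ha k)
      exact Nat.pos_of_mul_pos_right (this.trans_le hP)
    let f : β → ℕ := fun y => (G.filter fun x => y ∉ P ∧ Good x (insert y P)).card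
    have hsum : G.card * a ≤ ∑ y ∈ Y, f y := by
      have h1 : ∑ x ∈ G, (Y.filter fun y => y ∉ P ∧ Good x (insert y P)).card = ∑ y ∈ Y, f y :=
        Finset.sum_card_bipartiteAbove_eq_sum_card_bipartiteBelow
          (fun x y => y ∉ P ∧ Good x (insert y P))
      rw [← h1, ← smul_eq_mul]
      refine Finset.card_nsmul_le_sum _ _ _ fun x hx => ?_
      rw [hG, Finset.mem_filter] at hx
      exact hs x hx.1 P hPY (by omega) hx.2
    have hY : Y.Nonempty := by
      by_contra h
      rw [Finset.not_nonempty_iff_eq_empty] at h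
      rw [h, Finset.sum_empty] at hsum
      exact absurd (Nat.mul_pos hGpos ha) (by omega)
    obtain ⟨y, hy, hfy⟩ : ∃ y ∈ Y, G.card * a ≤ f y * Y.card := by
      by_contra! h
      have h2 := Finset.sum_lt_sum_of_nonempty hY h
      rw [← Finset.sum_mul, Finset.sum_const, smul_eq_mul, mul_comm] at h2
      exact absurd (Nat.mul_le_mul_left Y.card hsum) (by omega)
    have hfpos : 0 < f y :=
      Nat.pos_of_mul_pos_right ((Nat.mul_pos hGpos ha).trans_le hfy)
    obtain ⟨x, hx⟩ := Finset.card_pos.mp hfpos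
    have hyP : y ∉ P := (Finset.mem_filter.mp hx).2.1
    refine ⟨insert y P, Finset.insert_subset hy hPY, by
      rw [Finset.card_insert_of_notMem hyP, hPc], ?_⟩
    have hle : f y ≤ (X.filter fun x => Good x (insert y P)).card := by
      refine Finset.card_le_card fun z hz => ?_
      simp only [hG, Finset.mem_filter] at hz ⊢
      exact ⟨hz.1.1, hz.2.2⟩
    calc X.card * a ^ (k + 1) = X.card * a ^ k * a := by ring
      _ ≤ G.card * Y.card ^ k * a := Nat.mul_le_mul_right _ hP
      _ = G.card * a * Y.card ^ k := by ring
      _ ≤ f y * Y.card * Y.card ^ k := Nat.mul_le_mul_right _ hfy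
      _ = f y * Y.card ^ (k + 1) := by ring
      _ ≤ _ := Nat.mul_le_mul_right _ hle

/-- If every `x ∈ X` is related to at least `a + t` elements of `Y`, then some `t`-element subset
of `Y` has many common neighbours. -/
theorem exists_card_mul_pow_le_card_common {α β : Type*} [DecidableEq β]
    (X : Finset α) (Y : Finset β) (R : α → β → Prop) [DecidableRel R]
    (t a : ℕ) (hX : X.Nonempty) (ha : 0 < a)
    (hs : ∀ x ∈ X, a + t ≤ (Y.filter fun y => R x y).card) :
    ∃ P ⊆ Y, P.card = t ∧
      X.card * a ^ t ≤ (X.filter fun x => ∀ y ∈ P, R x y).card * Y.card ^ t := by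
  refine exists_card_mul_pow_le_card_good X Y (fun x P => ∀ y ∈ P, R x y) t a hX ha (by simp) ?_
  intro x hx P _ hPt hP
  have hsub : (Y.filter fun y => R x y) \ P ⊆
      Y.filter fun y => y ∉ P ∧ ∀ z ∈ insert y P, R x z := by
    intro y hy
    simp only [Finset.mem_sdiff, Finset.mem_filter, Finset.forall_mem_insert] at hy ⊢
    exact ⟨hy.1.1, hy.2, hy.1.2, hP⟩
  have h1 := Finset.card_le_card hsub
  have h2 := Finset.le_card_sdiff P (Y.filter fun y => R x y)
  have := hs x hx
  omega

/-- A function on at least `t * t` points is constant or injective on some `t` of them. -/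
theorem exists_subset_card_eq_const_or_injOn {α β : Type*} [DecidableEq β]
    (X : Finset α) (κ : α → β) (t : ℕ) (ht : 0 < t) (hX : t * t ≤ X.card) :
    ∃ A ⊆ X, A.card = t ∧
      ((∀ x ∈ A, ∀ x' ∈ A, κ x = κ x') ∨ Set.InjOn κ (A : Set α)) := by
  by_cases h : t ≤ (X.image κ).card
  · obtain ⟨B, hB, hBt⟩ := Finset.exists_subset_card_eq h
    obtain ⟨A, hA, hinj, rfl⟩ := Finset.exists_subset_injOn_image_eq_of_surjOn (X : Set α) B
      (f := κ) (by
        intro b hb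
        have := hB hb
        simpa using this)
    refine ⟨A, by exact_mod_cast hA, ?_, Or.inr hinj⟩
    rw [← hBt, Finset.card_image_of_injOn hinj]
  · obtain ⟨b, -, hb⟩ := Finset.exists_le_card_fiber_of_mul_le_card_of_maps_to
      (s := X) (t := X.image κ) (f := κ) (n := t) (fun x hx => Finset.mem_image_of_mem κ hx)
      (by
        have : X.Nonempty := Finset.card_pos.mp ((Nat.mul_pos ht ht).trans_le hX)
        exact this.image κ)
      ((Nat.mul_le_mul_right t (by omega)).trans hX)
    obtain ⟨A, hA, hAt⟩ := Finset.exists_subset_card_eq hb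
    refine ⟨A, hA.trans (Finset.filter_subset _ _), hAt, Or.inl fun x hx x' hx' => ?_⟩
    rw [(Finset.mem_filter.mp (hA hx)).2, (Finset.mem_filter.mp (hA hx')).2]

/-- Double counting for overriding the coordinates in the range of `g`. -/
theorem card_mul_card_piFinset_le {ι κ β : Type*} [Fintype ι] [Fintype κ] [DecidableEq ι]
    [DecidableEq κ] [DecidableEq β] (W : κ → Finset β) (g : ι → κ) (hg : g.Injective)
    (S : Finset (κ → β)) (hS : S ⊆ Fintype.piFinset W) (m : ℕ)
    (hm : ∀ w ∈ Fintype.piFinset W,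
      ((Fintype.piFinset fun i => W (g i)).filter fun v => Function.extend g v w ∈ S).card ≤ m) :
    S.card * (Fintype.piFinset fun i => W (g i)).card ≤ (Fintype.piFinset W).card * m := by
  classical
  have hmem : ∀ w ∈ Fintype.piFinset W, ∀ v ∈ Fintype.piFinset fun i => W (g i),
      Function.extend g v w ∈ Fintype.piFinset W := by
    intro w hw v hv
    simp only [Fintype.mem_piFinset] at hw hv ⊢
    intro k
    by_cases hk : ∃ i, g i = k
    · obtain ⟨i, rfl⟩ := hk
      rw [hg.extend_apply]
      exact hv i
    · rw [Function.extend_apply' _ _ _ hk]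
      exact hw k
  have hinv : ∀ (w : κ → β) (v : ι → β),
      Function.extend g (w ∘ g) (Function.extend g v w) = w := by
    intro w v
    ext k
    by_cases hk : ∃ i, g i = k
    · obtain ⟨i, rfl⟩ := hk
      rw [hg.extend_apply, Function.comp_apply]
    · rw [Function.extend_apply' _ _ _ hk, Function.extend_apply' _ _ _ hk]
  have hext : ∀ (w : κ → β) (v : ι → β), Function.extend g v w ∘ g = v := fun w v =>
    funext fun i => hg.extend_apply v w i
  calc S.card * (Fintype.piFinset fun i => W (g i)).card
      = (S ×ˢ Fintype.piFinset fun i => W (g i)).card := (Finset.card_product _ _).symm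
    _ ≤ ((Fintype.piFinset W).sigma fun w =>
          (Fintype.piFinset fun i => W (g i)).filter fun v => Function.extend g v w ∈ S).card := by
        refine Finset.card_le_card_of_injOn
          (fun p => ⟨Function.extend g p.2 p.1, p.1 ∘ g⟩) ?_ ?_
        · rintro ⟨s, u⟩ hp
          simp only [Finset.coe_product, Set.mem_prod, Finset.mem_coe] at hp
          simp only [Finset.coe_sigma, Set.mem_sigma_iff, Finset.mem_coe, Finset.mem_filter, hinv]
          refine ⟨hmem s (hS hp.1) u hp.2, ?_, hp.1⟩
          have := hS hp.1
          simp only [Fintype.mem_piFinset] at this ⊢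
          exact fun i => this (g i)
        · rintro ⟨s, u⟩ _ ⟨s', u'⟩ _ h
          simp only [Sigma.mk.injEq, heq_eq_eq] at h
          have hs : s = s' := by
            rw [← hinv s u, ← hinv s' u', h.1, h.2]
          have hu : u = u' := by
            rw [← hext s u, ← hext s' u', h.1]
          rw [hs, hu]
    _ = ∑ w ∈ Fintype.piFinset W, _ := Finset.card_sigma _ _
    _ ≤ (Fintype.piFinset W).card * m := by
        rw [← smul_eq_mul]
        exact Finset.sum_le_card_nsmul _ _ _ hm

theorem pow_le_of_mul_pow_le {t p q r N k X a c : ℕ} (ht : 0 < t) (hX : t ^ p ≤ X) (ha : t ^ q ≤ a)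
    (h : X * a ^ k ≤ c * (t ^ N) ^ k) (hpq : r + N * k ≤ p + q * k) : t ^ r ≤ c := by
  have h1 : t ^ r * (t ^ N) ^ k ≤ c * (t ^ N) ^ k := by
    calc t ^ r * (t ^ N) ^ k = t ^ (r + N * k) := by rw [pow_add, pow_mul]
      _ ≤ t ^ (p + q * k) := Nat.pow_le_pow_right ht hpq
      _ = t ^ p * (t ^ q) ^ k := by rw [pow_add, pow_mul]
      _ ≤ X * a ^ k := Nat.mul_le_mul hX (Nat.pow_le_pow_left ha k)
      _ ≤ _ := h
  exact Nat.le_of_mul_le_mul_right h1 (pow_pos (pow_pos ht N) k)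

theorem pow_add_self_le_pow {t q s : ℕ} (ht : 2 ≤ t) (hq : 1 ≤ q) (hs : q + 1 ≤ s) :
    t ^ q + t ≤ t ^ s := by
  have h1 : t ≤ t ^ q := Nat.le_self_pow (by omega) t
  have h2 : t ^ (q + 1) ≤ t ^ s := Nat.pow_le_pow_right (by omega) hs
  have h3 : t ^ (q + 1) = t ^ q * t := pow_succ t q
  nlinarith

/-- Many vertices with a large monochromatic star yield a complete bipartite graph in which all
stars on one side are monochromatic. -/
theorem exists_canonical_of_large_stars {t N : ℕ} (ht : 100 ≤ t) (hN : N = 30 * t ^ 3)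
    (X Y : Finset ℕ) (hY : Y.card = t ^ N) (R : ℕ → ℕ → Prop) (c : ℕ → ℕ → ℕ) (κ : ℕ → ℕ)
    [DecidableRel R] (hX : t ^ (N - 9 * t - 1) ≤ X.card)
    (hs : ∀ x ∈ X, t ^ (N - 10 * t ^ 2) ≤ (Y.filter fun y => R x y ∧ c x y = κ x).card) :
    ∃ A ⊆ X, ∃ B ⊆ Y, A.card = t ∧ B.card = t ∧ (∀ x ∈ A, ∀ y ∈ B, R x y) ∧
      ∃ p : Prop, ∀ x ∈ A, ∀ x' ∈ A, ∀ y ∈ B, ∀ y' ∈ B, (c x y = c x' y' ↔ (p → x = x')) := by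
  have ht3 : 100 * t ^ 2 ≤ t ^ 3 := by nlinarith [sq_nonneg t]
  have ht2 : 100 * t ≤ t ^ 2 := by nlinarith
  have hq1 : 1 ≤ N - 10 * t ^ 2 - 1 := by omega
  have hXne : X.Nonempty :=
    Finset.card_pos.mp ((pow_pos (by omega) _).trans_le hX)
  obtain ⟨P, hPY, hPt, hP⟩ := exists_card_mul_pow_le_card_common X Y
    (fun x y => R x y ∧ c x y = κ x) t (t ^ (N - 10 * t ^ 2 - 1)) hXne (pow_pos (by omega) _)
    (fun x hx => (pow_add_self_le_pow (by omega) hq1 (by omega)).trans (hs x hx))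
  rw [hY] at hP
  have h2 := pow_le_of_mul_pow_le (r := 2) (by omega) hX le_rfl hP (by
    have h1 : (N - 10 * t ^ 2 - 1) * t = N * t - 10 * t ^ 3 - t := by
      rw [Nat.sub_mul, Nat.sub_mul]; ring_nf
    have h4 : 30 * t ^ 3 ≤ N * t := by rw [hN]; nlinarith [Nat.zero_le (t ^ 3)]
    rw [h1]
    omega)
  obtain ⟨A, hA, hAt, hA'⟩ := exists_subset_card_eq_const_or_injOn _ κ t (by omega)
    (by rw [← sq]; exact h2)
  have hAP : ∀ x ∈ A, ∀ y ∈ P, R x y ∧ c x y = κ x := fun x hx =>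
    (Finset.mem_filter.mp (hA hx)).2
  refine ⟨A, hA.trans (Finset.filter_subset _ _), P, hPY, hAt, hPt,
    fun x hx y hy => (hAP x hx y hy).1, ?_⟩
  rcases hA' with h | h
  · refine ⟨False, fun x hx x' hx' y hy y' hy' => ?_⟩
    simp [(hAP x hx y hy).2, (hAP x' hx' y' hy').2, h x hx x' hx']
  · refine ⟨True, fun x hx x' hx' y hy y' hy' => ?_⟩
    rw [(hAP x hx y hy).2, (hAP x' hx' y' hy').2]
    exact ⟨fun e _ => h hx hx' e, fun e => by rw [e trivial]⟩

/-- If `X` is large compared with the colour classes at the vertices of `P` and every vertex of `X`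
sees distinct colours on `P`, then `X` contains `t` vertices spanning a rainbow graph with `P`. -/
theorem exists_rainbow_subset (X P : Finset ℕ) (c : ℕ → ℕ → ℕ) (t s : ℕ) (hP : P.card = t)
    (ht : 0 < t) (hinj : ∀ x ∈ X, Set.InjOn (c x) (P : Set ℕ))
    (hs : ∀ y ∈ P, ∀ κ, (X.filter fun x => c x y = κ).card ≤ s) (hX : t * t * t * s < X.card) :
    ∃ A ⊆ X, A.card = t ∧
      ∀ x ∈ A, ∀ x' ∈ A, ∀ y ∈ P, ∀ y' ∈ P, c x y = c x' y' → x = x' ∧ y = y' := by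
  suffices H : ∀ k ≤ t, ∃ A ⊆ X, A.card = k ∧
      ∀ x ∈ A, ∀ x' ∈ A, ∀ y ∈ P, ∀ y' ∈ P, c x y = c x' y' → x = x' ∧ y = y' from H t le_rfl
  intro k
  induction k with
  | zero => exact fun _ => ⟨∅, by simp, by simp, by simp⟩
  | succ k ih =>
    intro hk
    obtain ⟨A, hAX, hAk, hA⟩ := ih (by omega)
    let used : Finset ℕ := (A ×ˢ P).image fun p => c p.1 p.2
    have hused : used.card ≤ t * t := by
      refine Finset.card_image_le.trans ?_
      rw [Finset.card_product, hP]
      exact Nat.mul_le_mul_right t (by omega)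
    let bad : Finset ℕ := (used ×ˢ P).biUnion fun p => X.filter fun x => c x p.2 = p.1
    have hbad : bad.card ≤ t * t * t * s := by
      refine (Finset.card_biUnion_le_card_mul _ _ s ?_).trans ?_
      · intro p hp
        exact hs p.2 (Finset.mem_product.mp hp).2 p.1
      · rw [Finset.card_product, hP]
        exact Nat.mul_le_mul_right s (Nat.mul_le_mul_right t hused)
    obtain ⟨x, hx, hxb⟩ := Finset.exists_mem_notMem_of_card_lt_card (hbad.trans_lt hX)
    have hnew : ∀ x' ∈ A, ∀ y ∈ P, ∀ y' ∈ P, c x y ≠ c x' y' := by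
      intro x' hx' y hy y' hy' h
      refine hxb (Finset.mem_biUnion.mpr ⟨(c x' y', y), ?_, Finset.mem_filter.mpr ⟨hx, h⟩⟩)
      exact Finset.mem_product.mpr
        ⟨Finset.mem_image.mpr ⟨(x', y'), Finset.mem_product.mpr ⟨hx', hy'⟩, rfl⟩, hy⟩
    have hxA : x ∉ A := by
      intro h
      obtain ⟨y, hy⟩ := Finset.card_pos.mp (hP ▸ ht)
      exact hnew x h y hy y hy rfl
    refine ⟨insert x A, Finset.insert_subset hx hAX, by
      rw [Finset.card_insert_of_notMem hxA, hAk], ?_⟩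
    intro u hu v hv y hy y' hy' h
    rcases Finset.mem_insert.mp hu with rfl | huA <;>
      rcases Finset.mem_insert.mp hv with rfl | hvA
    · exact ⟨rfl, hinj _ hx hy hy' h⟩
    · exact absurd h (hnew v hvA y hy y' hy')
    · exact absurd h.symm (hnew u huA y' hy' y hy)
    · exact hA u huA v hvA y hy y' hy' h

/-- A dense bipartite graph in which all monochromatic stars are small contains a rainbow
complete bipartite graph. -/
theorem exists_rainbow_of_small_stars {t N : ℕ} (ht : 100 ≤ t) (hN : N = 30 * t ^ 3)
    (X Y : Finset ℕ) (hY : Y.card = t ^ N) (R : ℕ → ℕ → Prop) (c : ℕ → ℕ → ℕ)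
    [DecidableRel R] (hX : t ^ (N - 9 * t - 1) ≤ X.card)
    (hdeg : ∀ x ∈ X, t ^ (N - 9 * t - 1) ≤ (Y.filter fun y => R x y).card)
    (hx : ∀ x ∈ X, ∀ κ, (Y.filter fun y => R x y ∧ c x y = κ).card ≤ t ^ (N - 10 * t ^ 2))
    (hy : ∀ y ∈ Y, ∀ κ, (X.filter fun x => R x y ∧ c x y = κ).card ≤ t ^ (N - 10 * t ^ 2)) :
    ∃ A ⊆ X, ∃ B ⊆ Y, A.card = t ∧ B.card = t ∧ (∀ x ∈ A, ∀ y ∈ B, R x y) ∧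
      ∀ x ∈ A, ∀ x' ∈ A, ∀ y ∈ B, ∀ y' ∈ B, c x y = c x' y' → x = x' ∧ y = y' := by
  classical
  have ht3 : 100 * t ^ 2 ≤ t ^ 3 := by nlinarith [sq_nonneg t]
  have ht2 : 100 * t ≤ t ^ 2 := by nlinarith
  set s := t ^ (N - 10 * t ^ 2) with hs
  have hXne : X.Nonempty :=
    Finset.card_pos.mp ((pow_pos (by omega) _).trans_le hX)
  have harith : t ^ (N - 9 * t - 2) + t * s ≤ t ^ (N - 9 * t - 1) := by
    have h1 : t * s ≤ t ^ (N - 9 * t - 2) := by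
      rw [hs, ← pow_succ']
      exact Nat.pow_le_pow_right (by omega) (by omega)
    have h2 : t ^ (N - 9 * t - 1) = t ^ (N - 9 * t - 2) * t := by
      rw [← pow_succ]; congr 1; omega
    rw [h2]
    nlinarith
  obtain ⟨P, hPY, hPt, hP⟩ := exists_card_mul_pow_le_card_good X Y
    (fun x P => (∀ y ∈ P, R x y) ∧ Set.InjOn (c x) (P : Set ℕ)) t (t ^ (N - 9 * t - 2)) hXne
    (pow_pos (by omega) _) (by simp) (by
      rintro x hxX P hPY hPt ⟨hPR, hPi⟩
      have hsub : (Y.filter fun y => R x y) \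
            (P.biUnion fun z => Y.filter fun y => R x y ∧ c x y = c x z) ⊆
          Y.filter fun y => y ∉ P ∧ (∀ z ∈ insert y P, R x z) ∧
            Set.InjOn (c x) (insert y P : Finset ℕ) := by
        intro y hy
        simp only [Finset.mem_sdiff, Finset.mem_filter, Finset.mem_biUnion, not_exists, not_and,
          Finset.forall_mem_insert] at hy ⊢
        obtain ⟨⟨hyY, hyR⟩, hyn⟩ := hy
        have hyc : ∀ z ∈ P, c x y ≠ c x z := fun z hz => hyn z hz hyY hyR
        have hyP : y ∉ P := fun h => hyc y h rfl
        refine ⟨hyY, hyP, ⟨hyR, hPR⟩, ?_⟩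
        rw [Finset.coe_insert, Set.injOn_insert (by exact_mod_cast hyP)]
        refine ⟨hPi, ?_⟩
        rintro ⟨z, hz, h⟩
        exact hyc z hz h.symm
      have h1 := Finset.card_le_card hsub
      have h2 := Finset.le_card_sdiff
        (P.biUnion fun z => Y.filter fun y => R x y ∧ c x y = c x z) (Y.filter fun y => R x y)
      have h3 : (P.biUnion fun z => Y.filter fun y => R x y ∧ c x y = c x z).card ≤ t * s :=
        (Finset.card_biUnion_le_card_mul _ _ s fun z _ => hx x hxX _).trans
          (Nat.mul_le_mul_right s hPt.le)
      have := hdeg x hxX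
      omega)
  rw [hY] at hP
  have h2 := pow_le_of_mul_pow_le (r := N - 10 * t ^ 2 + 4) (by omega) hX le_rfl hP (by
    have h1 : (N - 9 * t - 2) * t = N * t - 9 * t ^ 2 - 2 * t := by
      rw [Nat.sub_mul, Nat.sub_mul]; ring_nf
    have h4 : 30 * t ^ 3 ≤ N * t := by rw [hN]; nlinarith [Nat.zero_le (t ^ 3)]
    rw [h1]
    omega)
  set X' := X.filter fun x => (∀ y ∈ P, R x y) ∧ Set.InjOn (c x) (P : Set ℕ) with hX'
  have hX'm : ∀ x ∈ X', x ∈ X ∧ (∀ y ∈ P, R x y) ∧ Set.InjOn (c x) (P : Set ℕ) := fun x hx =>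
    Finset.mem_filter.mp hx
  obtain ⟨A, hAX, hAt, hA⟩ := exists_rainbow_subset X' P c t s hPt (by omega)
    (fun x hx => (hX'm x hx).2.2) (fun y hyP κ => by
      refine le_trans (Finset.card_le_card fun x hx => ?_) (hy y (hPY hyP) κ)
      rw [Finset.mem_filter] at hx ⊢
      have := hX'm x hx.1
      exact ⟨this.1, this.2.1 y hyP, hx.2⟩)
    (by
      refine lt_of_lt_of_le ?_ h2
      have h5 : t * t * t * s = t ^ (N - 10 * t ^ 2 + 3) := by rw [hs]; ring
      rw [h5]
      exact Nat.pow_lt_pow_right (by omega) (by omega))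
  exact ⟨A, fun x hx => (hX'm x (hAX hx)).1, P, hPY, hAt, hPt,
    fun x hx y hy => (hX'm x (hAX hx)).2.1 y hy, hA⟩

/-- A dense edge-coloured bipartite graph contains a canonically coloured complete bipartite
graph. -/
theorem exists_canonical_bipartite {t N : ℕ} (ht : 100 ≤ t) (hN : N = 30 * t ^ 3)
    (X Y : Finset ℕ) (hX : X.card = t ^ N) (hY : Y.card = t ^ N) (R : ℕ → ℕ → Prop)
    (c : ℕ → ℕ → ℕ) [DecidableRel R]
    (hR : t ^ (2 * N - 9 * t) ≤ ((X ×ˢ Y).filter fun p => R p.1 p.2).card) :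
    ∃ A ⊆ X, ∃ B ⊆ Y, A.card = t ∧ B.card = t ∧ (∀ x ∈ A, ∀ y ∈ B, R x y) ∧
      ∃ p q : Prop, ∀ x ∈ A, ∀ x' ∈ A, ∀ y ∈ B, ∀ y' ∈ B,
        (c x y = c x' y' ↔ (p → x = x') ∧ (q → y = y')) := by
  classical
  have ht3 : 100 * t ^ 2 ≤ t ^ 3 := by nlinarith [sq_nonneg t]
  have ht2 : 100 * t ≤ t ^ 2 := by nlinarith
  set s := t ^ (N - 10 * t ^ 2) with hs
  set d := t ^ (N - 9 * t - 1) with hd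
  set BX := X.filter fun x => ∃ κ, s ≤ (Y.filter fun y => R x y ∧ c x y = κ).card with hBX
  set BY := Y.filter fun y => ∃ κ, s ≤ (X.filter fun x => R x y ∧ c x y = κ).card with hBY
  by_cases hBXd : d ≤ BX.card
  · have h : ∀ x, ∃ κ, x ∈ BX → s ≤ (Y.filter fun y => R x y ∧ c x y = κ).card := by
      intro x
      by_cases hx : x ∈ BX
      · obtain ⟨κ, hκ⟩ := (Finset.mem_filter.mp hx).2
        exact ⟨κ, fun _ => hκ⟩
      · exact ⟨0, fun h => absurd h hx⟩
    choose κ hκ using h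
    obtain ⟨A, hA, B, hB, hAt, hBt, hAB, p, hp⟩ :=
      exists_canonical_of_large_stars ht hN BX Y hY R c κ hBXd hκ
    refine ⟨A, hA.trans (Finset.filter_subset _ _), B, hB, hAt, hBt, hAB, p, False, ?_⟩
    intro x hx x' hx' y hy y' hy'
    rw [hp x hx x' hx' y hy y' hy']
    simp
  by_cases hBYd : d ≤ BY.card
  · have h : ∀ y, ∃ κ, y ∈ BY → s ≤ (X.filter fun x => R x y ∧ c x y = κ).card := by
      intro y
      by_cases hy : y ∈ BY
      · obtain ⟨κ, hκ⟩ := (Finset.mem_filter.mp hy).2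
        exact ⟨κ, fun _ => hκ⟩
      · exact ⟨0, fun h => absurd h hy⟩
    choose κ hκ using h
    obtain ⟨B, hB, A, hA, hBt, hAt, hAB, q, hq⟩ :=
      exists_canonical_of_large_stars ht hN BY X hX (fun y x => R x y) (fun y x => c x y) κ hBYd hκ
    refine ⟨A, hA, B, hB.trans (Finset.filter_subset _ _), hAt, hBt,
      fun x hx y hy => hAB y hy x hx, False, q, ?_⟩
    intro x hx x' hx' y hy y' hy'
    rw [hq y hy y' hy' x hx x' hx']
    simp
  push Not at hBXd hBYd
  have hn : 0 < t ^ N := pow_pos (by omega) _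
  set X₁ := X \ BX with hX₁
  set Y₁ := Y \ BY with hY₁
  set X₂ := X₁.filter fun x => d ≤ (Y.filter fun y => R x y ∧ y ∈ Y₁).card with hX₂
  have hcover : ((X ×ˢ Y).filter fun p => R p.1 p.2) ⊆
      (BX ×ˢ Y) ∪ (X ×ˢ BY) ∪ ((X₂ ×ˢ Y) ∪
        (X₁ \ X₂).biUnion fun x => (Y.filter fun y => R x y ∧ y ∈ Y₁).image fun y => (x, y)) := by
    rintro ⟨x, y⟩ hp
    simp only [Finset.mem_filter, Finset.mem_product] at hp
    simp only [Finset.mem_union, Finset.mem_product, Finset.mem_biUnion, Finset.mem_image,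
      Finset.mem_filter, Prod.mk.injEq, Finset.mem_sdiff]
    by_cases h1 : x ∈ BX
    · exact Or.inl (Or.inl ⟨h1, hp.1.2⟩)
    by_cases h2 : y ∈ BY
    · exact Or.inl (Or.inr ⟨hp.1.1, h2⟩)
    by_cases h3 : x ∈ X₂
    · exact Or.inr (Or.inl ⟨h3, hp.1.2⟩)
    · exact Or.inr (Or.inr ⟨x, ⟨Finset.mem_sdiff.mpr ⟨hp.1.1, h1⟩, h3⟩, y,
        ⟨hp.1.2, hp.2, Finset.mem_sdiff.mpr ⟨hp.1.2, h2⟩⟩, rfl, rfl⟩)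
  have hlast : ((X₁ \ X₂).biUnion fun x =>
      (Y.filter fun y => R x y ∧ y ∈ Y₁).image fun y => (x, y)).card ≤ t ^ N * d := by
    refine (Finset.card_biUnion_le_card_mul _ _ d fun x hx => ?_).trans
      (Nat.mul_le_mul_right d ?_)
    · refine Finset.card_image_le.trans ?_
      rw [Finset.mem_sdiff, hX₂, Finset.mem_filter] at hx
      by_contra! h
      exact hx.2 ⟨hx.1, h.le⟩
    · rw [← hX]
      exact Finset.card_le_card (Finset.sdiff_subset.trans Finset.sdiff_subset)
  have hX₂d : d ≤ X₂.card := by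
    have h1 := hR.trans (Finset.card_le_card hcover)
    have h2 := Finset.card_union_le ((BX ×ˢ Y) ∪ (X ×ˢ BY)) ((X₂ ×ˢ Y) ∪
        (X₁ \ X₂).biUnion fun x => (Y.filter fun y => R x y ∧ y ∈ Y₁).image fun y => (x, y))
    have h3 := Finset.card_union_le (BX ×ˢ Y) (X ×ˢ BY)
    have h4 := Finset.card_union_le (X₂ ×ˢ Y)
        ((X₁ \ X₂).biUnion fun x => (Y.filter fun y => R x y ∧ y ∈ Y₁).image fun y => (x, y))
    simp only [Finset.card_product, hX, hY] at h2 h3 h4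
    have h5 : t ^ (2 * N - 9 * t) = t * (t ^ N * d) := by
      rw [hd, ← pow_add, ← pow_succ']
      congr 1
      omega
    have h6 : BX.card * t ^ N ≤ d * t ^ N := Nat.mul_le_mul_right _ hBXd.le
    have h7 : t ^ N * BY.card ≤ t ^ N * d := Nat.mul_le_mul_left _ hBYd.le
    by_contra! h
    have h8 : X₂.card * t ^ N < d * t ^ N := Nat.mul_lt_mul_of_pos_right h hn
    nlinarith
  have hX₂m : ∀ x ∈ X₂, x ∈ X ∧ x ∉ BX ∧ d ≤ (Y.filter fun y => R x y ∧ y ∈ Y₁).card := by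
    intro x hx
    rw [hX₂, Finset.mem_filter, hX₁, Finset.mem_sdiff] at hx
    exact ⟨hx.1.1, hx.1.2, hx.2⟩
  obtain ⟨A, hA, B, hB, hAt, hBt, hAB, hc⟩ := exists_rainbow_of_small_stars ht hN X₂ Y hY
    (fun x y => R x y ∧ y ∈ Y₁) c hX₂d (fun x hx => (hX₂m x hx).2.2)
    (fun x hx κ => by
      obtain ⟨hxX, hxB, -⟩ := hX₂m x hx
      by_contra! h
      refine hxB (Finset.mem_filter.mpr ⟨hxX, κ, h.le.trans (Finset.card_le_card ?_)⟩)
      intro y hy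
      simp only [Finset.mem_filter] at hy ⊢
      exact ⟨hy.1, hy.2.1.1, hy.2.2⟩)
    (fun y hyY κ => by
      by_contra! h
      obtain ⟨x, hx⟩ := Finset.card_pos.mp ((Nat.zero_le _).trans_lt h)
      have hyY₁ : y ∈ Y₁ := (Finset.mem_filter.mp hx).2.1.2
      refine (Finset.mem_sdiff.mp hyY₁).2
        (Finset.mem_filter.mpr ⟨hyY, κ, h.le.trans (Finset.card_le_card ?_)⟩)
      intro x hx
      simp only [Finset.mem_filter] at hx ⊢
      exact ⟨(hX₂m x hx.1).1, hx.2.1.1, hx.2.2⟩)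
  refine ⟨A, fun x hx => (hX₂m x (hA hx)).1, B, hB, hAt, hBt, fun x hx y hy => (hAB x hx y hy).1,
    True, True, ?_⟩
  intro x hx x' hx' y hy y' hy'
  constructor
  · intro h
    obtain ⟨h1, h2⟩ := hc x hx x' hx' y hy y' hy' h
    exact ⟨fun _ => h1, fun _ => h2⟩
  · rintro ⟨h1, h2⟩
    rw [h1 trivial, h2 trivial]

/-- Many edges whose colour repeats often in the direction of the third class yield a canonical
copy. -/
theorem exists_canonical_of_heavy_edges {t N : ℕ} (ht : 100 ≤ t) (hN : N = 30 * t ^ 3)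
    (X Y Z : Finset ℕ) (hX : X.card = t ^ N) (hY : Y.card = t ^ N) (hZ : Z.card = t ^ N)
    (f : ℕ → ℕ → ℕ → ℕ)
    (hf : t ^ (3 * N - 7) ≤ (((X ×ˢ Y) ×ˢ Z).filter fun p =>
      t ^ (N - 7) ≤ (Z.filter fun z => f p.1.1 p.1.2 z = f p.1.1 p.1.2 p.2).card).card) :
    ∃ A ⊆ X, ∃ B ⊆ Y, ∃ C ⊆ Z, A.card = t ∧ B.card = t ∧ C.card = t ∧
      ∃ p q : Prop, ∀ x ∈ A, ∀ x' ∈ A, ∀ y ∈ B, ∀ y' ∈ B, ∀ z ∈ C, ∀ z' ∈ C,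
        (f x y z = f x' y' z' ↔ (p → x = x') ∧ (q → y = y')) := by
  classical
  have ht3 : 100 * t ^ 2 ≤ t ^ 3 := by nlinarith [sq_nonneg t]
  have ht2 : 100 * t ≤ t ^ 2 := by nlinarith
  set Q := (X ×ˢ Y).filter fun p => ∃ κ, t ^ (N - 7) ≤ (Z.filter fun z => f p.1 p.2 z = κ).card
    with hQ
  have hQcard : t ^ (2 * N - 7) ≤ Q.card := by
    have h1 : t ^ (3 * N - 7) ≤ (Q ×ˢ Z).card := by
      refine hf.trans (Finset.card_le_card ?_)
      rintro ⟨p, z⟩ hp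
      simp only [hQ, Finset.mem_filter, Finset.mem_product] at hp ⊢
      exact ⟨⟨hp.1.1, _, hp.2⟩, hp.1.2⟩
    rw [Finset.card_product, hZ, show 3 * N - 7 = 2 * N - 7 + N by omega, pow_add] at h1
    exact Nat.le_of_mul_le_mul_right h1 (pow_pos (by omega) _)
  have hc : ∀ x y, ∃ κ, (x, y) ∈ Q → t ^ (N - 7) ≤ (Z.filter fun z => f x y z = κ).card := by
    intro x y
    by_cases h : (x, y) ∈ Q
    · obtain ⟨κ, hκ⟩ := (Finset.mem_filter.mp h).2
      exact ⟨κ, fun _ => hκ⟩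
    · exact ⟨0, fun h' => absurd h' h⟩
  choose c hc using hc
  have hQne : Q.Nonempty := Finset.card_pos.mp ((pow_pos (by omega) _).trans_le hQcard)
  obtain ⟨C, hCZ, hCt, hC⟩ := exists_card_mul_pow_le_card_common Q Z
    (fun p z => f p.1 p.2 z = c p.1 p.2) t (t ^ (N - 8)) hQne (pow_pos (by omega) _)
    (fun p hp => (pow_add_self_le_pow (by omega) (by omega) (by omega)).trans (hc p.1 p.2 hp))
  rw [hZ] at hC
  have h2 := pow_le_of_mul_pow_le (r := 2 * N - 9 * t) (by omega) hQcard le_rfl hC (by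
    have h1 : (N - 8) * t = N * t - 8 * t := Nat.sub_mul _ _ _
    have h4 : 30 * t ^ 3 ≤ N * t := by rw [hN]; nlinarith [Nat.zero_le (t ^ 3)]
    rw [h1]
    omega)
  obtain ⟨A, hA, B, hB, hAt, hBt, hAB, p, q, hpq⟩ := exists_canonical_bipartite ht hN X Y hX hY
    (fun x y => ∀ z ∈ C, f x y z = c x y) c (by
      refine h2.trans (Finset.card_le_card fun p hp => ?_)
      rw [Finset.mem_filter, hQ, Finset.mem_filter] at hp
      exact Finset.mem_filter.mpr ⟨hp.1.1, hp.2⟩)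
  refine ⟨A, hA, B, hB, C, hCZ, hAt, hBt, hCt, p, q, ?_⟩
  intro x hx x' hx' y hy y' hy' z hz z' hz'
  rw [hAB x hx y hy z hz, hAB x' hx' y' hy' z' hz', hpq x hx x' hx' y hy y' hy']

theorem extend_const_eq_update {κ β : Type*} [DecidableEq κ] (i : κ) (v : Unit → β) (w : κ → β) :
    Function.extend (fun _ : Unit => i) v w = Function.update w i (v ()) := by
  have hg : Function.Injective fun _ : Unit => i := fun _ _ _ => Subsingleton.elim _ _
  ext k
  by_cases hk : k = i
  · subst hk
    rw [Function.update_self]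
    exact hg.extend_apply v w ()
  · rw [Function.update_of_ne hk, Function.extend_apply' _ _ _ (by rintro ⟨-, h⟩; exact hk h.symm)]

/-- Double counting along the lines in the direction of one coordinate. -/
theorem card_mul_card_le_of_lines {κ β : Type*} [Fintype κ] [DecidableEq κ] [DecidableEq β]
    (W : κ → Finset β) (i : κ) (S : Finset (κ → β)) (hS : S ⊆ Fintype.piFinset W) (m : ℕ)
    (hm : ∀ w ∈ Fintype.piFinset W, ((W i).filter fun v => Function.update w i v ∈ S).card ≤ m) :
    S.card * (W i).card ≤ (Fintype.piFinset W).card * m := by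
  have h := card_mul_card_piFinset_le W (fun _ : Unit => i) (fun _ _ _ => Subsingleton.elim _ _)
    S hS m (fun w hw => by
      refine le_trans ?_ (hm w hw)
      refine Finset.card_le_card_of_injOn (fun v => v ()) ?_ ?_
      · intro v hv
        simp only [extend_const_eq_update, Finset.coe_filter, Fintype.mem_piFinset,
          Set.mem_ofPred_eq] at hv ⊢
        exact ⟨hv.1 (), hv.2⟩
      · intro v _ v' _ h
        exact funext fun _ => h)
  simpa using h

/-- If few edges repeat their colour often in some direction, then there is a rainbow copy. -/
theorem exists_rainbow_of_few_heavy_edges {t N : ℕ} (ht : 100 ≤ t) (hN : 7 ≤ N)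
    (V : Fin 3 → Finset ℕ) (hV : ∀ i, (V i).card = t ^ N) (φ : (Fin 3 → ℕ) → ℕ)
    (hφ : ∀ i, ((Fintype.piFinset V).filter fun e =>
      t ^ (N - 7) ≤ ((V i).filter fun v => φ (Function.update e i v) = φ e).card).card
        ≤ t ^ (3 * N - 7)) :
    ∃ w : Fin 3 × Fin t → ℕ, (∀ k, w k ∈ V k.1) ∧
      ∀ a b : Fin 3 → Fin t, φ (fun i => w (i, a i)) = φ (fun i => w (i, b i)) → a = b := by
  classical
  have htpos : 0 < t := by omega
  have hnpos : 0 < t ^ N := pow_pos htpos N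
  have hpi : (Fintype.piFinset V).card = (t ^ N) ^ 3 := by
    simp [Fintype.card_piFinset, hV]
  -- Few edges agree with a colouring that ignores one direction
  have key : ∀ (i : Fin 3) (ψ : (Fin 3 → ℕ) → ℕ),
      (∀ e v, ψ (Function.update e i v) = ψ e) →
      ((Fintype.piFinset V).filter fun e => φ e = ψ e).card ≤ 2 * t ^ (3 * N - 7) := by
    intro i ψ hψ
    set heavy := (Fintype.piFinset V).filter fun e =>
      t ^ (N - 7) ≤ ((V i).filter fun v => φ (Function.update e i v) = φ e).card with hheavy
    set S := ((Fintype.piFinset V).filter fun e => φ e = ψ e) \ heavy with hS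
    have hSc : S.card ≤ t ^ (3 * N - 7) := by
      have h := card_mul_card_le_of_lines V i S
        (Finset.sdiff_subset.trans (Finset.filter_subset _ _)) (t ^ (N - 7)) (by
          intro e he
          by_contra! hlt
          obtain ⟨v₀, hv₀⟩ := Finset.card_pos.mp ((Nat.zero_le _).trans_lt hlt)
          have hv₀S := (Finset.mem_filter.mp hv₀).2
          have hm := Finset.mem_sdiff.mp hv₀S
          have hm' := Finset.mem_filter.mp hm.1
          refine hm.2 (Finset.mem_filter.mpr
            ⟨hm'.1, hlt.le.trans (Finset.card_le_card fun v hv => ?_)⟩)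
          have hvS := (Finset.mem_filter.mp hv).2
          have hvm := Finset.mem_filter.mp (Finset.mem_sdiff.mp hvS).1
          refine Finset.mem_filter.mpr ⟨(Finset.mem_filter.mp hv).1, ?_⟩
          rw [Function.update_idem, hvm.2, hm'.2, hψ, hψ])
      rw [hV, hpi] at h
      refine Nat.le_of_mul_le_mul_right (h.trans_eq ?_) hnpos
      rw [← pow_mul, ← pow_add, ← pow_add]
      congr 1
      omega
    have hsub : ((Fintype.piFinset V).filter fun e => φ e = ψ e) ⊆ S ∪ heavy := by
      intro e he
      by_cases h : e ∈ heavy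
      · exact Finset.mem_union_right _ h
      · exact Finset.mem_union_left _ (Finset.mem_sdiff.mpr ⟨he, h⟩)
    have h1 := (Finset.card_le_card hsub).trans (Finset.card_union_le _ _)
    have h2 : heavy.card ≤ t ^ (3 * N - 7) := hφ i
    omega
  let W : Fin 3 × Fin t → Finset ℕ := fun k => V k.1
  let bad : (Fin 3 → Fin t) × (Fin 3 → Fin t) → Finset (Fin 3 × Fin t → ℕ) := fun p =>
    (Fintype.piFinset W).filter fun w =>
      p.1 ≠ p.2 ∧ φ (fun i => w (i, p.1 i)) = φ (fun i => w (i, p.2 i))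
  have hWpos : 0 < (Fintype.piFinset W).card := by
    rw [Fintype.card_piFinset]
    exact Finset.prod_pos fun k _ => by rw [hV]; exact hnpos
  have hbad : ∀ p, (bad p).card * t ^ 7 ≤ (Fintype.piFinset W).card * 2 := by
    rintro ⟨a, b⟩
    by_cases hab : a = b
    · simp [bad, hab]
    obtain ⟨i, hi⟩ := Function.ne_iff.mp hab
    have hg : Function.Injective fun j : Fin 3 => (j, a j) := fun j j' h => (Prod.mk.inj h).1
    have h := card_mul_card_piFinset_le W (fun j : Fin 3 => (j, a j)) hg (bad (a, b))
      (Finset.filter_subset _ _) (2 * t ^ (3 * N - 7)) (by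
        intro w hw
        refine le_trans (Finset.card_le_card fun v hv => ?_)
          (key i (fun e => φ fun j => Function.extend (fun j : Fin 3 => (j, a j)) e w (j, b j)) ?_)
        · have hv' := Finset.mem_filter.mp hv
          refine Finset.mem_filter.mpr ⟨hv'.1, ?_⟩
          have h3 := (Finset.mem_filter.mp hv'.2).2.2
          rw [← h3]
          congr 1
          ext j
          exact (hg.extend_apply v w j).symm
        · intro e v
          congr 1
          ext j
          by_cases hj : a j = b j
          · rw [← hj, hg.extend_apply _ w j, hg.extend_apply _ w j, Function.update_of_ne]
            rintro rfl
            exact hi hj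
          · have hne : ¬ ∃ j', (fun j : Fin 3 => (j, a j)) j' = (j, b j) := by
              rintro ⟨j', h'⟩
              obtain ⟨h1, h2⟩ := Prod.mk.inj h'
              subst h1
              exact hj h2
            rw [Function.extend_apply' _ _ _ hne, Function.extend_apply' _ _ _ hne])
    have hpi' : (Fintype.piFinset fun j : Fin 3 => W (j, a j)).card = (t ^ N) ^ 3 := hpi
    rw [hpi', ← pow_mul, show N * 3 = 7 + (3 * N - 7) by omega, pow_add] at h
    refine Nat.le_of_mul_le_mul_right (c := t ^ (3 * N - 7)) ?_ (pow_pos htpos _)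
    calc _ = _ := by ring
      _ ≤ _ := h
      _ = _ := by ring
  have hunion : (Finset.univ.biUnion bad).card < (Fintype.piFinset W).card := by
    have h1 : (Finset.univ.biUnion bad).card * t ^ 7
        ≤ t ^ 6 * ((Fintype.piFinset W).card * 2) := by
      calc (Finset.univ.biUnion bad).card * t ^ 7 ≤ (∑ p, (bad p).card) * t ^ 7 :=
            Nat.mul_le_mul_right _ Finset.card_biUnion_le
        _ = ∑ p, (bad p).card * t ^ 7 := Finset.sum_mul _ _ _
        _ ≤ ∑ _p : (Fin 3 → Fin t) × (Fin 3 → Fin t), (Fintype.piFinset W).card * 2 :=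
            Finset.sum_le_sum fun p _ => hbad p
        _ = t ^ 6 * ((Fintype.piFinset W).card * 2) := by
            rw [Finset.sum_const, Finset.card_univ, smul_eq_mul, Fintype.card_prod,
              Fintype.card_fun, Fintype.card_fin, Fintype.card_fin, ← pow_add]
    by_contra! hle
    have h2 : (Fintype.piFinset W).card * t ^ 7 ≤ t ^ 6 * ((Fintype.piFinset W).card * 2) :=
      (Nat.mul_le_mul_right _ hle).trans h1
    have h3 : 0 < t ^ 6 * (Fintype.piFinset W).card := Nat.mul_pos (pow_pos htpos 6) hWpos
    have h4 : t ^ 6 * (Fintype.piFinset W).card * t ≤ t ^ 6 * (Fintype.piFinset W).card * 2 := by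
      calc _ = _ := by ring
        _ ≤ _ := h2
        _ = _ := by ring
    have := Nat.le_of_mul_le_mul_left h4 h3
    omega
  obtain ⟨w, hw, hwb⟩ := Finset.exists_mem_notMem_of_card_lt_card hunion
  refine ⟨w, fun k => Fintype.mem_piFinset.mp hw k, fun a b hφab => ?_⟩
  by_contra hne
  exact hwb (Finset.mem_biUnion.mpr
    ⟨(a, b), Finset.mem_univ _, Finset.mem_filter.mpr ⟨hw, hne, hφab⟩⟩)

/-- `exists_canonical_of_heavy_edges` with the repeated direction `σ 2`. -/
theorem exists_canonical_of_heavy_direction {t N : ℕ} (ht : 100 ≤ t) (hN : N = 30 * t ^ 3)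
    (V : Fin 3 → Finset ℕ) (hV : ∀ i, (V i).card = t ^ N) (φ : (Fin 3 → ℕ) → ℕ)
    (σ : Equiv.Perm (Fin 3))
    (hφ : t ^ (3 * N - 7) ≤ ((Fintype.piFinset V).filter fun e =>
      t ^ (N - 7) ≤
        ((V (σ 2)).filter fun v => φ (Function.update e (σ 2) v) = φ e).card).card) :
    ∃ (U : Fin 3 → Finset ℕ) (J : Finset (Fin 3)),
      (∀ i, U i ⊆ V i) ∧ (∀ i, (U i).card = t) ∧
      ∀ e ∈ Fintype.piFinset U, ∀ e' ∈ Fintype.piFinset U,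
        (φ e = φ e' ↔ ∀ j ∈ J, e j = e' j) := by
  classical
  let E : ℕ → ℕ → ℕ → Fin 3 → ℕ := fun x y z => ![x, y, z] ∘ σ.symm
  have hE : ∀ e : Fin 3 → ℕ, E (e (σ 0)) (e (σ 1)) (e (σ 2)) = e := by
    intro e
    ext k
    obtain ⟨i, rfl⟩ := σ.surjective k
    fin_cases i <;> simp [E]
  have hEu : ∀ (e : Fin 3 → ℕ) v,
      E (e (σ 0)) (e (σ 1)) v = Function.update e (σ 2) v := by
    intro e v
    rw [← hE (Function.update e (σ 2) v)]
    simp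
  obtain ⟨A, hA, B, hB, C, hC, hAt, hBt, hCt, p, q, hpq⟩ :=
    exists_canonical_of_heavy_edges ht hN (V (σ 0)) (V (σ 1)) (V (σ 2)) (hV _) (hV _) (hV _)
      (fun x y z => φ (E x y z)) (by
        refine hφ.trans (Finset.card_le_card_of_injOn
          (fun e => ((e (σ 0), e (σ 1)), e (σ 2))) ?_ ?_)
        · intro e he
          simp only [Finset.coe_filter, Fintype.mem_piFinset, Set.mem_ofPred_eq,
            Finset.mem_product] at he ⊢
          refine ⟨⟨⟨he.1 _, he.1 _⟩, he.1 _⟩, ?_⟩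
          simp only [hE, hEu]
          exact he.2
        · intro e _ e' _ h
          simp only [Prod.mk.injEq] at h
          rw [← hE e, ← hE e', h.1.1, h.1.2, h.2])
  refine ⟨![A, B, C] ∘ σ.symm,
    Finset.univ.filter fun j => (j = σ 0 ∧ p) ∨ (j = σ 1 ∧ q), ?_, ?_, ?_⟩
  · intro k
    obtain ⟨i, rfl⟩ := σ.surjective k
    fin_cases i <;> simpa
  · intro k
    obtain ⟨i, rfl⟩ := σ.surjective k
    fin_cases i <;> simpa
  · intro e he e' he'
    have hm : ∀ e ∈ Fintype.piFinset (![A, B, C] ∘ σ.symm),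
        e (σ 0) ∈ A ∧ e (σ 1) ∈ B ∧ e (σ 2) ∈ C := by
      intro e he
      rw [Fintype.mem_piFinset] at he
      exact ⟨by simpa using he (σ 0), by simpa using he (σ 1), by simpa using he (σ 2)⟩
    obtain ⟨h0, h1, h2⟩ := hm e he
    obtain ⟨h0', h1', h2'⟩ := hm e' he'
    have h := hpq _ h0 _ h0' _ h1 _ h1' _ h2 _ h2'
    rw [hE, hE] at h
    rw [h]
    simp only [Finset.mem_filter, Finset.mem_univ, true_and]
    constructor
    · rintro ⟨hp, hq⟩ j (⟨rfl, h⟩ | ⟨rfl, h⟩)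
      exacts [hp h, hq h]
    · exact fun h => ⟨fun hp => h _ (Or.inl ⟨rfl, hp⟩), fun hq => h _ (Or.inr ⟨rfl, hq⟩)⟩


/-- **Canonical Ramsey numbers for 3-partite 3-uniform hypergraphs.**
For all sufficiently large `t`, every colouring `φ` of the edges of the complete
3-partite 3-uniform hypergraph with all three vertex classes of size `n = t^(30 t^3)`
yields a canonical copy of `K^(3)_{t,t,t}`: classes `U i ⊆ V i` of size `t` and a set
`J ⊆ [3]` such that two edges of the copy get the same colour iff they agree on the
coordinates in `J`. Edges are encoded as transversals `e : Fin 3 → ℕ` with `e i ∈ V i`. -/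
theorem canonical_ramsey_tripartite :
    ∃ t₀ : ℕ, ∀ t : ℕ, t₀ ≤ t →
      ∀ V : Fin 3 → Finset ℕ, (∀ i, (V i).card = t ^ (30 * t ^ 3)) →
        ∀ φ : (Fin 3 → ℕ) → ℕ,
          ∃ (U : Fin 3 → Finset ℕ) (J : Finset (Fin 3)),
            (∀ i, U i ⊆ V i) ∧ (∀ i, (U i).card = t) ∧
            ∀ e ∈ Fintype.piFinset U, ∀ e' ∈ Fintype.piFinset U,
              (φ e = φ e' ↔ ∀ j ∈ J, e j = e' j) := by
  refine ⟨100, fun t ht V hV φ => ?_⟩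
  set N := 30 * t ^ 3 with hN
  by_cases h : ∃ i, t ^ (3 * N - 7) ≤ ((Fintype.piFinset V).filter fun e =>
      t ^ (N - 7) ≤ ((V i).filter fun v => φ (Function.update e i v) = φ e).card).card
  · obtain ⟨i, hi⟩ := h
    exact exists_canonical_of_heavy_direction ht hN V hV φ (Equiv.swap 2 i)
      (by rwa [Equiv.swap_apply_left])
  · push Not at h
    have ht3 : 1 ≤ t ^ 3 := Nat.one_le_pow _ _ (by omega)
    obtain ⟨w, hwV, hw⟩ :=
      exists_rainbow_of_few_heavy_edges ht (by omega) V hV φ fun i => (h i).le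
    have hinj : ∀ i, Function.Injective fun j => w (i, j) := by
      intro i j j' hj
      have heq := hw (fun _ => j) (Function.update (fun _ => j) i j') (by
        congr 1
        ext k
        by_cases hk : k = i
        · subst hk
          simpa using hj
        · simp [hk])
      simpa using congrFun heq i
    refine ⟨fun i => Finset.univ.image fun j => w (i, j), Finset.univ, ?_, ?_, ?_⟩
    · intro i v hv
      obtain ⟨j, -, rfl⟩ := Finset.mem_image.mp hv
      exact hwV (i, j)
    · intro i
      rw [Finset.card_image_of_injective _ (hinj i), Finset.card_univ, Fintype.card_fin]
    · intro e he e' he'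
      have hm : ∀ e ∈ Fintype.piFinset fun i => Finset.univ.image fun j => w (i, j),
          ∃ a : Fin 3 → Fin t, (fun i => w (i, a i)) = e := by
        intro e he
        rw [Fintype.mem_piFinset] at he
        have h : ∀ i, ∃ j, w (i, j) = e i := fun i => by simpa using he i
        choose a ha using h
        exact ⟨a, funext ha⟩
      obtain ⟨a, rfl⟩ := hm e he
      obtain ⟨b, rfl⟩ := hm e' he'
      constructor
      · intro h j _
        rw [hw a b h]
      · intro h
        congr 1
        exact funext fun j => h j (Finset.mem_univ j)
end

section
/- For every integer k ≥ 4 and all sufficiently large t, every colouring φ: E(K^{(k)}_{n,…,n}) → ℕ of the edges of the complete k-partite k-uniform hypergraph with all k vertex classes of size n = t^{t^{k²}} yields a canonical copy of K^{(k)}_{t,…,t}; in other words, ER(K^{(k)}_{t,…,t}) ≤ t^{t^{k²}}. -/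
namespace CanonicalRamsey

open Finset Function
open scoped BigOperators

section Probability

variable {Ω Ω' : Type*} [Fintype Ω] [Fintype Ω']

open scoped Classical in
/-- The proportion of the points of a finite type that satisfy `p`. -/
noncomputable def prob (p : Ω → Prop) : ℝ := 𝔼 x, if p x then (1 : ℝ) else 0

lemma prob_nonneg (p : Ω → Prop) : 0 ≤ prob p :=
  expect_nonneg fun x _ => by split_ifs <;> norm_num

lemma prob_mono {p q : Ω → Prop} (h : ∀ x, p x → q x) : prob p ≤ prob q := by
  refine expect_le_expect fun x _ => ?_
  by_cases hp : p x
  · simp [hp, h x hp]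
  · simp only [hp, if_false]; split_ifs <;> norm_num

lemma prob_congr {p q : Ω → Prop} (h : ∀ x, p x ↔ q x) : prob p = prob q :=
  le_antisymm (prob_mono fun x => (h x).1) (prob_mono fun x => (h x).2)

lemma exists_of_prob_pos {p : Ω → Prop} (h : 0 < prob p) : ∃ x, p x := by
  by_contra! hp
  simp [prob, hp] at h

lemma prob_true [Nonempty Ω] {p : Ω → Prop} (h : ∀ x, p x) : prob p = 1 := by
  simp [prob, h]

lemma prob_le_add {p q r : Ω → Prop} (h : ∀ x, p x → q x ∨ r x) : prob p ≤ prob q + prob r := by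
  rw [prob, prob, prob, ← expect_add_distrib]
  refine expect_le_expect fun x _ => ?_
  have := h x
  split_ifs <;> first | (exfalso; tauto) | norm_num

lemma prob_le_sum {κ : Type*} {s : Finset κ} {p : Ω → Prop} {q : κ → Ω → Prop}
    (h : ∀ x, p x → ∃ i ∈ s, q i x) : prob p ≤ ∑ i ∈ s, prob (q i) := by
  classical
  simp only [prob]
  rw [← expect_sum_comm]
  refine expect_le_expect fun x _ => ?_
  split_ifs with hp
  · obtain ⟨i, hi, hq⟩ := h x hp
    calc (1 : ℝ) = if q i x then (1 : ℝ) else 0 := by simp [hq]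
      _ ≤ _ := single_le_sum (f := fun i => if q i x then (1 : ℝ) else 0)
        (fun j _ => by split_ifs <;> norm_num) hi
  · exact sum_nonneg fun j _ => by split_ifs <;> norm_num

lemma prob_prod (p : Ω × Ω' → Prop) : prob p = 𝔼 x, prob fun y => p (x, y) := by
  simp only [prob]
  rw [← univ_product_univ, expect_product]

lemma prob_prod' (p : Ω × Ω' → Prop) : prob p = 𝔼 y, prob fun x => p (x, y) := by
  rw [prob_prod]
  simp only [prob]
  exact expect_comm _ _ _

lemma pow_expect_le [Nonempty Ω] {f : Ω → ℝ} (hf : ∀ x, 0 ≤ f x) (n : ℕ) :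
    (𝔼 x, f x) ^ n ≤ 𝔼 x, f x ^ n := by
  have hc : (Fintype.card Ω : ℝ) ≠ 0 := by simp
  have h := Real.pow_arith_mean_le_arith_mean_pow univ (fun _ : Ω => (Fintype.card Ω : ℝ)⁻¹) f
    (fun _ _ => by positivity) (by simp) (fun x _ => hf x) n
  rw [← mul_sum, ← mul_sum] at h
  rw [Fintype.expect_eq_sum_div_card, Fintype.expect_eq_sum_div_card, div_eq_inv_mul,
    div_eq_inv_mul]
  exact h

/-- Surjective homomorphisms of finite groups preserve the uniform distribution. -/
lemma prob_comp_hom {G K : Type*} [Fintype G] [Fintype K] [AddCommGroup G] [AddCommGroup K]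
    (π : G →+ K) (hπ : Surjective π) (p : K → Prop) : prob (fun x => p (π x)) = prob p := by
  classical
  have hfib : ∀ y, #{x | π x = y} = #{x | π x = 0} := fun y =>
    AddMonoidHom.card_fiber_eq_of_mem_range π (hπ y) (hπ 0)
  set m := #{x | π x = 0}
  have hsum : ∀ f : K → ℝ, ∑ x, f (π x) = m * ∑ y, f y := by
    intro f
    rw [← sum_fiberwise univ π, mul_sum]
    refine sum_congr rfl fun y _ => ?_
    rw [sum_congr rfl (g := fun _ => f y) fun x hx => by rw [(mem_filter.1 hx).2], sum_const,
      hfib, nsmul_eq_mul]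
  have hcard : (Fintype.card G : ℝ) = m * Fintype.card K := by
    simpa using hsum fun _ => 1
  have hm : (m : ℝ) ≠ 0 := by
    intro h
    simp [h] at hcard
  rw [prob, prob, Fintype.expect_eq_sum_div_card, Fintype.expect_eq_sum_div_card,
    hsum (fun y => if p y then 1 else 0), hcard, mul_div_mul_left _ _ hm]

lemma prob_forall {A T : Type*} [Fintype A] [Fintype T] [DecidableEq T] (p : A → Prop) :
    prob (fun b : T → A => ∀ τ, p (b τ)) = prob p ^ Fintype.card T := by
  classical
  rw [prob, prob, Fintype.expect_eq_sum_div_card, Fintype.expect_eq_sum_div_card, div_pow,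
    Fintype.card_fun, Nat.cast_pow]
  congr 1
  trans ∑ b : T → A, ∏ τ, if p (b τ) then (1 : ℝ) else 0
  · refine sum_congr rfl fun b _ => ?_
    rw [prod_ite_zero]
    simp
  · rw [← Fintype.prod_sum fun (_ : T) a => if p a then (1 : ℝ) else 0]
    simp

end Probability

section Separated

variable {ι A T C : Type*} [DecidableEq ι]

/-- The colour, read off with the reference edge `f`, depends injectively on the grid coordinates
in `I`. -/
def Separated (φ : (ι → A) → C) (I : Finset ι) (f : ι → A) (u : ι → T → A) : Prop :=
  ∀ s s' : ι → T, φ (I.piecewise (fun i => u i (s i)) f) = φ (I.piecewise (fun i => u i (s' i)) f) →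
    ∀ i ∈ I, s i = s' i

lemma separated_update (φ : (ι → A) → C) {I : Finset ι} (f : ι → A) (u : ι → T → A) {j : ι}
    (b : T → A) (hj : j ∉ I) : Separated φ I f (update u j b) ↔ Separated φ I f u := by
  have h : ∀ s : ι → T, I.piecewise (fun i => update u j b i (s i)) f =
      I.piecewise (fun i => u i (s i)) f := by
    intro s
    ext i
    by_cases hi : i ∈ I
    · have : i ≠ j := fun h => hj (h ▸ hi)
      simp [hi, this]
    · simp [hi]
  simp only [Separated, h]

end Separated

section Grid

variable {ι A T C : Type*} [Fintype ι] [DecidableEq ι] [Fintype A] [AddCommGroup A] [Fintype T]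
  [DecidableEq T]

/-- All points of the grid spanned by `u` lie in `H`, where only the coordinates in `S` vary and
the other ones use the index `o`. -/
def GridIn (o : T) (H : (ι → A) → Prop) (S : Finset ι) (u : ι → T → A) : Prop :=
  ∀ s : ι → T, (∀ i, i ∉ S → s i = o) → H fun i => u i (s i)

/-- Overwriting the coordinate `j`, as a homomorphism. -/
def updateHom (B : Type*) [AddCommGroup B] (j : ι) : (ι → B) × B →+ (ι → B) where
  toFun x := update x.1 j x.2
  map_zero' := by simp
  map_add' x y := by
    ext i
    by_cases h : i = j
    · subst h; simp
    · simp [h]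

lemma prob_eq_expect_update {B : Type*} [Fintype B] [AddCommGroup B] (j : ι)
    (p : (ι → B) → Prop) : prob p = 𝔼 u, prob fun b => p (update u j b) := by
  rw [← prob_comp_hom (updateHom B j) (fun u => ⟨(u, u j), by simp [updateHom]⟩) p, prob_prod]
  rfl

lemma prob_eval (o : T) (p : A → Prop) : prob (fun b : T → A => p (b o)) = prob p :=
  prob_comp_hom (Pi.evalAddMonoidHom (fun _ : T => A) o) (fun a => ⟨fun _ => a, rfl⟩) p

lemma prob_gridIn_insert (o : T) (H : (ι → A) → Prop) {S : Finset ι} {j : ι}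
    (hj : j ∉ S) {R : (ι → T → A) → Prop} (hR : ∀ u b, R (update u j b) ↔ R u) :
    prob (fun u => GridIn o H S u ∧ R u) ^ Fintype.card T ≤
      prob (fun u => GridIn o H (insert j S) u ∧ R u) := by
  have : Nonempty T := ⟨o⟩
  set p : (ι → T → A) → A → Prop :=
    fun u a => GridIn o H S (update u j fun _ => a) ∧ R u with hp
  have h₁ : ∀ u b, (GridIn o H S (update u j b) ∧ R (update u j b)) ↔ p u (b o) := by
    intro u b
    rw [hR]
    refine and_congr_left fun _ => forall_congr' fun s => forall_congr' fun hs => ?_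
    rw [iff_iff_eq]
    congr 1
    ext i
    by_cases h : i = j
    · subst h; simp [hs i hj]
    · simp [h]
  have h₂ : ∀ u b, (GridIn o H (insert j S) (update u j b) ∧ R (update u j b)) ↔
      ∀ τ, p u (b τ) := by
    intro u b
    rw [hR]
    simp only [hp, forall_and, forall_const]
    refine and_congr_left fun _ => ⟨fun h τ s hs => ?_, fun h s hs => ?_⟩
    · convert h (update s j τ) fun i hi => ?_ using 2 with i
      · by_cases h : i = j
        · subst h; simp
        · simp [h]
      · rw [mem_insert, not_or] at hi
        simp [hi.1, hs i hi.2]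
    · convert h (s j) (update s j o) fun i hi => ?_ using 2 with i
      · by_cases h : i = j
        · subst h; simp
        · simp [h]
      · by_cases h : i = j
        · subst h; simp
        · simp [h, hs i (by simp [h, hi])]
  rw [prob_eq_expect_update j, prob_eq_expect_update j fun u => GridIn o H (insert j S) u ∧ R u]
  simp only [h₁, h₂, prob_eval o (p _), prob_forall]
  exact pow_expect_le (fun _ => prob_nonneg _) _

lemma prob_gridIn_union (o : T) (H : (ι → A) → Prop) {S : Finset ι}
    {R : (ι → T → A) → Prop} (hR : ∀ u j b, j ∉ S → (R (update u j b) ↔ R u))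
    (S' : Finset ι) (hS : Disjoint S S') :
    prob (fun u => GridIn o H S u ∧ R u) ^ Fintype.card T ^ #S' ≤
      prob (fun u => GridIn o H (S ∪ S') u ∧ R u) := by
  induction S' using Finset.induction_on with
  | empty => simp
  | insert j S' hj ih =>
    rw [disjoint_insert_right] at hS
    rw [card_insert_of_notMem hj, pow_succ, pow_mul, union_insert]
    refine (pow_le_pow_left₀ (pow_nonneg (prob_nonneg _) _) (ih hS.2) _).trans ?_
    exact prob_gridIn_insert o H (by simp [hS.1, hj]) fun u b => hR u j b hS.1

lemma prob_gridIn_empty (o : T) (H : (ι → A) → Prop) :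
    prob (fun u => GridIn o H ∅ u ∧ True) = prob H := by
  let π : (ι → T → A) →+ (ι → A) :=
    { toFun := fun u i => u i o, map_zero' := rfl, map_add' := fun _ _ => rfl }
  rw [← prob_comp_hom π (fun x => ⟨fun i _ => x i, rfl⟩) H]
  refine prob_congr fun u => ?_
  rw [and_true]
  refine ⟨fun h => h (fun _ => o) fun _ _ => rfl, fun h s hs => ?_⟩
  have : s = fun _ => o := funext fun i => hs i (notMem_empty i)
  subst this
  exact h

/-- The probability that an edge keeps its colour when its coordinates outside `I` are
resampled. -/
noncomputable def collision (φ : (ι → A) → C) (I : Finset ι) : ℝ :=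
  prob fun x : (ι → A) × (ι → A) => φ x.1 = φ (I.piecewise x.1 x.2)

lemma collision_univ (φ : (ι → A) → C) : collision φ univ = 1 :=
  prob_true fun x => by simp

lemma prob_cross_collision (φ : (ι → A) → C) (I : Finset ι) (s s' : ι → T) :
    prob (fun x : (ι → A) × (ι → T → A) =>
      φ (fun i => x.2 i (s i)) = φ (I.piecewise (fun i => x.2 i (s' i)) x.1)) =
      collision φ {i ∈ I | s i = s' i} := by
  let π : (ι → A) × (ι → T → A) →+ (ι → A) × (ι → A) :=
    { toFun := fun x => (fun i => x.2 i (s i),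
        fun i => if i ∈ I ∧ s i ≠ s' i then x.2 i (s' i) else x.1 i)
      map_zero' := by ext <;> simp
      map_add' := fun x y => by
        ext i
        · simp
        · simp only [Prod.fst_add, Prod.snd_add, Pi.add_apply]
          split_ifs <;> rfl }
  have hπ : Surjective π := by
    rintro ⟨e, g⟩
    refine ⟨(g, fun i τ => if τ = s i then e i else g i), ?_⟩
    ext i
    · simp [π]
    · simp only [π, AddMonoidHom.coe_mk, ZeroHom.coe_mk]
      split_ifs with h₁ h₂
      · exact absurd h₂.symm h₁.2
      · rfl
      · rfl
  rw [collision, ← prob_comp_hom π hπ]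
  refine prob_congr fun x => ?_
  rw [iff_iff_eq]
  congr 2
  ext i
  by_cases hi : i ∈ I <;> by_cases hs : s i = s' i <;> simp [π, hi, hs, piecewise]

lemma prob_not_separated_le (o : T) (φ : (ι → A) → C) (I : Finset ι) {η : ℝ} (hη₀ : 0 ≤ η)
    (hη : ∀ J, J ⊂ I → collision φ J ≤ η) :
    prob (fun x : (ι → A) × (ι → T → A) =>
      GridIn o (fun e => φ e = φ (I.piecewise e x.1)) I x.2 ∧ ¬ Separated φ I x.1 x.2) ≤
      (Fintype.card T : ℝ) ^ (2 * Fintype.card ι) * η := by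
  classical
  set P : Finset ((ι → T) × (ι → T)) := {p | ∃ i ∈ I, p.1 i ≠ p.2 i}
  refine (prob_le_sum (s := P) (q := fun p x => φ (fun i => x.2 i (I.piecewise p.1 (fun _ => o) i)) =
    φ (I.piecewise (fun i => x.2 i (p.2 i)) x.1)) ?_).trans ?_
  · rintro ⟨f, u⟩ ⟨hg, hs⟩
    simp only [Separated, not_forall] at hs
    obtain ⟨s, s', hφ, i, hi, hne⟩ := hs
    refine ⟨(s, s'), by simpa [P] using ⟨i, hi, hne⟩, ?_⟩
    dsimp only
    rw [← hφ]
    refine (hg (I.piecewise s fun _ => o) fun i hi => by simp [hi]).trans ?_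
    congr 1
    ext i
    by_cases hi : i ∈ I <;> simp [hi]
  · refine (sum_le_card_nsmul P _ η fun p hp => ?_).trans ?_
    · rw [prob_cross_collision]
      obtain ⟨i, hi, hne⟩ := (mem_filter.1 hp).2
      refine hη _ ((ssubset_iff_of_subset (filter_subset _ _)).2 ⟨i, hi, ?_⟩)
      simp [hi, hne]
    · rw [nsmul_eq_mul]
      refine mul_le_mul_of_nonneg_right ?_ hη₀
      have : #P ≤ Fintype.card T ^ (2 * Fintype.card ι) := by
        refine (card_le_univ P).trans_eq ?_
        rw [Fintype.card_prod, Fintype.card_fun, ← pow_add, two_mul]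
      exact_mod_cast this

lemma prob_apply_eq_apply (i : ι) {a b : T} (hab : a ≠ b) :
    prob (fun u : ι → T → A => u i a = u i b) = (Fintype.card A : ℝ)⁻¹ := by
  classical
  let π : (ι → T → A) →+ A :=
    { toFun := fun u => u i a - u i b
      map_zero' := by simp
      map_add' := fun u v => by simp only [Pi.add_apply]; abel }
  have hπ : Surjective π := fun x => ⟨fun _ τ => if τ = a then x else 0, by simp [π, hab.symm]⟩
  have h := prob_comp_hom π hπ fun x => x = 0
  rw [prob_congr (q := fun u => π u = 0) fun u => by simp [π, sub_eq_zero], h]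
  simp [prob]

lemma prob_not_injective_le :
    prob (fun u : ι → T → A => ¬ ∀ i, Injective (u i)) ≤
      (Fintype.card ι * Fintype.card T ^ 2 : ℝ) * (Fintype.card A : ℝ)⁻¹ := by
  set P : Finset (ι × T × T) := {x | x.2.1 ≠ x.2.2}
  refine (prob_le_sum (s := P) (q := fun x u => u x.1 x.2.1 = u x.1 x.2.2) ?_).trans ?_
  · intro u hu
    simp only [Injective, not_forall] at hu
    obtain ⟨i, a, b, h, hne⟩ := hu
    exact ⟨(i, a, b), by simpa [P] using hne, h⟩
  · rw [sum_congr rfl fun x hx => prob_apply_eq_apply x.1 (mem_filter.1 hx).2, sum_const,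
      nsmul_eq_mul]
    refine mul_le_mul_of_nonneg_right ?_ (by positivity)
    have : #P ≤ Fintype.card ι * Fintype.card T ^ 2 := by
      refine (card_le_univ P).trans_eq ?_
      rw [Fintype.card_prod, Fintype.card_prod, sq]
    exact_mod_cast this

theorem exists_canonical_grid (o : T) (φ : (ι → A) → C) (I : Finset ι) {δ η : ℝ} (hδ₀ : 0 ≤ δ)
    (hη₀ : 0 ≤ η) (hδ : δ ≤ collision φ I) (hη : ∀ J, J ⊂ I → collision φ J ≤ η)
    (hβ : 0 ≤ δ ^ Fintype.card T ^ #I - (Fintype.card T : ℝ) ^ (2 * Fintype.card ι) * η)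
    (hA : (Fintype.card ι * Fintype.card T ^ 2 : ℝ) * (Fintype.card A : ℝ)⁻¹ <
      (δ ^ Fintype.card T ^ #I - (Fintype.card T : ℝ) ^ (2 * Fintype.card ι) * η) ^
        Fintype.card T ^ #Iᶜ) :
    ∃ u : ι → T → A, (∀ i, Injective (u i)) ∧ ∀ s s' : ι → T,
      φ (fun i => u i (s i)) = φ (fun i => u i (s' i)) ↔ ∀ i ∈ I, s i = s' i := by
  set H : (ι → A) → (ι → A) → Prop := fun f e => φ e = φ (I.piecewise e f) with hH
  have hf : ∀ f, prob (H f) ^ Fintype.card T ^ #I ≤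
      prob (fun u : ι → T → A => GridIn o (H f) I u ∧ Separated φ I f u) +
      prob (fun u : ι → T → A => GridIn o (H f) I u ∧ ¬ Separated φ I f u) := by
    intro f
    have h := prob_gridIn_union (A := A) (T := T) o (H f) (S := ∅) (R := fun _ => True)
      (fun _ _ _ _ => Iff.rfl) I (disjoint_empty_left I)
    rw [prob_gridIn_empty, empty_union] at h
    exact h.trans (prob_le_add fun u hu => by tauto)
  have hδ' : δ ≤ 𝔼 f, prob (H f) := by rwa [collision, prob_prod'] at hδ
  have hsum := (pow_le_pow_left₀ hδ₀ hδ' (Fintype.card T ^ #I)).trans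
    ((pow_expect_le (fun f => prob_nonneg (H f)) _).trans (expect_le_expect fun f _ => hf f))
  rw [expect_add_distrib] at hsum
  have hns := prob_not_separated_le o φ I hη₀ hη
  rw [prob_prod] at hns
  obtain ⟨f, -, hf'⟩ := exists_le_of_le_expect (univ_nonempty (α := ι → A))
    (sub_le_iff_le_add.2 (hsum.trans (add_le_add_right hns _)))
  have hgrid := prob_gridIn_union o (H f) (S := I) (R := Separated φ I f)
    (fun u j b hj => separated_update φ f u b hj) Iᶜ disjoint_compl_right
  rw [union_compl] at hgrid
  have hlt := (prob_not_injective_le.trans_lt hA).trans_le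
    ((pow_le_pow_left₀ hβ hf' _).trans hgrid)
  have hpos : 0 < prob fun u : ι → T → A =>
      (GridIn o (H f) univ u ∧ Separated φ I f u) ∧ ∀ i, Injective (u i) := by
    have := prob_le_add (p := fun u : ι → T → A => GridIn o (H f) univ u ∧ Separated φ I f u)
      (q := fun u => (GridIn o (H f) univ u ∧ Separated φ I f u) ∧ ∀ i, Injective (u i))
      (r := fun u => ¬ ∀ i, Injective (u i)) fun u hu => by tauto
    linarith
  obtain ⟨u, ⟨hu, hsep⟩, hinj⟩ := exists_of_prob_pos hpos
  have hcol : ∀ s : ι → T, φ (fun i => u i (s i)) = φ (I.piecewise (fun i => u i (s i)) f) :=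
    fun s => hu s fun i hi => absurd (mem_univ i) hi
  refine ⟨u, hinj, fun s s' => ⟨fun h => hsep s s' (by rw [← hcol, ← hcol, h]), fun h => ?_⟩⟩
  rw [hcol, hcol s']
  congr 1
  ext i
  by_cases hi : i ∈ I
  · simp [hi, h i hi]
  · simp [hi]

end Grid

section Exponents

/-- The exponents of the collision thresholds. -/
def exponent (k t : ℕ) : ℕ → ℕ
  | 0 => 0
  | m + 1 => exponent k t m * t ^ (k - 1) + (2 * k + 1)

lemma exponent_mono {k t : ℕ} (ht : 1 ≤ t) : Monotone (exponent k t) :=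
  monotone_nat_of_le_succ fun m =>
    (Nat.le_mul_of_pos_right _ (by positivity)).trans (Nat.le_add_right _ _)

lemma exponent_succ_lt {k t : ℕ} (hk : 2 ≤ k) (ht : 2 * k + 2 ≤ t) (m : ℕ) :
    exponent k t (m + 1) + 1 ≤ t ^ ((k - 1) * m + 1) := by
  induction m with
  | zero => simp [exponent]; omega
  | succ m ih =>
    have ht' : t ≤ t ^ (k - 1) := Nat.le_self_pow (by omega) t
    calc exponent k t (m + 1 + 1) + 1
        = exponent k t (m + 1) * t ^ (k - 1) + (2 * k + 2) := rfl
      _ ≤ (exponent k t (m + 1) + 1) * t ^ (k - 1) := by rw [add_mul]; omega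
      _ ≤ t ^ ((k - 1) * m + 1) * t ^ (k - 1) := Nat.mul_le_mul_right _ ih
      _ = t ^ ((k - 1) * (m + 1) + 1) := by rw [← pow_add]; congr 1; ring

lemma exponent_bound {k t : ℕ} (hk : 4 ≤ k) (ht : 2 * k + 4 ≤ t) :
    (exponent k t k + 1) * t ^ k + 3 ≤ t ^ k ^ 2 := by
  obtain ⟨m, rfl⟩ : ∃ m, k = m + 1 := ⟨k - 1, by omega⟩
  have h := exponent_succ_lt (by omega) (show 2 * (m + 1) + 2 ≤ t by omega) m
  rw [Nat.add_sub_cancel] at h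
  calc (exponent (m + 1) t (m + 1) + 1) * t ^ (m + 1) + 3
      ≤ t ^ (m * m + 1) * t ^ (m + 1) + 3 := by gcongr
    _ = t ^ (m * m + m + 2) + 3 := by rw [← pow_add]; congr 2; ring
    _ ≤ t ^ (m * m + m + 2) * t := by
      have : 1 ≤ t ^ (m * m + m + 2) := Nat.one_le_pow _ _ (by omega)
      nlinarith
    _ = t ^ (m * m + m + 3) := rfl
    _ ≤ t ^ (m + 1) ^ 2 := Nat.pow_le_pow_right (by omega) (by nlinarith)

end Exponents

theorem exists_canonical_grid_of_card {C : Type*} {k t n : ℕ} (hk : 4 ≤ k) (ht : 2 * k + 4 ≤ t)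
    (hn : n = t ^ t ^ k ^ 2) (φ : (Fin k → ZMod n) → C) :
    ∃ (u : Fin k → Fin t → ZMod n) (I : Finset (Fin k)), (∀ i, Injective (u i)) ∧
      ∀ s s' : Fin k → Fin t,
        φ (fun i => u i (s i)) = φ (fun i => u i (s' i)) ↔ ∀ i ∈ I, s i = s' i := by
  have ht₀ : 0 < t := by omega
  have : NeZero n := ⟨by rw [hn]; positivity⟩
  have htR : (1 : ℝ) < t := by exact_mod_cast (by omega : 1 < t)
  have htR₀ : (0 : ℝ) < t := by linarith
  set x : ℝ := (t : ℝ)⁻¹ with hx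
  have hx₀ : 0 < x := inv_pos.2 htR₀
  have hx₁ : x ≤ 1 := inv_le_one_of_one_le₀ htR.le
  have htx : (t : ℝ) * x = 1 := mul_inv_cancel₀ htR₀.ne'
  have hx₂ : 2 * x ≤ 1 := by
    rw [← htx]; gcongr; exact_mod_cast (by omega : 2 ≤ t)
  obtain ⟨I, hI, hmin⟩ := exists_min_image
    ({I | x ^ exponent k t (k - #I) ≤ collision φ I} : Finset (Finset (Fin k))) card
    ⟨univ, by simp [collision_univ, exponent]⟩
  replace hI := (mem_filter.1 hI).2
  have hIk : #I ≤ k := (card_le_univ I).trans_eq (Fintype.card_fin k)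
  set D := exponent k t (k - #I) with hD
  have hDt : D * t ^ #I ≤ D * t ^ (k - 1) := by
    rcases hIk.eq_or_lt with h | h
    · simp [hD, h, exponent]
    · exact Nat.mul_le_mul_left _ (Nat.pow_le_pow_right ht₀ (by omega))
  have hJ : ∀ J, J ⊂ I → collision φ J ≤ x ^ (D * t ^ #I + (2 * k + 1)) := by
    intro J hJI
    have hcard := card_lt_card hJI
    have hlt : collision φ J < x ^ exponent k t (k - #J) := by
      by_contra! h
      exact absurd (hmin J (by simpa using h)) (by omega)
    refine hlt.le.trans (pow_le_pow_of_le_one hx₀.le hx₁ ?_)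
    calc D * t ^ #I + (2 * k + 1) ≤ exponent k t (k - #I + 1) := Nat.add_le_add_right hDt _
      _ ≤ exponent k t (k - #J) := exponent_mono ht₀ (by omega)
  have hβ : x ^ (D * t ^ #I + 1) ≤ (x ^ D) ^ t ^ #I -
      (t : ℝ) ^ (2 * k) * x ^ (D * t ^ #I + (2 * k + 1)) := by
    have h₁ : (t : ℝ) ^ (2 * k) * x ^ (D * t ^ #I + (2 * k + 1)) = x ^ (D * t ^ #I) * x := by
      rw [pow_add, pow_succ x (2 * k)]
      calc _ = x ^ (D * t ^ #I) * ((t : ℝ) * x) ^ (2 * k) * x := by rw [mul_pow]; ring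
        _ = _ := by rw [htx]; simp
    rw [h₁, ← pow_mul, pow_succ]
    nlinarith [pow_pos hx₀ (D * t ^ #I)]
  have hβ₀ := (pow_pos hx₀ (D * t ^ #I + 1)).le.trans hβ
  have hexp : (D * t ^ #I + 1) * t ^ #Iᶜ + 3 ≤ t ^ k ^ 2 := by
    refine le_trans ?_ (exponent_bound hk ht)
    have h₁ : t ^ #I * t ^ #Iᶜ = t ^ k := by
      rw [← pow_add, card_add_card_compl, Fintype.card_fin]
    have h₂ : D ≤ exponent k t k := exponent_mono ht₀ (Nat.sub_le _ _)
    have h₃ : 1 ≤ t ^ #I := Nat.one_le_pow _ _ ht₀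
    calc (D * t ^ #I + 1) * t ^ #Iᶜ + 3 ≤ ((D + 1) * t ^ #I) * t ^ #Iᶜ + 3 := by
          gcongr; nlinarith
      _ = (D + 1) * t ^ k + 3 := by rw [mul_assoc, h₁]
      _ ≤ _ := by gcongr
  have hA : ((k : ℝ) * t ^ 2) * (n : ℝ)⁻¹ < ((x ^ D) ^ t ^ #I -
      (t : ℝ) ^ (2 * k) * x ^ (D * t ^ #I + (2 * k + 1))) ^ t ^ #Iᶜ := by
    refine lt_of_lt_of_le ?_ (pow_le_pow_left₀ (by positivity) hβ _)
    rw [← pow_mul]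
    have h₁ : (n : ℝ)⁻¹ ≤ x ^ ((D * t ^ #I + 1) * t ^ #Iᶜ) * x ^ 3 := by
      rw [← pow_add, hn, Nat.cast_pow, ← inv_pow]
      exact pow_le_pow_of_le_one hx₀.le hx₁ hexp
    have h₂ : (k : ℝ) * x < 1 := by
      rw [← htx]
      exact mul_lt_mul_of_pos_right (by exact_mod_cast (by omega : k < t)) hx₀
    calc ((k : ℝ) * t ^ 2) * (n : ℝ)⁻¹
        ≤ ((k : ℝ) * t ^ 2) * (x ^ ((D * t ^ #I + 1) * t ^ #Iᶜ) * x ^ 3) := by gcongr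
      _ = x ^ ((D * t ^ #I + 1) * t ^ #Iᶜ) * (k * x) * ((t : ℝ) * x) ^ 2 := by ring
      _ = x ^ ((D * t ^ #I + 1) * t ^ #Iᶜ) * (k * x) := by rw [htx]; ring
      _ < x ^ ((D * t ^ #I + 1) * t ^ #Iᶜ) * 1 := by gcongr
      _ = _ := mul_one _
  have hgrid := exists_canonical_grid (T := Fin t) ⟨0, ht₀⟩ φ I (pow_nonneg hx₀.le D)
    (pow_nonneg hx₀.le _) hI hJ (by simpa only [Fintype.card_fin] using hβ₀)
    (by simpa only [Fintype.card_fin, ZMod.card] using hA)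
  obtain ⟨u, hu, hs⟩ := hgrid
  exact ⟨u, I, hu, hs⟩

end CanonicalRamsey

/-- **Canonical Ramsey numbers for k-partite k-uniform hypergraphs, `k ≥ 4`.**
For every `k ≥ 4` and all sufficiently large `t`, every colouring `φ` of the edges
of the complete `k`-partite `k`-uniform hypergraph with all classes of size
`n = t^(t^(k^2))` yields a canonical copy of `K^(k)_{t,…,t}`: classes `U i ⊆ V i`
of size `t` and a set `J ⊆ [k]` such that two edges of the copy get the same colour
iff they agree on the coordinates in `J`.
Edges are encoded as transversals `e : Fin k → ℕ` with `e i ∈ V i`. -/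
theorem canonical_ramsey_partite (k : ℕ) (hk : 4 ≤ k) :
    ∃ t₀ : ℕ, ∀ t : ℕ, t₀ ≤ t →
      ∀ V : Fin k → Finset ℕ, (∀ i, (V i).card = t ^ (t ^ (k ^ 2))) →
        ∀ φ : (Fin k → ℕ) → ℕ,
          ∃ (U : Fin k → Finset ℕ) (J : Finset (Fin k)),
            (∀ i, U i ⊆ V i) ∧ (∀ i, (U i).card = t) ∧
            ∀ e ∈ Fintype.piFinset U, ∀ e' ∈ Fintype.piFinset U,
              (φ e = φ e' ↔ ∀ j ∈ J, e j = e' j) := by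
  refine ⟨2 * k + 4, fun t ht V hV φ => ?_⟩
  obtain ⟨n, hn⟩ : ∃ n, n = t ^ t ^ k ^ 2 := ⟨_, rfl⟩
  have : NeZero n := ⟨by rw [hn]; exact pow_ne_zero _ (by omega)⟩
  have v : ∀ i, ZMod n ≃ V i := fun i =>
    Fintype.equivOfCardEq (by rw [ZMod.card, Fintype.card_coe, hV, hn])
  obtain ⟨u, I, hu, hφ⟩ := CanonicalRamsey.exists_canonical_grid_of_card hk ht hn
    fun x => φ fun i => v i (x i)
  set w : Fin k → Fin t → ℕ := fun i τ => v i (u i τ) with hw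
  have hwi : ∀ i, Function.Injective (w i) := fun i =>
    Subtype.val_injective.comp ((v i).injective.comp (hu i))
  refine ⟨fun i => Finset.univ.image (w i), I, fun i => ?_, fun i => ?_, fun e he e' he' => ?_⟩
  · exact Finset.image_subset_iff.2 fun τ _ => (v i (u i τ)).2
  · rw [Finset.card_image_of_injective _ (hwi i), Finset.card_univ, Fintype.card_fin]
  · simp only [Fintype.mem_piFinset, Finset.mem_image, Finset.mem_univ, true_and] at he he'
    choose s hs using he
    choose s' hs' using he'
    obtain rfl : (fun i => w i (s i)) = e := funext hs
    obtain rfl : (fun i => w i (s' i)) = e' := funext hs'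
    refine (hφ s s').trans (forall₂_congr fun i _ => ?_)
    exact (hwi i).eq_iff.symm
end

section
/- Let k ≥ 1 and let H = (V₁ ∪̇ … ∪̇ V_k, E) be a k-partite k-uniform hypergraph of density d = |E| / (|V₁|⋯|V_k|). If positive integers t₁,…,t_k satisfy (d/4^{k−1})^{∏_{j<i} t_j} · |V_i| ≥ 2t_i for every i ∈ [k], then the number K^{(k)}_{t₁,…,t_k}(H) of complete k-partite k-uniform subhypergraphs of H with vertex classes U_j ⊆ V_j, |U_j| = t_j for every j ∈ [k], satisfies K^{(k)}_{t₁,…,t_k}(H) > (d/2^{2k−1})^{∏_{j∈[k]} t_j} · ∏_{j∈[k]} C(|V_j|, t_j), where C(·,·) denotes the binomial coefficient. -/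
open Finset

/-- The density of a `k`-partite `k`-uniform hypergraph with edge set `E`. -/
noncomputable def partiteDensity {k : ℕ} (V : Fin k → Finset ℕ) (E : Finset (Fin k → ℕ)) : ℝ :=
  (E.card : ℝ) / ∏ i, ((V i).card : ℝ)

/-- The number of complete `k`-partite subhypergraphs with classes of sizes `t i`. -/
def completePartiteCount {k : ℕ} (V : Fin k → Finset ℕ) (E : Finset (Fin k → ℕ))
    (t : Fin k → ℕ) : ℕ :=
  ((Fintype.piFinset fun i => (V i).powersetCard (t i)).filter
    fun U => Fintype.piFinset U ⊆ E).card

/-- The common link of a set `U` of vertices of the first class. -/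
def commonLink {k : ℕ} (V : Fin (k + 1) → Finset ℕ) (E : Finset (Fin (k + 1) → ℕ))
    (U : Finset ℕ) : Finset (Fin k → ℕ) :=
  (Fintype.piFinset (Fin.tail V)).filter fun x => ∀ u ∈ U, (Fin.cons u x : Fin (k + 1) → ℕ) ∈ E

lemma partiteDensity_nonneg {k : ℕ} (V : Fin k → Finset ℕ) (E : Finset (Fin k → ℕ)) :
    0 ≤ partiteDensity V E := by
  unfold partiteDensity; positivity

lemma partiteDensity_le_one {k : ℕ} {V : Fin k → Finset ℕ} {E : Finset (Fin k → ℕ)}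
    (hE : E ⊆ Fintype.piFinset V) : partiteDensity V E ≤ 1 := by
  unfold partiteDensity
  refine div_le_one_of_le₀ ?_ (by positivity)
  have h := card_le_card hE
  rw [Fintype.card_piFinset] at h
  exact_mod_cast h

lemma pow_mul_card_lt_sum_pow {ι : Type*} (s : Finset ι) (g : ι → ℝ) (hg : ∀ x ∈ s, 0 ≤ g x)
    {c : ℝ} (hc : 0 ≤ c) (h : c * s.card < ∑ x ∈ s, g x) {n : ℕ} (hn : 1 ≤ n) :
    c ^ n * s.card < ∑ x ∈ s, g x ^ n := by
  have hs : 0 < (s.card : ℝ) := by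
    rcases s.eq_empty_or_nonempty with rfl | hs
    · simp at h
    · exact_mod_cast hs.card_pos
  obtain ⟨n, rfl⟩ := Nat.exists_eq_add_of_le' hn
  calc c ^ (n + 1) * s.card = (c * s.card) ^ (n + 1) / s.card ^ n := by
        rw [eq_div_iff (by positivity)]; ring
    _ < (∑ x ∈ s, g x) ^ (n + 1) / s.card ^ n := by gcongr
    _ ≤ _ := pow_sum_div_card_le_sum_pow hg n

lemma choose_mul_card_lt_sum_choose {ι : Type*} (s : Finset ι) (f : ι → ℕ) {d : ℝ} {n t : ℕ}
    (hd : 0 ≤ d) (hs : s.Nonempty) (ht : 1 ≤ t) (hdn : 2 * (t : ℝ) ≤ d * n)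
    (hf : ∑ x ∈ s, (f x : ℝ) = d * n * s.card) :
    (d / 2) ^ t * n.choose t * s.card < ∑ x ∈ s, ((f x).choose t : ℝ) := by
  have hs' : 0 < (s.card : ℝ) := by exact_mod_cast hs.card_pos
  have hsum : d * n / 2 * s.card < ∑ x ∈ s, ((f x + 1 - t : ℕ) : ℝ) := by
    calc d * n / 2 * s.card < (d * n + 1 - t) * s.card := by
          gcongr; linarith
      _ = ∑ x ∈ s, ((f x : ℝ) + 1 - t) := by
          simp only [sum_sub_distrib, sum_add_distrib, hf, sum_const, nsmul_eq_mul]; ring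
      _ ≤ _ := by
          gcongr with x
          rw [sub_le_iff_le_add]
          exact_mod_cast (by omega : f x + 1 ≤ f x + 1 - t + t)
  have hpow := pow_mul_card_lt_sum_pow s _ (fun _ _ => Nat.cast_nonneg _) (by positivity) hsum ht
  have hfac : 0 < (t.factorial : ℝ) := by positivity
  refine lt_of_mul_lt_mul_left ?_ hfac.le
  calc (t.factorial : ℝ) * ((d / 2) ^ t * n.choose t * s.card)
      = (d / 2) ^ t * (n.descFactorial t : ℝ) * s.card := by
        rw [Nat.descFactorial_eq_factorial_mul_choose]; push_cast; ring
    _ ≤ (d / 2) ^ t * (n : ℝ) ^ t * s.card := by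
        gcongr
        exact_mod_cast Nat.descFactorial_le_pow n t
    _ = (d * n / 2) ^ t * s.card := by rw [← mul_pow]; ring
    _ < _ := hpow
    _ ≤ ∑ x ∈ s, ((f x).descFactorial t : ℝ) := by
        gcongr with x
        exact_mod_cast Nat.pow_sub_le_descFactorial (f x) t
    _ = _ := by
        rw [mul_sum]
        refine sum_congr rfl fun x _ => ?_
        rw [Nat.descFactorial_eq_factorial_mul_choose]; push_cast; rfl

lemma sum_card_commonLink {k : ℕ} (V : Fin (k + 1) → Finset ℕ) (E : Finset (Fin (k + 1) → ℕ))
    (t : ℕ) :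
    ∑ U ∈ (V 0).powersetCard t, (commonLink V E U).card =
      ∑ x ∈ Fintype.piFinset (Fin.tail V),
        ((V 0).filter fun v => (Fin.cons v x : Fin (k + 1) → ℕ) ∈ E).card.choose t := by
  simp only [commonLink, card_filter _ (Fintype.piFinset _)]
  rw [sum_comm]
  refine sum_congr rfl fun x _ => ?_
  rw [← card_filter, ← card_powersetCard]
  congr 1
  ext U
  simp only [mem_filter, mem_powersetCard, subset_iff]
  grind

lemma sum_card_filter_cons_mem {k : ℕ} {V : Fin (k + 1) → Finset ℕ}
    {E : Finset (Fin (k + 1) → ℕ)} (hE : E ⊆ Fintype.piFinset V) :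
    ∑ x ∈ Fintype.piFinset (Fin.tail V),
      ((V 0).filter fun v => (Fin.cons v x : Fin (k + 1) → ℕ) ∈ E).card = E.card := by
  rw [card_eq_sum_card_fiberwise (f := Fin.tail) (t := Fintype.piFinset (Fin.tail V))
    (fun e he => (Fin.mem_piFinset_iff_zero_tail.1 (hE he)).2)]
  refine sum_congr rfl fun x _ => ?_
  refine card_nbij' (fun v => Fin.cons v x) (fun e => e 0) ?_ ?_ ?_ ?_
  · intro v hv
    simp_all
  · intro e he
    simp only [coe_filter, Set.mem_ofPred_eq] at he ⊢
    obtain ⟨he, rfl⟩ := he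
    exact ⟨(Fin.mem_piFinset_iff_zero_tail.1 (hE he)).1, by rwa [Fin.cons_self_tail]⟩
  · intro v _
    simp
  · intro e he
    simp only [coe_filter, Set.mem_ofPred_eq] at he
    obtain ⟨-, rfl⟩ := he
    exact Fin.cons_self_tail e

lemma piFinset_subset_iff_tail_subset_commonLink {k : ℕ} {V U : Fin (k + 1) → Finset ℕ}
    {E : Finset (Fin (k + 1) → ℕ)} (hU : ∀ i, U i ⊆ V i) :
    Fintype.piFinset U ⊆ E ↔ Fintype.piFinset (Fin.tail U) ⊆ commonLink V E (U 0) := by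
  constructor
  · intro h x hx
    have hxU := Fintype.mem_piFinset.1 hx
    refine mem_filter.2
      ⟨Fintype.mem_piFinset.2 fun i => hU i.succ (hxU i), fun u hu => h ?_⟩
    rw [Fin.mem_piFinset_iff_zero_tail, Fin.cons_zero, Fin.tail_cons]
    exact ⟨hu, hx⟩
  · intro h e he
    obtain ⟨he0, het⟩ := Fin.mem_piFinset_iff_zero_tail.1 he
    have := (mem_filter.1 (h het)).2 _ he0
    rwa [Fin.cons_self_tail] at this

lemma completePartiteCount_succ {k : ℕ} (V : Fin (k + 1) → Finset ℕ)
    (E : Finset (Fin (k + 1) → ℕ)) (t : Fin (k + 1) → ℕ) :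
    completePartiteCount V E t =
      ∑ U ∈ (V 0).powersetCard (t 0),
        completePartiteCount (Fin.tail V) (commonLink V E U) (Fin.tail t) := by
  unfold completePartiteCount
  rw [card_eq_sum_card_fiberwise (f := fun U => U 0) (t := (V 0).powersetCard (t 0))
    (fun U hU => (Fintype.mem_piFinset.1 (mem_filter.1 hU).1) 0)]
  refine sum_congr rfl fun W hW => ?_
  have hW' := mem_powersetCard.1 hW
  refine card_nbij' Fin.tail (fun U => Fin.cons W U) ?_ ?_ ?_ ?_
  · intro U hU
    simp only [coe_filter, Set.mem_ofPred_eq, mem_filter, Fintype.mem_piFinset] at hU ⊢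
    obtain ⟨⟨hU, hUE⟩, rfl⟩ := hU
    exact ⟨fun i => hU i.succ, (piFinset_subset_iff_tail_subset_commonLink
      (fun i => (mem_powersetCard.1 (hU i)).1)).1 hUE⟩
  · intro U hU
    simp only [coe_filter, Set.mem_ofPred_eq, mem_filter, Fintype.mem_piFinset] at hU ⊢
    obtain ⟨hU, hUE⟩ := hU
    have hmem : ∀ i, (Fin.cons W U : Fin (k + 1) → Finset ℕ) i ∈ (V i).powersetCard (t i) :=
      Fin.cases hW hU
    exact ⟨⟨hmem, (piFinset_subset_iff_tail_subset_commonLink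
      (fun i => (mem_powersetCard.1 (hmem i)).1)).2 (by simpa using hUE)⟩, rfl⟩
  · intro U hU
    simp only [coe_filter, Set.mem_ofPred_eq] at hU
    obtain ⟨-, rfl⟩ := hU
    exact Fin.cons_self_tail U
  · intro U _
    exact Fin.tail_cons (α := fun _ => Finset ℕ) W U

/-- Threshold below which the links are discarded in the induction on the uniformity. -/
lemma exists_link_threshold (k : ℕ) {d : ℝ} (hd : 0 ≤ d) {t : ℕ} (ht : 1 ≤ t) :
    ∃ τ : ℝ, 0 ≤ τ ∧ (1 ≤ k → (d / 4 ^ k) ^ t ≤ τ / 4 ^ (k - 1)) ∧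
      (d / 2 ^ (2 * k + 1)) ^ t ≤ ((d / 2) ^ t - τ) / 2 ^ (2 * k - 1) := by
  rcases k with _ | m
  · exact ⟨0, le_rfl, by simp, by simp⟩
  obtain ⟨s, rfl⟩ := Nat.exists_eq_add_of_le' ht
  refine ⟨4 ^ m * (d / 4 ^ (m + 1)) ^ (s + 1), by positivity, fun _ => ?_, ?_⟩
  · rw [Nat.add_sub_cancel, mul_div_cancel_left₀ _ (by positivity)]
  have h1 : (4 : ℝ) ^ m * (d / 4 ^ (m + 1)) ^ (s + 1) ≤ (d / 2) ^ (s + 1) / 2 := by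
    have h : (2 : ℝ) ^ (2 * m + s + 2) ≤ 2 ^ (2 * (m + 1) * (s + 1)) :=
      pow_le_pow_right₀ (by norm_num) (by nlinarith)
    have h4 : (4 : ℝ) ^ m = 2 ^ (2 * m) := by rw [pow_mul]; norm_num
    have h4' : (4 : ℝ) ^ (m + 1) = 2 ^ (2 * (m + 1)) := by rw [pow_mul]; norm_num
    rw [h4, h4', div_pow, div_pow, div_div, ← mul_div_assoc, ← pow_mul, ← pow_succ,
      div_le_div_iff₀ (by positivity) (by positivity)]
    calc (2 : ℝ) ^ (2 * m) * d ^ (s + 1) * 2 ^ (s + 1 + 1)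
        = d ^ (s + 1) * 2 ^ (2 * m + s + 2) := by ring
      _ ≤ _ := by gcongr
  have h2 : (d / 2 ^ (2 * (m + 1) + 1)) ^ (s + 1) ≤
      (d / 2) ^ (s + 1) / 2 / 2 ^ (2 * (m + 1) - 1) := by
    rw [show 2 * (m + 1) - 1 = 2 * m + 1 by omega, div_pow, div_pow, div_div, div_div, ← pow_mul]
    gcongr
    calc (2 : ℝ) ^ (s + 1) * (2 * 2 ^ (2 * m + 1)) = 2 ^ (s + 2 * m + 3) := by ring
      _ ≤ _ := pow_le_pow_right₀ (by norm_num) (by nlinarith)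
  refine h2.trans ?_
  gcongr
  linarith

lemma lt_completePartiteCount_succ {k : ℕ}
    (ih : ∀ (V : Fin k → Finset ℕ) (E : Finset (Fin k → ℕ)) (t : Fin k → ℕ),
      E ⊆ Fintype.piFinset V → (∀ i, 1 ≤ t i) →
      (∀ i, 2 * (t i : ℝ) ≤
        (partiteDensity V E / 4 ^ (k - 1)) ^ (∏ j ∈ univ.filter (· < i), t j) * (V i).card) →
      (partiteDensity V E / 2 ^ (2 * k - 1)) ^ (∏ i, t i) * ∏ i, ((V i).card.choose (t i) : ℝ) ≤
        completePartiteCount V E t)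
    (V : Fin (k + 1) → Finset ℕ) (E : Finset (Fin (k + 1) → ℕ)) (t : Fin (k + 1) → ℕ)
    (hE : E ⊆ Fintype.piFinset V) (ht : ∀ i, 1 ≤ t i)
    (hcond : ∀ i, 2 * (t i : ℝ) ≤
      (partiteDensity V E / 4 ^ k) ^ (∏ j ∈ univ.filter (· < i), t j) * (V i).card) :
    (partiteDensity V E / 2 ^ (2 * k + 1)) ^ (∏ i, t i) * ∏ i, ((V i).card.choose (t i) : ℝ) <
      completePartiteCount V E t := by
  set d := partiteDensity V E with hd
  have hd0 : 0 ≤ d := partiteDensity_nonneg V E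
  have hd1 : d ≤ 1 := partiteDensity_le_one hE
  have hd4 : d / 4 ^ k ≤ d := div_le_self hd0 (one_le_pow₀ (by norm_num))
  have hVt : ∀ i, t i ≤ (V i).card := by
    intro i
    have h : 2 * (t i : ℝ) ≤ (V i).card := (hcond i).trans
      (mul_le_of_le_one_left (by positivity) (pow_le_one₀ (by positivity) (hd4.trans hd1)))
    have h' : 2 * t i ≤ (V i).card := by exact_mod_cast h
    omega
  have hV : ∀ i, 0 < ((V i).card : ℝ) := fun i => by exact_mod_cast (ht i).trans (hVt i)
  obtain ⟨τ, hτ0, hτ1, hτ2⟩ := exists_link_threshold k hd0 (ht 0)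
  set M : ℝ := ∏ i, ((Fin.tail V i).card : ℝ) with hM
  have hM0 : 0 < M := prod_pos fun i _ => hV i.succ
  have hcardM : ((Fintype.piFinset (Fin.tail V)).card : ℝ) = M := by
    rw [Fintype.card_piFinset]; push_cast; rfl
  have hEd : (E.card : ℝ) = d * (V 0).card * M := by
    rw [hd, partiteDensity, Fin.prod_univ_succ, mul_assoc]
    exact (div_mul_cancel₀ _ (mul_pos (hV 0) hM0).ne').symm
  have hlink : (d / 2) ^ t 0 * (V 0).card.choose (t 0) <
      ∑ U ∈ (V 0).powersetCard (t 0), partiteDensity (Fin.tail V) (commonLink V E U) := by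
    simp only [partiteDensity, ← sum_div]
    rw [lt_div_iff₀ hM0, ← hcardM, ← Nat.cast_sum, sum_card_commonLink, Nat.cast_sum]
    refine choose_mul_card_lt_sum_choose _ _ hd0 ?_ (ht 0) ?_ ?_
    · rw [← card_pos]; exact_mod_cast hcardM ▸ hM0
    · refine (hcond 0).trans ?_
      simp only [Fin.not_lt_zero, filter_false, prod_empty, pow_one]
      gcongr
    · rw [hcardM, ← hEd, ← Nat.cast_sum, sum_card_filter_cons_mem hE]
  set P := ∏ i, Fin.tail t i with hP
  have hP1 : 1 ≤ P := Nat.one_le_iff_ne_zero.2 (prod_ne_zero_iff.2 fun i _ =>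
    Nat.one_le_iff_ne_zero.1 (ht i.succ))
  set Q : ℝ := ∏ i, ((Fin.tail V i).card.choose (Fin.tail t i) : ℝ) with hQ
  have hQ0 : 0 < Q := prod_pos fun i _ => by exact_mod_cast Nat.choose_pos (hVt i.succ)
  set g : Finset ℕ → ℝ := fun U =>
    max (partiteDensity (Fin.tail V) (commonLink V E U) - τ) 0 / 2 ^ (2 * k - 1) with hg
  have hsum : (d / 2 ^ (2 * k + 1)) ^ t 0 * ((V 0).powersetCard (t 0)).card <
      ∑ U ∈ (V 0).powersetCard (t 0), g U := by
    calc _ ≤ ((d / 2) ^ t 0 - τ) / 2 ^ (2 * k - 1) * ((V 0).powersetCard (t 0)).card := by gcongr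
      _ = ((d / 2) ^ t 0 * (V 0).card.choose (t 0) - τ * (V 0).card.choose (t 0)) /
          2 ^ (2 * k - 1) := by rw [card_powersetCard]; ring
      _ < (∑ U ∈ (V 0).powersetCard (t 0), partiteDensity (Fin.tail V) (commonLink V E U) -
          τ * (V 0).card.choose (t 0)) / 2 ^ (2 * k - 1) := by gcongr
      _ = ∑ U ∈ (V 0).powersetCard (t 0),
          (partiteDensity (Fin.tail V) (commonLink V E U) - τ) / 2 ^ (2 * k - 1) := by
          rw [← sum_div, sum_sub_distrib, sum_const, card_powersetCard, nsmul_eq_mul,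
            mul_comm τ]
      _ ≤ _ := by
          simp only [hg]
          gcongr
          exact le_max_left _ _
  have hpow := pow_mul_card_lt_sum_pow _ g (fun _ _ => by positivity) (by positivity) hsum hP1
  have hcount : ∀ U, g U ^ P * Q ≤
      completePartiteCount (Fin.tail V) (commonLink V E U) (Fin.tail t) := by
    intro U
    rcases le_total (partiteDensity (Fin.tail V) (commonLink V E U)) τ with h | h
    · have : g U = 0 := by simp [hg, h]
      rw [this, zero_pow (by omega), zero_mul]
      positivity
    · have hgU : g U ≤ partiteDensity (Fin.tail V) (commonLink V E U) / 2 ^ (2 * k - 1) := by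
        simp only [hg]
        gcongr
        exact max_le (by linarith) (hτ0.trans h)
      have hgU0 : 0 ≤ g U := by positivity
      refine le_trans (by gcongr)
        (ih (Fin.tail V) (commonLink V E U) (Fin.tail t) (filter_subset _ _)
          (fun i => ht i.succ) fun i => (hcond i.succ).trans ?_)
      have hprod : ∏ j ∈ univ.filter (· < i.succ), t j =
          t 0 * ∏ j ∈ univ.filter (· < i), Fin.tail t j := by
        simp [prod_filter, Fin.prod_univ_succ, Fin.tail]
      rw [hprod, pow_mul]
      refine mul_le_mul_of_nonneg_right ?_ (by positivity)
      refine pow_le_pow_left₀ (by positivity) ((hτ1 i.pos).trans ?_) _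
      gcongr
  rw [completePartiteCount_succ, Nat.cast_sum, Fin.prod_univ_succ, Fin.prod_univ_succ, pow_mul]
  calc _ = ((d / 2 ^ (2 * k + 1)) ^ t 0) ^ P * ((V 0).powersetCard (t 0)).card * Q := by
        rw [card_powersetCard, ← mul_assoc]; rfl
    _ < (∑ U ∈ (V 0).powersetCard (t 0), g U ^ P) * Q := by gcongr
    _ = ∑ U ∈ (V 0).powersetCard (t 0), g U ^ P * Q := sum_mul _ _ _
    _ ≤ _ := sum_le_sum fun U _ => hcount U

lemma le_completePartiteCount (k : ℕ) :
    ∀ (V : Fin k → Finset ℕ) (E : Finset (Fin k → ℕ)) (t : Fin k → ℕ),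
      E ⊆ Fintype.piFinset V → (∀ i, 1 ≤ t i) →
      (∀ i, 2 * (t i : ℝ) ≤
        (partiteDensity V E / 4 ^ (k - 1)) ^ (∏ j ∈ univ.filter (· < i), t j) * (V i).card) →
      (partiteDensity V E / 2 ^ (2 * k - 1)) ^ (∏ i, t i) * ∏ i, ((V i).card.choose (t i) : ℝ) ≤
        completePartiteCount V E t := by
  induction k with
  | zero =>
    intro V E t hE _ _
    rcases E.eq_empty_or_nonempty with rfl | ⟨e, he⟩
    · simp [partiteDensity]
    · have hU : ∀ U : Fin 0 → Finset ℕ, Fintype.piFinset U ⊆ E := fun U x _ =>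
        Subsingleton.elim e x ▸ he
      rw [completePartiteCount, filter_true_of_mem fun U _ => hU U]
      simpa using partiteDensity_le_one hE
  | succ k ih =>
    intro V E t hE ht hcond
    exact (lt_completePartiteCount_succ ih V E t hE ht hcond).le

/-- **Unbalanced partite supersaturation (Erdős).**
Let `H` be a `k`-partite `k`-uniform hypergraph with vertex classes `V 1, …, V k`
and edge set `E` (edges are encoded as transversals `e : Fin k → ℕ`, `e i ∈ V i`),
of density `d = |E| / ∏ |V i|`.  If positive integers `t i` satisfy
`(d/4^(k-1))^(∏_{j<i} t j) * |V i| ≥ 2 t i` for all `i`, then the number of tuples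
`(U 1, …, U k)` with `U i ⊆ V i`, `|U i| = t i` spanning a complete `k`-partite
subhypergraph of `H` exceeds `(d/2^(2k-1))^(∏ t i) * ∏ C(|V i|, t i)`. -/
theorem partite_supersaturation (k : ℕ) (hk : 1 ≤ k)
    (V : Fin k → Finset ℕ) (E : Finset (Fin k → ℕ))
    (hE : E ⊆ Fintype.piFinset V)
    (d : ℝ) (hd : d = (E.card : ℝ) / ∏ i, ((V i).card : ℝ))
    (t : Fin k → ℕ) (ht : ∀ i, 1 ≤ t i)
    (hcond : ∀ i : Fin k,
      (d / 4 ^ (k - 1)) ^ (∏ j ∈ Finset.univ.filter (· < i), t j) * ((V i).card : ℝ)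
        ≥ 2 * (t i : ℝ)) :
    ((((Fintype.piFinset fun i => (V i).powersetCard (t i)).filter
        fun U => Fintype.piFinset U ⊆ E).card : ℝ)
      > (d / 2 ^ (2 * k - 1)) ^ (∏ i, t i) * ∏ i, (((V i).card.choose (t i) : ℕ) : ℝ)) := by
  obtain ⟨m, rfl⟩ := Nat.exists_eq_add_of_le' hk
  subst hd
  exact lt_completePartiteCount_succ (le_completePartiteCount m) V E t hE ht hcond
end

section
/- Let k ≥ 2, let δ₀,…,δ_{k−1} ∈ (0,1], and let φ: E(K^{(k)}_{V₁,…,V_k}) → ℕ be a (δ₀,…,δ_{k−1})-bounded colouring of the complete k-partite k-uniform hypergraph with vertex classes V₁,…,V_k. If t is a positive integer with t ≤ (1/2)·min{|V₁|,…,|V_k|} and δ_j ≤ 1/(2^{3k−j} · t^{2k−j−1}) for every j = 0,…,k−1, then there is a rainbow copy of K^{(k)}_{t,…,t}, i.e., sets U_i ⊆ V_i with |U_i| = t for each i ∈ [k] such that φ is injective on the edges spanned by U₁,…,U_k. -/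
open Finset

/-- The set `V_J` of `J`-patterns: partial transversals picking one vertex of `V j`
for each `j ∈ J`, encoded as functions that are `0` outside `J`.  It has
cardinality `∏_{j ∈ J} |V j|`. -/
def patterns {k : ℕ} (V : Fin k → Finset ℕ) (J : Finset (Fin k)) : Finset (Fin k → ℕ) :=
  Fintype.piFinset fun j => if j ∈ J then V j else {0}

/-- A colouring `φ` of the edge set `E` of a `k`-partite `k`-uniform hypergraph
(edges are transversals `e : Fin k → ℕ`, `e i ∈ V i`) is `(δ, J)`-bounded if all but
at most `δ ∏_{j∈J} |V j|` of the patterns `S ∈ V_J` satisfy, for every colour `ℓ`,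
`|{e ∈ E : e_J = S, φ e = ℓ}| ≤ δ ∏_{j∉J} |V j|`. -/
def BoundedOn {k : ℕ} (V : Fin k → Finset ℕ) (E : Finset (Fin k → ℕ))
    (φ : (Fin k → ℕ) → ℕ) (δ : ℝ) (J : Finset (Fin k)) : Prop :=
  ∃ B ⊆ patterns V J,
    (B.card : ℝ) ≤ δ * ∏ j ∈ J, ((V j).card : ℝ) ∧
    ∀ S ∈ patterns V J, S ∉ B → ∀ ℓ : ℕ,
      ((E.filter fun e => (∀ j ∈ J, e j = S j) ∧ φ e = ℓ).card : ℝ)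
        ≤ δ * ∏ j ∈ Finset.univ \ J, ((V j).card : ℝ)

/-- The number of `m`-subsets of `V` containing `x` is at most the fraction `m / |V|` of all. -/
theorem card_filter_mem_powersetCard_le (V : Finset ℕ) (m : ℕ) (hm : 1 ≤ m) (hV : m ≤ V.card)
    (x : ℕ) (hx : x ∈ V) :
    (((V.powersetCard m).filter fun A => x ∈ A).card : ℝ)
      ≤ (V.powersetCard m).card * (m / V.card) := by
  have h1 : ((V.powersetCard m).filter fun A => x ∈ A)
      ⊆ ((V.erase x).powersetCard (m - 1)).image (insert x) := by
    intro A hA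
    rw [mem_filter, mem_powersetCard] at hA
    obtain ⟨⟨hAV, hAc⟩, hxA⟩ := hA
    rw [mem_image]
    refine ⟨A.erase x, mem_powersetCard.2 ⟨erase_subset_erase _ hAV, ?_⟩, insert_erase hxA⟩
    rw [card_erase_of_mem hxA, hAc]
  have h2 := (card_le_card h1).trans card_image_le
  rw [card_powersetCard, card_erase_of_mem hx] at h2
  rw [card_powersetCard]
  obtain ⟨m, rfl⟩ := Nat.exists_eq_add_of_le' hm
  obtain ⟨n, hn⟩ := Nat.exists_eq_add_of_le' (hm.trans hV)
  rw [hn] at h2 ⊢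
  simp only [Nat.add_sub_cancel] at h2
  have h3 := Nat.add_one_mul_choose_eq n m
  have h2' : (((V.powersetCard (m + 1)).filter fun A => x ∈ A).card : ℝ) ≤ n.choose m := by
    exact_mod_cast h2
  have h3' : ((n : ℝ) + 1) * n.choose m = (n + 1).choose (m + 1) * (m + 1) := by exact_mod_cast h3
  rw [← mul_div_assoc, le_div_iff₀ (by positivity)]
  push_cast
  nlinarith

/-- The number of `m`-subsets of `V` containing two distinct elements is at most the fraction
`(m / |V|) ^ 2` of all. -/
theorem card_filter_mem_mem_powersetCard_le (V : Finset ℕ) (m : ℕ) (hm : 2 ≤ m)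
    (hV : m ≤ V.card) (x y : ℕ) (hx : x ∈ V) (hy : y ∈ V) (hxy : x ≠ y) :
    (((V.powersetCard m).filter fun A => x ∈ A ∧ y ∈ A).card : ℝ)
      ≤ (V.powersetCard m).card * (m / V.card) ^ 2 := by
  have hyx : y ∈ V.erase x := mem_erase.2 ⟨hxy.symm, hy⟩
  have h1 : ((V.powersetCard m).filter fun A => x ∈ A ∧ y ∈ A)
      ⊆ (((V.erase x).erase y).powersetCard (m - 2)).image fun A => insert x (insert y A) := by
    intro A hA
    rw [mem_filter, mem_powersetCard] at hA
    obtain ⟨⟨hAV, hAc⟩, hxA, hyA⟩ := hA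
    have hyA' : y ∈ A.erase x := mem_erase.2 ⟨hxy.symm, hyA⟩
    rw [mem_image]
    refine ⟨(A.erase x).erase y, mem_powersetCard.2
      ⟨erase_subset_erase _ (erase_subset_erase _ hAV), ?_⟩, ?_⟩
    · rw [card_erase_of_mem hyA', card_erase_of_mem hxA, hAc]
      omega
    · rw [insert_erase hyA', insert_erase hxA]
  have h2 := (card_le_card h1).trans card_image_le
  rw [card_powersetCard, card_erase_of_mem hyx, card_erase_of_mem hx] at h2
  rw [card_powersetCard]
  obtain ⟨m, rfl⟩ := Nat.exists_eq_add_of_le' hm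
  obtain ⟨n, hn⟩ := Nat.exists_eq_add_of_le' (hm.trans hV)
  rw [hn] at h2 hV ⊢
  simp only [Nat.add_sub_cancel, show n + 2 - 1 - 1 = n by omega] at h2
  have h3 := Nat.add_one_mul_choose_eq n m
  have h4 := Nat.add_one_mul_choose_eq (n + 1) (m + 1)
  have h2' : (((V.powersetCard (m + 2)).filter fun A => x ∈ A ∧ y ∈ A).card : ℝ)
      ≤ n.choose m := by
    exact_mod_cast h2
  have h3' : ((n : ℝ) + 1) * n.choose m = (n + 1).choose (m + 1) * (m + 1) := by exact_mod_cast h3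
  have h4' : ((n : ℝ) + 2) * (n + 1).choose (m + 1) = (n + 2).choose (m + 2) * (m + 2) := by
    exact_mod_cast h4
  have hmn : (m : ℝ) ≤ n := by exact_mod_cast (by omega : m ≤ n)
  rw [div_pow, ← mul_div_assoc, le_div_iff₀ (by positivity)]
  push_cast
  refine (mul_le_mul_of_nonneg_right h2' (by positivity)).trans ?_
  have hpos : (0 : ℝ) < n + 1 := by positivity
  refine le_of_mul_le_mul_left ?_ hpos
  have e1 : ((n : ℝ) + 1) * (n.choose m * (n + 2) ^ 2)
      = (n + 2).choose (m + 2) * (m + 2) * ((m + 1) * (n + 2)) := by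
    rw [← h4']
    linear_combination ((n : ℝ) + 2) ^ 2 * h3'
  rw [e1]
  have e2 : ((m : ℝ) + 1) * (n + 2) ≤ (m + 2) * (n + 1) := by linarith
  calc _ ≤ ((n + 2).choose (m + 2) : ℝ) * (m + 2) * ((m + 2) * (n + 1)) := by gcongr
    _ = _ := by ring

/-- The number of transversals with prescribed values on `J`. -/
theorem card_filter_agree_le {k : ℕ} (V : Fin k → Finset ℕ) (J : Finset (Fin k))
    (S : Fin k → ℕ) :
    (((Fintype.piFinset V).filter fun e => ∀ j ∈ J, e j = S j).card : ℝ)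
      ≤ ∏ j ∈ univ \ J, ((V j).card : ℝ) := by
  have h1 : ((Fintype.piFinset V).filter fun e => ∀ j ∈ J, e j = S j)
      ⊆ Fintype.piFinset fun j => if j ∈ J then {S j} else V j := by
    intro e he
    rw [mem_filter, Fintype.mem_piFinset] at he
    rw [Fintype.mem_piFinset]
    intro j
    split_ifs with hj
    · exact mem_singleton.2 (he.2 j hj)
    · exact he.1 j
  have h2 := card_le_card h1
  rw [Fintype.card_piFinset] at h2
  have h3 : ∏ j, (if j ∈ J then {S j} else V j).card = ∏ j ∈ univ \ J, (V j).card := by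
    rw [← prod_sdiff (subset_univ J), mul_comm, prod_eq_one, one_mul]
    · exact prod_congr rfl fun j hj => by rw [if_neg (mem_sdiff.1 hj).2]
    · intro j hj
      rw [if_pos hj, card_singleton]
  rw [h3] at h2
  exact_mod_cast h2

/-- In a `(δ, J)`-bounded colouring there are few monochromatic pairs of edges agreeing on `J`. -/
theorem card_monochromatic_pairs_le {k : ℕ} (V : Fin k → Finset ℕ) (φ : (Fin k → ℕ) → ℕ) (δ : ℝ)
    (hδ : 0 ≤ δ) (J : Finset (Fin k)) (h : BoundedOn V (Fintype.piFinset V) φ δ J) :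
    (((Fintype.piFinset V ×ˢ Fintype.piFinset V).filter fun p =>
        (∀ j ∈ J, p.2 j = p.1 j) ∧ φ p.2 = φ p.1).card : ℝ)
      ≤ 2 * δ * ((∏ j ∈ J, ((V j).card : ℝ)) * (∏ j ∈ univ \ J, ((V j).card : ℝ)) ^ 2) := by
  classical
  obtain ⟨B, hB, hBc, hgood⟩ := h
  set E := Fintype.piFinset V with hE
  set P : ℝ := ∏ j ∈ J, ((V j).card : ℝ) with hP
  set Q : ℝ := ∏ j ∈ univ \ J, ((V j).card : ℝ) with hQ
  have hP0 : 0 ≤ P := prod_nonneg fun _ _ => Nat.cast_nonneg _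
  have hQ0 : 0 ≤ Q := prod_nonneg fun _ _ => Nat.cast_nonneg _
  set res : (Fin k → ℕ) → (Fin k → ℕ) := fun e j => if j ∈ J then e j else 0 with hres
  have hres_mem : ∀ e ∈ E, res e ∈ patterns V J := by
    intro e he
    rw [hE, Fintype.mem_piFinset] at he
    rw [patterns, Fintype.mem_piFinset]
    intro j
    by_cases hj : j ∈ J
    · simpa [hres, hj] using he j
    · simp [hres, hj]
  have hagree : ∀ e e' : Fin k → ℕ, (∀ j ∈ J, e' j = e j) ↔ ∀ j ∈ J, e' j = res e j := by
    intro e e'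
    refine forall₂_congr fun j hj => ?_
    simp [hres, hj]
  have hsum : (((E ×ˢ E).filter fun p =>
        (∀ j ∈ J, p.2 j = p.1 j) ∧ φ p.2 = φ p.1).card : ℝ)
      = ∑ e ∈ E, ((E.filter fun e' => (∀ j ∈ J, e' j = e j) ∧ φ e' = φ e).card : ℝ) := by
    rw [card_filter, sum_product]
    push_cast
    refine sum_congr rfl fun e _ => ?_
    rw [card_filter]
    push_cast
    rfl
  have hbad : ((E.filter fun e => res e ∈ B).card : ℝ) ≤ B.card * Q := by
    have hmaps : ∀ e ∈ E.filter (fun e => res e ∈ B), res e ∈ B := fun e he => (mem_filter.1 he).2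
    rw [card_eq_sum_card_fiberwise hmaps]
    push_cast
    refine (sum_le_card_nsmul _ _ Q fun S _ => ?_).trans (by rw [nsmul_eq_mul])
    refine le_trans ?_ (card_filter_agree_le V J S)
    refine Nat.cast_le.2 (card_le_card fun e he => ?_)
    simp only [mem_filter] at he ⊢
    refine ⟨he.1.1, fun j hj => ?_⟩
    rw [← he.2]
    simp [hres, hj]
  have hsize : (E.card : ℝ) = P * Q := by
    rw [hE, Fintype.card_piFinset, ← prod_sdiff (subset_univ J)]
    push_cast
    rw [mul_comm]
  rw [hsum, ← sum_filter_add_sum_filter_not E fun e => res e ∈ B]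
  have hb : ∑ e ∈ E with res e ∈ B,
      ((E.filter fun e' => (∀ j ∈ J, e' j = e j) ∧ φ e' = φ e).card : ℝ) ≤ δ * (P * Q ^ 2) := by
    refine (sum_le_card_nsmul _ _ Q fun e _ => ?_).trans ?_
    · refine le_trans ?_ (card_filter_agree_le V J e)
      refine Nat.cast_le.2 (card_le_card fun e he => ?_)
      simp only [mem_filter] at he ⊢
      exact ⟨he.1, he.2.1⟩
    · rw [nsmul_eq_mul]
      calc _ ≤ (B.card * Q) * Q := mul_le_mul_of_nonneg_right hbad hQ0
        _ ≤ (δ * P * Q) * Q :=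
          mul_le_mul_of_nonneg_right (mul_le_mul_of_nonneg_right hBc hQ0) hQ0
        _ = _ := by ring
  have hg : ∑ e ∈ E with ¬ res e ∈ B,
      ((E.filter fun e' => (∀ j ∈ J, e' j = e j) ∧ φ e' = φ e).card : ℝ) ≤ δ * (P * Q ^ 2) := by
    refine (sum_le_card_nsmul _ _ (δ * Q) fun e he => ?_).trans ?_
    · rw [mem_filter] at he
      have := hgood (res e) (hres_mem e he.1) he.2 (φ e)
      simpa only [hagree e] using this
    · rw [nsmul_eq_mul]
      calc _ ≤ (E.card : ℝ) * (δ * Q) :=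
          mul_le_mul_of_nonneg_right (Nat.cast_le.2 (card_le_card (filter_subset _ _)))
            (mul_nonneg hδ hQ0)
        _ = _ := by rw [hsize]; ring
  linarith

/-- The number of choices of `m`-sets in each class containing two given transversals that agree
exactly on `J`. -/
theorem card_filter_piFinset_powersetCard_le {k : ℕ} (V : Fin k → Finset ℕ) (m : ℕ) (hm : 2 ≤ m)
    (hV : ∀ i, m ≤ (V i).card) (J : Finset (Fin k)) (e e' : Fin k → ℕ)
    (he : e ∈ Fintype.piFinset V) (he' : e' ∈ Fintype.piFinset V)
    (hJ : ∀ j, j ∈ J ↔ e' j = e j) :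
    (((Fintype.piFinset fun i => (V i).powersetCard m).filter fun W =>
        e ∈ Fintype.piFinset W ∧ e' ∈ Fintype.piFinset W).card : ℝ)
      * ((∏ j ∈ J, ((V j).card : ℝ)) * (∏ j ∈ univ \ J, ((V j).card : ℝ)) ^ 2)
      ≤ (Fintype.piFinset fun i => (V i).powersetCard m).card * (m : ℝ) ^ (2 * k - J.card) := by
  rw [Fintype.mem_piFinset] at he he'
  have hpos : ∀ i, (0 : ℝ) < (V i).card := fun i => Nat.cast_pos.2 (by have := hV i; omega)
  have h1 : ((Fintype.piFinset fun i => (V i).powersetCard m).filter fun W =>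
        e ∈ Fintype.piFinset W ∧ e' ∈ Fintype.piFinset W)
      ⊆ Fintype.piFinset fun i => ((V i).powersetCard m).filter fun A => e i ∈ A ∧ e' i ∈ A := by
    intro W hW
    simp only [mem_filter, Fintype.mem_piFinset] at hW ⊢
    exact fun i => ⟨hW.1 i, hW.2.1 i, hW.2.2 i⟩
  have h2 := card_le_card h1
  rw [Fintype.card_piFinset] at h2
  have hw : (∏ j ∈ J, ((V j).card : ℝ)) * (∏ j ∈ univ \ J, ((V j).card : ℝ)) ^ 2
      = ∏ i, if i ∈ J then ((V i).card : ℝ) else ((V i).card : ℝ) ^ 2 := by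
    rw [← prod_sdiff (subset_univ J), ← prod_pow, mul_comm]
    congr 1
    · exact prod_congr rfl fun j hj => by rw [if_neg (mem_sdiff.1 hj).2]
    · exact prod_congr rfl fun j hj => by rw [if_pos hj]
  have hpow : (m : ℝ) ^ (2 * k - J.card) = ∏ i, if i ∈ J then (m : ℝ) else (m : ℝ) ^ 2 := by
    rw [prod_ite, prod_const, prod_const, ← pow_mul, ← pow_add]
    congr 1
    have a1 : (univ.filter fun i => i ∈ J).card = J.card := by simp
    have a2 := card_filter_add_card_filter_not (s := (univ : Finset (Fin k))) (fun i => i ∈ J)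
    rw [card_univ, Fintype.card_fin] at a2
    omega
  calc _ ≤ ((∏ i, (((V i).powersetCard m).filter fun A => e i ∈ A ∧ e' i ∈ A).card : ℕ) : ℝ)
        * ((∏ j ∈ J, ((V j).card : ℝ)) * (∏ j ∈ univ \ J, ((V j).card : ℝ)) ^ 2) :=
        mul_le_mul_of_nonneg_right (Nat.cast_le.2 h2)
          (mul_nonneg (prod_nonneg fun i _ => (hpos i).le)
            (pow_nonneg (prod_nonneg fun i _ => (hpos i).le) 2))
    _ ≤ _ := by
      rw [hw, hpow, Fintype.card_piFinset]
      push_cast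
      rw [← prod_mul_distrib, ← prod_mul_distrib]
      refine prod_le_prod (fun i _ => by positivity) fun i _ => ?_
      have hi := hpos i
      split_ifs with hj
      · rw [(hJ i).1 hj]
        simp only [and_self]
        have := card_filter_mem_powersetCard_le (V i) m (by omega) (hV i) (e i) (he i)
        rwa [← mul_div_assoc, le_div_iff₀ hi] at this
      · have := card_filter_mem_mem_powersetCard_le (V i) m hm (hV i) (e i) (e' i) (he i) (he' i)
          fun h => hj ((hJ i).2 h.symm)
        rwa [div_pow, ← mul_div_assoc, le_div_iff₀ (by positivity)] at this

/-- If a colouring has fewer than `2 t` ordered monochromatic pairs of distinct edges on classes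
of size `2 t`, deleting vertices of one class leaves a rainbow copy. -/
theorem exists_rainbow_of_card_pairs_lt {k : ℕ} (hk : 0 < k) (W : Fin k → Finset ℕ)
    (φ : (Fin k → ℕ) → ℕ) (t : ℕ) (hW : ∀ i, (W i).card = 2 * t)
    (h : ((Fintype.piFinset W ×ˢ Fintype.piFinset W).filter fun p =>
      p.1 ≠ p.2 ∧ φ p.2 = φ p.1).card < 2 * t) :
    ∃ U : Fin k → Finset ℕ, (∀ i, U i ⊆ W i) ∧ (∀ i, (U i).card = t) ∧
      ∀ e ∈ Fintype.piFinset U, ∀ e' ∈ Fintype.piFinset U, φ e = φ e' → e = e' := by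
  classical
  set M := (Fintype.piFinset W ×ˢ Fintype.piFinset W).filter fun p =>
      p.1 ≠ p.2 ∧ φ p.2 = φ p.1 with hM
  set L := M.filter fun p => toLex p.1 < toLex p.2 with hL
  set R := M.filter fun p => ¬ toLex p.1 < toLex p.2 with hR
  have hLR : L.card ≤ R.card := by
    refine card_le_card_of_injOn Prod.swap ?_ Prod.swap_injective.injOn
    rintro ⟨e, e'⟩ hp
    simp only [hL, hR, hM, mem_coe, mem_filter, mem_product, Prod.swap] at hp ⊢
    exact ⟨⟨⟨hp.1.1.2, hp.1.1.1⟩, hp.1.2.1.symm, hp.1.2.2.symm⟩, hp.2.le.not_gt⟩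
  have hadd : L.card + R.card = M.card := card_filter_add_card_filter_not _
  let i₀ : Fin k := ⟨0, hk⟩
  set D := L.image fun p => p.1 i₀ with hD
  have hDc : D.card ≤ L.card := card_image_le
  have hex : ∀ i, ∃ A ⊆ (if i = i₀ then W i \ D else W i), A.card = t := by
    intro i
    refine exists_subset_card_eq ?_
    have := hW i
    split_ifs
    · have := le_card_sdiff D (W i)
      omega
    · omega
  choose U hU hUc using hex
  have hUW : ∀ i, U i ⊆ W i := by
    intro i
    refine (hU i).trans ?_
    split_ifs
    · exact sdiff_subset
    · exact Subset.refl _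
  have key : ∀ e ∈ Fintype.piFinset U, ∀ e' ∈ Fintype.piFinset U, φ e = φ e' →
      ¬ toLex e < toLex e' := by
    intro e he e' he' hφ hlt
    rw [Fintype.mem_piFinset] at he he'
    have h0 := hU i₀ (he i₀)
    rw [if_pos rfl, mem_sdiff] at h0
    refine h0.2 (mem_image.2 ⟨(e, e'), ?_, rfl⟩)
    simp only [hL, hM, mem_filter, mem_product, Fintype.mem_piFinset]
    refine ⟨⟨⟨fun i => hUW i (he i), fun i => hUW i (he' i)⟩, ?_, hφ.symm⟩, hlt⟩
    rintro rfl
    exact lt_irrefl _ hlt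
  refine ⟨U, hUW, hUc, fun e he e' he' hφ => ?_⟩
  have h1 := key e he e' he' hφ
  have h2 := key e' he' e he hφ.symm
  exact toLex.injective (le_antisymm (not_lt.1 h2) (not_lt.1 h1))

/-- **Rainbow copies in bounded colourings.**
Let `k ≥ 2`, `δ 0, …, δ (k-1) ∈ (0,1]`, and let `φ` be a `(δ 0, …, δ (k-1))`-bounded
colouring of the complete `k`-partite `k`-uniform hypergraph on `V 1, …, V k`.
If `1 ≤ t ≤ ½ min |V i|` and `δ j ≤ 1/(2^(3k-j) t^(2k-j-1))` for all `j ≤ k-1`, then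
there is a rainbow copy of `K^(k)_{t,…,t}`. -/
theorem rainbow_in_bounded_colouring (k : ℕ) (hk : 2 ≤ k)
    (V : Fin k → Finset ℕ) (δ : Fin k → ℝ) (hδ : ∀ j, δ j ∈ Set.Ioc (0 : ℝ) 1)
    (φ : (Fin k → ℕ) → ℕ)
    (hbdd : ∀ j : Fin k, ∀ J : Finset (Fin k), J.card = j.1 →
      BoundedOn V (Fintype.piFinset V) φ (δ j) J)
    (t : ℕ) (ht : 1 ≤ t) (htV : ∀ i, 2 * t ≤ (V i).card)
    (hδt : ∀ j : Fin k,
      δ j ≤ 1 / (2 ^ (3 * k - j.1) * (t : ℝ) ^ (2 * k - j.1 - 1))) :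
    ∃ U : Fin k → Finset ℕ, (∀ i, U i ⊆ V i) ∧ (∀ i, (U i).card = t) ∧
      ∀ e ∈ Fintype.piFinset U, ∀ e' ∈ Fintype.piFinset U, φ e = φ e' → e = e' := by
  classical
  set Ω := Fintype.piFinset fun i => (V i).powersetCard (2 * t) with hΩ
  set E := Fintype.piFinset V with hE
  have hΩpos : (0 : ℝ) < Ω.card := by
    rw [Nat.cast_pos, hΩ, Fintype.card_piFinset]
    refine prod_pos fun i _ => ?_
    rw [card_powersetCard]
    exact Nat.choose_pos (htV i)
  have ht0 : (0 : ℝ) < t := by exact_mod_cast ht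
  suffices hex : ∃ W ∈ Ω, (((Fintype.piFinset W ×ˢ Fintype.piFinset W).filter fun p =>
      p.1 ≠ p.2 ∧ φ p.2 = φ p.1).card : ℝ) < 2 * t by
    obtain ⟨W, hW, hWc⟩ := hex
    rw [hΩ, Fintype.mem_piFinset] at hW
    obtain ⟨U, hU, hUc, hinj⟩ := exists_rainbow_of_card_pairs_lt (by omega) W φ t
      (fun i => (mem_powersetCard.1 (hW i)).2) (by exact_mod_cast hWc)
    exact ⟨U, fun i => (hU i).trans (mem_powersetCard.1 (hW i)).1, hUc, hinj⟩
  set M := (E ×ˢ E).filter fun p => p.1 ≠ p.2 ∧ φ p.2 = φ p.1 with hM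
  set agree : (Fin k → ℕ) × (Fin k → ℕ) → Finset (Fin k) :=
    fun p => univ.filter fun i => p.2 i = p.1 i with hagree
  have hmaps : ∀ p ∈ M, agree p ∈ (univ : Finset (Finset (Fin k))).erase univ := by
    intro p hp
    refine mem_erase.2 ⟨fun h => ?_, mem_univ _⟩
    refine (mem_filter.1 hp).2.1 (funext fun i => ?_)
    have hi : i ∈ agree p := h ▸ mem_univ i
    exact ((mem_filter.1 hi).2).symm
  have hdouble : ∑ W ∈ Ω, (((Fintype.piFinset W ×ˢ Fintype.piFinset W).filter fun p =>
      p.1 ≠ p.2 ∧ φ p.2 = φ p.1).card : ℝ)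
      = ∑ p ∈ M, ((Ω.filter fun W => p.1 ∈ Fintype.piFinset W ∧
          p.2 ∈ Fintype.piFinset W).card : ℝ) := by
    rw [← Nat.cast_sum, ← Nat.cast_sum]
    congr 1
    have := sum_card_bipartiteAbove_eq_sum_card_bipartiteBelow (s := Ω) (t := M)
      (fun W p => p.1 ∈ Fintype.piFinset W ∧ p.2 ∈ Fintype.piFinset W)
    refine Eq.trans (sum_congr rfl fun W hW => ?_) this
    rw [hΩ, Fintype.mem_piFinset] at hW
    have hsub : Fintype.piFinset W ⊆ E :=
      Fintype.piFinset_subset _ _ fun i => (mem_powersetCard.1 (hW i)).1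
    congr 1
    ext p
    simp only [bipartiteAbove, hM, mem_filter, mem_product]
    constructor
    · rintro ⟨⟨h1, h2⟩, h3⟩
      exact ⟨⟨⟨hsub h1, hsub h2⟩, h3⟩, h1, h2⟩
    · rintro ⟨⟨_, h3⟩, h12⟩
      exact ⟨h12, h3⟩
  have hfibre : ∀ J ∈ (univ : Finset (Finset (Fin k))).erase univ,
      ∑ p ∈ M with agree p = J, ((Ω.filter fun W => p.1 ∈ Fintype.piFinset W ∧
          p.2 ∈ Fintype.piFinset W).card : ℝ) ≤ Ω.card * (2 * t / 2 ^ k) := by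
    intro J hJ
    have hJk : J.card < k := by
      have := card_lt_univ_of_notMem (s := J) (x := (not_forall.1 fun h =>
        (mem_erase.1 hJ).1 (eq_univ_iff_forall.2 h)).choose)
        (not_forall.1 fun h => (mem_erase.1 hJ).1 (eq_univ_iff_forall.2 h)).choose_spec
      simpa using this
    set d := δ ⟨J.card, hJk⟩ with hd
    have hd0 : 0 ≤ d := (hδ _).1.le
    have hdle : d ≤ 1 / (2 ^ (3 * k - J.card) * (t : ℝ) ^ (2 * k - J.card - 1)) := hδt _
    set X : ℝ := (∏ j ∈ J, ((V j).card : ℝ)) * (∏ j ∈ univ \ J, ((V j).card : ℝ)) ^ 2 with hX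
    have hV0 : ∀ i, (0 : ℝ) < (V i).card := fun i => Nat.cast_pos.2 (by have := htV i; omega)
    have hXpos : 0 < X :=
      mul_pos (prod_pos fun i _ => hV0 i) (pow_pos (prod_pos fun i _ => hV0 i) 2)
    have hMJ : ((M.filter fun p => agree p = J).card : ℝ) ≤ 2 * d * X := by
      refine le_trans (Nat.cast_le.2 (card_le_card fun p hp => ?_))
        (card_monochromatic_pairs_le V φ d hd0 J (hbdd ⟨J.card, hJk⟩ J rfl))
      simp only [hM, mem_filter] at hp ⊢
      refine ⟨hp.1.1, fun j hj => ?_, hp.1.2.2⟩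
      rw [← hp.2] at hj
      exact (mem_filter.1 hj).2
    have hterm : ∀ p ∈ M.filter fun p => agree p = J,
        ((Ω.filter fun W => p.1 ∈ Fintype.piFinset W ∧
          p.2 ∈ Fintype.piFinset W).card : ℝ) ≤ Ω.card * (2 * t : ℝ) ^ (2 * k - J.card) / X := by
      intro p hp
      rw [mem_filter, hM, mem_filter, mem_product] at hp
      rw [le_div_iff₀ hXpos]
      have := card_filter_piFinset_powersetCard_le V (2 * t) (by omega) htV J p.1 p.2
        hp.1.1.1 hp.1.1.2 fun j => by rw [← hp.2]; simp [hagree]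
      push_cast at this
      exact this
    have hpow : d * (2 * t : ℝ) ^ (2 * k - J.card) ≤ t / 2 ^ k := by
      calc _ ≤ 1 / (2 ^ (3 * k - J.card) * (t : ℝ) ^ (2 * k - J.card - 1))
            * (2 * t : ℝ) ^ (2 * k - J.card) := by gcongr
        _ = t / 2 ^ k := by
          obtain ⟨s, hs⟩ : ∃ s, 2 * k - J.card = s + 1 := ⟨2 * k - J.card - 1, by omega⟩
          rw [hs, show 3 * k - J.card = s + 1 + k by omega, Nat.add_sub_cancel]
          field_simp
          ring
    calc _ ≤ ((M.filter fun p => agree p = J).card : ℝ)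
          * (Ω.card * (2 * t : ℝ) ^ (2 * k - J.card) / X) := by
          refine (sum_le_card_nsmul _ _ _ hterm).trans (by rw [nsmul_eq_mul])
      _ ≤ 2 * d * X * (Ω.card * (2 * t : ℝ) ^ (2 * k - J.card) / X) :=
          mul_le_mul_of_nonneg_right hMJ
            (div_nonneg (mul_nonneg hΩpos.le (pow_nonneg (by linarith) _)) hXpos.le)
      _ = Ω.card * (2 * (d * (2 * t : ℝ) ^ (2 * k - J.card))) := by field_simp
      _ ≤ Ω.card * (2 * (t / 2 ^ k)) :=
          mul_le_mul_of_nonneg_left (mul_le_mul_of_nonneg_left hpow two_pos.le) hΩpos.le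
      _ = _ := by ring
  have htotal : ∑ W ∈ Ω, (((Fintype.piFinset W ×ˢ Fintype.piFinset W).filter fun p =>
      p.1 ≠ p.2 ∧ φ p.2 = φ p.1).card : ℝ) < ∑ W ∈ Ω, (2 * t : ℝ) := by
    rw [hdouble, ← sum_fiberwise_of_maps_to hmaps, sum_const, nsmul_eq_mul]
    refine (sum_le_card_nsmul _ _ _ hfibre).trans_lt ?_
    rw [nsmul_eq_mul, card_erase_of_mem (mem_univ _), card_univ, Fintype.card_finset,
      Fintype.card_fin, Nat.cast_sub Nat.one_le_two_pow]
    push_cast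
    have h2k : (0 : ℝ) < 2 ^ k := by positivity
    have : ((2 : ℝ) ^ k - 1) * (Ω.card * (2 * t / 2 ^ k))
        = Ω.card * (2 * t) - Ω.card * (2 * t) / 2 ^ k := by
      field_simp
    rw [this]
    have : 0 < (Ω.card : ℝ) * (2 * t) / 2 ^ k := by positivity
    linarith
  exact exists_lt_of_sum_lt htotal
end

section
/- Let k ≥ 2 and let H = (V₁ ∪̇ … ∪̇ V_k, E) be a k-partite k-uniform hypergraph of density d = |E|/(|V₁|⋯|V_k|) > 0, and let φ: E → ℕ be a (δ₀,…,δ_{k−1})-bounded colouring with δ₀,…,δ_{k−1} ∈ (0,1]. If an integer m satisfies 2^{k+3}/d ≤ m ≤ min{|V₁|,…,|V_k|} and δ_j < 1/(2^{k+1} · m^{2k−j}) for every j = 0,…,k−1, then there exist sets U_j ⊆ V_j with |U_j| = m for every j ∈ [k] such that the induced subhypergraph H[U₁,…,U_k] has density at least d/2 (i.e., at least (d/2)·m^k edges) and φ is injective on its edges (rainbow). -/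
open Finset

/-- At most a proportion `(m / #s) ^ #t` of the `m`-element subsets of `s` contain `t`. -/
lemma card_filter_superset_powersetCard_le {α : Type*} [DecidableEq α] {s t : Finset α} {m : ℕ}
    (hts : t ⊆ s) (hm : m ≤ #s) :
    (#{u ∈ s.powersetCard m | t ⊆ u} : ℝ) ≤ (m / #s : ℝ) ^ #t * (#s).choose m := by
  rcases le_or_gt (#t) m with htm | htm
  · rw [card_filter_powersetCard_subset t s m hts htm]
    rcases Nat.eq_zero_or_pos (#s) with hs | hs
    · have : m = 0 := by lia
      have : #t = 0 := by lia
      simp [*]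
    have key : ∀ c ≤ m, (#s - c).choose (m - c) * #s ^ c ≤ m ^ c * (#s).choose m := by
      intro c
      induction c with
      | zero => simp
      | succ c ih =>
        intro hc
        have h1 := Nat.add_one_mul_choose_eq (#s - (c + 1)) (m - (c + 1))
        rw [show #s - (c + 1) + 1 = #s - c by lia, show m - (c + 1) + 1 = m - c by lia] at h1
        have h2 : (m - c) * #s ≤ m * (#s - c) := by
          rw [Nat.sub_mul, Nat.mul_sub]
          exact Nat.sub_le_sub_left (by rw [mul_comm]; exact Nat.mul_le_mul_left _ hm) _
        refine Nat.le_of_mul_le_mul_left (c := #s - c) ?_ (by lia)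
        calc _ = (#s - c) * (#s - (c + 1)).choose (m - (c + 1)) * #s ^ c * #s := by ring
          _ = (#s - c).choose (m - c) * #s ^ c * ((m - c) * #s) := by rw [h1]; ring
          _ ≤ m ^ c * (#s).choose m * (m * (#s - c)) := Nat.mul_le_mul (ih (by lia)) h2
          _ = _ := by ring
    have h := key _ htm
    rw [div_pow, div_mul_eq_mul_div, le_div_iff₀ (by positivity)]
    exact_mod_cast h
  · rw [filter_eq_empty_iff.2]
    · simp only [card_empty, Nat.cast_zero]
      positivity
    · intro u hu htu
      have := card_le_card htu
      rw [(mem_powersetCard.1 hu).2] at this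
      lia

/-- Exactly a proportion `m / #s` of the `m`-element subsets of `s` contain a given point. -/
lemma card_filter_mem_powersetCard {α : Type*} [DecidableEq α] {s : Finset α} {x : α} {m : ℕ}
    (hx : x ∈ s) : (#{u ∈ s.powersetCard m | {x} ⊆ u} : ℝ) = (m / #s : ℝ) * (#s).choose m := by
  have hs : 0 < #s := card_pos.2 ⟨x, hx⟩
  rcases Nat.eq_zero_or_pos m with rfl | hm
  · simp
  rw [card_filter_powersetCard_subset {x} s m (by simpa) (by simpa)]
  have h1 := Nat.add_one_mul_choose_eq (#s - 1) (m - 1)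
  rw [Nat.sub_add_cancel hs, Nat.sub_add_cancel hm] at h1
  rw [div_mul_eq_mul_div, eq_div_iff (by positivity), card_singleton]
  have h2 : ((#s * (#s - 1).choose (m - 1) : ℕ) : ℝ) = ((#s).choose m * m : ℕ) := by rw [h1]
  push_cast at h2
  linarith

section Selections

variable {ι α : Type*} [Fintype ι] [DecidableEq ι]

/-- The families `U` of `m`-element subsets `U i ⊆ V i`. -/
def selections (V : ι → Finset α) (m : ℕ) : Finset (ι → Finset α) :=
  Fintype.piFinset fun i => (V i).powersetCard m

lemma card_selections (V : ι → Finset α) (m : ℕ) :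
    #(selections V m) = ∏ i, (#(V i)).choose m := by
  simp [selections]

variable [DecidableEq α]

lemma card_filter_superset_selections (V T : ι → Finset α) (m : ℕ) :
    #{U ∈ selections V m | ∀ i, T i ⊆ U i} =
      ∏ i, #{u ∈ (V i).powersetCard m | T i ⊆ u} := by
  rw [← Fintype.card_piFinset]
  congr 1
  ext U
  simp [selections, forall_and]

lemma card_filter_superset_selections_le {V T : ι → Finset α} {m : ℕ}
    (hT : ∀ i, T i ⊆ V i) (hm : ∀ i, m ≤ #(V i)) :
    (#{U ∈ selections V m | ∀ i, T i ⊆ U i} : ℝ) ≤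
      (∏ i, (m / #(V i) : ℝ) ^ #(T i)) * #(selections V m) := by
  rw [card_filter_superset_selections, card_selections]
  push_cast
  rw [← prod_mul_distrib]
  exact prod_le_prod (fun _ _ => by positivity)
    fun i _ => card_filter_superset_powersetCard_le (hT i) (hm i)

lemma card_filter_mem_selections {V : ι → Finset α} {m : ℕ} {e : ι → α}
    (he : e ∈ Fintype.piFinset V) :
    (#{U ∈ selections V m | e ∈ Fintype.piFinset U} : ℝ) =
      (∏ i, (m / #(V i) : ℝ)) * #(selections V m) := by
  have h := card_filter_superset_selections V (fun i => {e i}) m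
  simp only [singleton_subset_iff] at h
  simp only [Fintype.mem_piFinset] at he ⊢
  rw [h, card_selections]
  push_cast
  rw [← prod_mul_distrib]
  refine prod_congr rfl fun i _ => ?_
  rw [← card_filter_mem_powersetCard (he i)]
  simp

lemma card_filter_mem_and_mem_selections_le {V : ι → Finset α} {m : ℕ} {e e' : ι → α}
    (hm : ∀ i, m ≤ #(V i)) (he : e ∈ Fintype.piFinset V) (he' : e' ∈ Fintype.piFinset V) :
    (#{U ∈ selections V m | e ∈ Fintype.piFinset U ∧ e' ∈ Fintype.piFinset U} : ℝ) ≤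
      (∏ i, if e i = e' i then (m / #(V i) : ℝ) else (m / #(V i) : ℝ) ^ 2) *
        #(selections V m) := by
  rw [Fintype.mem_piFinset] at he he'
  have h := card_filter_superset_selections_le (T := fun i => {e i, e' i}) (m := m)
    (fun i => by simp [insert_subset_iff, he i, he' i]) hm
  simp only [insert_subset_iff, singleton_subset_iff, forall_and] at h
  simp only [Fintype.mem_piFinset]
  refine h.trans_eq ?_
  congr 1
  refine prod_congr rfl fun i _ => ?_
  split_ifs with hi
  · simp [hi]
  · rw [card_pair hi]

/-- Double counting: the total over all selections of the number of hit elements of `R`. -/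
lemma sum_card_filter_eq {β γ : Type*} (Ω : Finset β) (R : Finset γ) (p : β → γ → Prop)
    [∀ b c, Decidable (p b c)] :
    ∑ b ∈ Ω, (#{c ∈ R | p b c} : ℝ) = ∑ c ∈ R, (#{b ∈ Ω | p b c} : ℝ) := by
  exact_mod_cast sum_card_bipartiteAbove_eq_sum_card_bipartiteBelow p

lemma sum_card_filter_mem_selections {V : ι → Finset α} {m : ℕ} {E : Finset (ι → α)}
    (hE : E ⊆ Fintype.piFinset V) :
    ∑ U ∈ selections V m, (#{e ∈ E | e ∈ Fintype.piFinset U} : ℝ) =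
      #E * (∏ i, (m / #(V i) : ℝ)) * #(selections V m) := by
  rw [sum_card_filter_eq, sum_congr rfl fun e he => card_filter_mem_selections (hE he)]
  simp [mul_assoc]

lemma one_add_pow_le (n : ℕ) {x : ℝ} (hx : 1 ≤ x) :
    x * (1 + x) ^ n ≤ x ^ (n + 1) + (2 ^ n - 1) * x ^ n := by
  induction n with
  | zero => simp
  | succ n ih =>
    have h : (1 : ℝ) ≤ 2 ^ n := one_le_pow₀ (by norm_num)
    have h2 : 0 ≤ (2 ^ n - 1) * x ^ n * (x - 1) :=
      mul_nonneg (mul_nonneg (by linarith) (by positivity)) (by linarith)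
    calc x * (1 + x) ^ (n + 1) = (x * (1 + x) ^ n) * (1 + x) := by ring
      _ ≤ (x ^ (n + 1) + (2 ^ n - 1) * x ^ n) * (1 + x) := by gcongr
      _ ≤ _ := by ring_nf at h2 ⊢; linarith

/-- The excess of the joint hitting weight over independence, summed over all transversals. -/
lemma sum_weight_sub_le {V : ι → Finset α} {m : ℕ} {e : ι → α} (hV : ∀ i, 0 < #(V i))
    (he : e ∈ Fintype.piFinset V) (hm : 1 ≤ m) :
    m * ∑ e' ∈ Fintype.piFinset V,
      ((∏ i, if e i = e' i then (m / #(V i) : ℝ) else (m / #(V i) : ℝ) ^ 2) -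
        ∏ i, (m / #(V i) : ℝ) ^ 2) ≤
      (∏ i, (m / #(V i) : ℝ)) * ((2 ^ Fintype.card ι - 1) * m ^ Fintype.card ι) := by
  set q : ι → ℝ := fun i => m / #(V i) with hq
  have hq0 : ∀ i, 0 ≤ q i := fun i => by positivity
  have hqn : ∀ i, #(V i) * q i = m := fun i => by
    have := hV i
    simp only [hq]
    field_simp
  rw [sum_sub_distrib]
  change m * ((∑ x ∈ Fintype.piFinset V, ∏ i, if e i = x i then q i else q i ^ 2) -
    ∑ x ∈ Fintype.piFinset V, ∏ i, q i ^ 2) ≤ _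
  rw [← prod_univ_sum V fun i x => if e i = x then q i else q i ^ 2,
    sum_const, Fintype.card_piFinset, nsmul_eq_mul]
  have h1 : ∏ i, ∑ x ∈ V i, (if e i = x then q i else q i ^ 2) ≤
      (∏ i, q i) * (1 + m) ^ Fintype.card ι := by
    rw [← card_univ, ← prod_const, ← prod_mul_distrib]
    refine prod_le_prod (fun i _ => sum_nonneg fun x _ => by
      have := hq0 i
      split_ifs <;> positivity) fun i _ => ?_
    calc ∑ x ∈ V i, (if e i = x then q i else q i ^ 2)
        ≤ ∑ x ∈ V i, ((if e i = x then q i else 0) + q i ^ 2) := by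
          refine sum_le_sum fun x _ => ?_
          have := hq0 i
          have : 0 ≤ q i ^ 2 := by positivity
          split_ifs <;> linarith
      _ = q i * (1 + m) := by
          rw [sum_add_distrib, sum_ite_eq, if_pos (Fintype.mem_piFinset.1 he i), sum_const,
            nsmul_eq_mul, ← hqn i]
          ring
  have h2 : ((∏ i, #(V i) : ℕ) : ℝ) * ∏ i, q i ^ 2 = (∏ i, q i) * m ^ Fintype.card ι := by
    push_cast
    rw [← card_univ, ← prod_const, ← prod_mul_distrib, ← prod_mul_distrib]
    refine prod_congr rfl fun i _ => ?_
    rw [← hqn i]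
    ring
  have h3 : 0 ≤ ∏ i, q i := prod_nonneg fun i _ => hq0 i
  have h4 := one_add_pow_le (Fintype.card ι) (x := m) (by exact_mod_cast hm)
  rw [h2]
  calc _ ≤ m * ((∏ i, q i) * (1 + m) ^ Fintype.card ι - (∏ i, q i) * m ^ Fintype.card ι) := by
        gcongr
    _ = (∏ i, q i) * (m * (1 + m) ^ Fintype.card ι - m ^ (Fintype.card ι + 1)) := by ring
    _ ≤ _ := mul_le_mul_of_nonneg_left (by linarith) h3

/-- The variance of the number of edges in a random selection, scaled by `m`. -/
lemma sum_sq_card_sub_le {V : ι → Finset α} {m : ℕ} {E : Finset (ι → α)}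
    (hE : E ⊆ Fintype.piFinset V) (hV : ∀ i, m ≤ #(V i)) (hm : 1 ≤ m) {μ : ℝ}
    (hμ : μ = #E * ∏ i, (m / #(V i) : ℝ)) :
    m * ∑ U ∈ selections V m, ((#{e ∈ E | e ∈ Fintype.piFinset U} : ℝ) - μ) ^ 2 ≤
      μ * ((2 ^ Fintype.card ι - 1) * m ^ Fintype.card ι) * #(selections V m) := by
  have hsq : ∑ U ∈ selections V m, (#{e ∈ E | e ∈ Fintype.piFinset U} : ℝ) ^ 2 ≤
      (∑ e ∈ E, ∑ e' ∈ E, ∏ i, if e i = e' i then (m / #(V i) : ℝ) else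
        (m / #(V i) : ℝ) ^ 2) * #(selections V m) := by
    have h1 : ∀ U : ι → Finset α, (#{e ∈ E | e ∈ Fintype.piFinset U} : ℝ) ^ 2 =
        (#{p ∈ E ×ˢ E | p.1 ∈ Fintype.piFinset U ∧ p.2 ∈ Fintype.piFinset U} : ℝ) := by
      intro U
      rw [filter_product, card_product]
      push_cast
      ring
    simp_rw [h1]
    rw [sum_card_filter_eq, ← sum_product', sum_mul]
    refine sum_le_sum fun p hp => ?_
    rw [mem_product] at hp
    exact card_filter_mem_and_mem_selections_le hV (hE hp.1) (hE hp.2)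
  have hexc : ∑ e ∈ E, ∑ e' ∈ E, ((∏ i, if e i = e' i then (m / #(V i) : ℝ) else
      (m / #(V i) : ℝ) ^ 2) - ∏ i, (m / #(V i) : ℝ) ^ 2) * m ≤
      μ * ((2 ^ Fintype.card ι - 1) * m ^ Fintype.card ι) := by
    rw [hμ, mul_assoc, ← nsmul_eq_mul, ← sum_const]
    refine sum_le_sum fun e he => ?_
    rw [← sum_mul, mul_comm]
    refine le_trans ?_ (sum_weight_sub_le (fun i => lt_of_lt_of_le hm (hV i)) (hE he) hm)
    refine mul_le_mul_of_nonneg_left (sum_le_sum_of_subset_of_nonneg hE fun e' _ _ => ?_)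
      (Nat.cast_nonneg m)
    rw [sub_nonneg]
    refine prod_le_prod (fun i _ => by positivity) fun i _ => ?_
    split_ifs
    · refine pow_le_of_le_one (by positivity) (div_le_one_of_le₀ ?_ (by positivity)) two_ne_zero
      exact_mod_cast hV i
    · exact le_rfl
  have hμ2 : ∑ e ∈ E, ∑ e' ∈ E, ∏ i, (m / #(V i) : ℝ) ^ 2 = μ ^ 2 := by
    simp only [sum_const, nsmul_eq_mul, prod_pow, hμ]
    ring
  have hlin := sum_card_filter_mem_selections (m := m) hE
  rw [← hμ] at hlin
  simp_rw [← sum_mul, sum_sub_distrib] at hexc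
  rw [hμ2] at hexc
  have hvar : ∑ U ∈ selections V m, ((#{e ∈ E | e ∈ Fintype.piFinset U} : ℝ) - μ) ^ 2 =
      ∑ U ∈ selections V m, (#{e ∈ E | e ∈ Fintype.piFinset U} : ℝ) ^ 2 -
        μ ^ 2 * #(selections V m) := by
    simp_rw [sub_sq, sum_add_distrib, sum_sub_distrib, sum_const, nsmul_eq_mul, ← sum_mul,
      ← mul_sum, hlin]
    ring
  rw [hvar]
  calc _ ≤ m * ((∑ e ∈ E, ∑ e' ∈ E, ∏ i, if e i = e' i then (m / #(V i) : ℝ) else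
        (m / #(V i) : ℝ) ^ 2) * #(selections V m) - μ ^ 2 * #(selections V m)) := by gcongr
    _ = (∑ e ∈ E, ∑ e' ∈ E, (∏ i, if e i = e' i then (m / #(V i) : ℝ) else
        (m / #(V i) : ℝ) ^ 2) - μ ^ 2) * m * #(selections V m) := by ring
    _ ≤ _ := by gcongr

/-- A selection hits few elements of a small set `B` of partial transversals indexed by `J`. -/
lemma sum_card_filter_partial_le {V : ι → Finset α} {m : ℕ} (hV : ∀ i, m ≤ #(V i))
    (hm : 1 ≤ m) {J : Finset ι} {B : Finset (ι → α)} (hB : ∀ S ∈ B, ∀ j ∈ J, S j ∈ V j)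
    {ε : ℝ} (hBε : #B ≤ ε * ∏ j ∈ J, (#(V j) : ℝ)) :
    ∑ U ∈ selections V m, (#{S ∈ B | ∀ j ∈ J, S j ∈ U j} : ℝ) ≤
      ε * m ^ #J * #(selections V m) := by
  have h1 : ∀ S ∈ B, (#{U ∈ selections V m | ∀ j ∈ J, S j ∈ U j} : ℝ) ≤
      (∏ j ∈ J, (m / #(V j) : ℝ)) * #(selections V m) := by
    intro S hS
    have h := card_filter_superset_selections_le (V := V) (m := m)
      (T := fun i => if i ∈ J then {S i} else ∅)
      (fun i => by
        split_ifs with hi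
        · simpa using hB S hS i hi
        · simp) hV
    have h2 : ∀ (U : ι → Finset α) i,
        ((if i ∈ J then {S i} else ∅ : Finset α) ⊆ U i) ↔ (i ∈ J → S i ∈ U i) := by
      intro U i
      split_ifs with hi <;> simp [hi]
    simp only [h2] at h
    refine h.trans_eq ?_
    congr 1
    rw [← Fintype.prod_ite_mem J fun j => (m / #(V j) : ℝ)]
    refine prod_congr rfl fun i _ => ?_
    split_ifs <;> simp
  rw [sum_card_filter_eq]
  refine (sum_le_sum h1).trans ?_
  rw [sum_const, nsmul_eq_mul, ← mul_assoc]
  refine mul_le_mul_of_nonneg_right ?_ (by positivity)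
  calc _ ≤ ε * (∏ j ∈ J, (#(V j) : ℝ)) * ∏ j ∈ J, (m / #(V j) : ℝ) := by gcongr
    _ = ε * m ^ #J := by
      rw [mul_assoc, ← prod_mul_distrib, ← prod_const]
      congr 1
      refine prod_congr rfl fun j _ => ?_
      have : 0 < #(V j) := lt_of_lt_of_le hm (hV j)
      field_simp

/-- A selection captures few pairs from a set `R` of pairs of transversals agreeing exactly
on `J`, provided each transversal is in relation with few others. -/
lemma sum_card_filter_pair_le {V : ι → Finset α} {m : ℕ} (hV : ∀ i, m ≤ #(V i))
    (hm : 1 ≤ m) {E : Finset (ι → α)} (hE : E ⊆ Fintype.piFinset V) {J : Finset ι}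
    {R : (ι → α) → (ι → α) → Prop} [∀ e e', Decidable (R e e')]
    (hR : ∀ e e', R e e' → ∀ i, e i = e' i ↔ i ∈ J) {ε : ℝ} (hε : 0 ≤ ε)
    (hRε : ∀ e ∈ E, (#{e' ∈ E | R e e'} : ℝ) ≤ ε * ∏ j ∈ univ \ J, (#(V j) : ℝ)) :
    ∑ U ∈ selections V m, (#{p ∈ {p ∈ E ×ˢ E | R p.1 p.2} |
        p.1 ∈ Fintype.piFinset U ∧ p.2 ∈ Fintype.piFinset U} : ℝ) ≤
      ε * m ^ (2 * Fintype.card ι - #J) * #(selections V m) := by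
  have hpos : ∀ i, (0 : ℝ) < #(V i) := fun i => by exact_mod_cast lt_of_lt_of_le hm (hV i)
  have hcard : (#{p ∈ E ×ˢ E | R p.1 p.2} : ℝ) ≤
      (∏ i, (#(V i) : ℝ)) * (ε * ∏ j ∈ univ \ J, (#(V j) : ℝ)) := by
    have h1 : #{p ∈ E ×ˢ E | R p.1 p.2} = ∑ e ∈ E, #{e' ∈ E | R e e'} := by
      simp_rw [card_filter]
      rw [sum_product]
    have h2 : (#E : ℝ) ≤ ∏ i, (#(V i) : ℝ) := by
      have := card_le_card hE
      rw [Fintype.card_piFinset] at this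
      exact_mod_cast this
    rw [h1]
    push_cast
    refine (sum_le_sum hRε).trans ?_
    rw [sum_const, nsmul_eq_mul]
    gcongr
  rw [sum_card_filter_eq]
  have h3 : ∀ p ∈ {p ∈ E ×ˢ E | R p.1 p.2},
      (#{U ∈ selections V m | p.1 ∈ Fintype.piFinset U ∧ p.2 ∈ Fintype.piFinset U} : ℝ) ≤
      ((∏ i, (m / #(V i) : ℝ)) * ∏ i ∈ univ \ J, (m / #(V i) : ℝ)) * #(selections V m) := by
    intro p hp
    rw [mem_filter, mem_product] at hp
    refine (card_filter_mem_and_mem_selections_le hV (hE hp.1.1) (hE hp.1.2)).trans_eq ?_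
    congr 1
    rw [← Fintype.prod_ite_mem (univ \ J) fun j => (m / #(V j) : ℝ), ← prod_mul_distrib]
    refine prod_congr rfl fun i _ => ?_
    simp only [hR _ _ hp.2 i, mem_sdiff, mem_univ, true_and]
    split_ifs
    · simp
    · ring
  refine (sum_le_sum h3).trans ?_
  rw [sum_const, nsmul_eq_mul, ← mul_assoc]
  refine mul_le_mul_of_nonneg_right ?_ (by positivity)
  have h4 : ∀ K : Finset ι, (∏ i ∈ K, (#(V i) : ℝ)) * ∏ i ∈ K, (m / #(V i) : ℝ) = m ^ #K := by
    intro K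
    rw [← prod_mul_distrib, ← prod_const]
    exact prod_congr rfl fun i _ => mul_div_cancel₀ _ (hpos i).ne'
  calc _ ≤ (∏ i, (#(V i) : ℝ)) * (ε * ∏ j ∈ univ \ J, (#(V j) : ℝ)) *
        ((∏ i, (m / #(V i) : ℝ)) * ∏ i ∈ univ \ J, (m / #(V i) : ℝ)) := by gcongr
    _ = ε * (((∏ i, (#(V i) : ℝ)) * ∏ i, (m / #(V i) : ℝ)) *
        ((∏ j ∈ univ \ J, (#(V j) : ℝ)) * ∏ i ∈ univ \ J, (m / #(V i) : ℝ))) := by ring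
    _ = _ := by
      rw [h4, h4, ← pow_add, card_sdiff_of_subset (subset_univ J), card_univ]
      have := card_le_univ J
      congr 2
      lia

end Selections

lemma BoundedOn.mono {k : ℕ} {V : Fin k → Finset ℕ} {E : Finset (Fin k → ℕ)}
    {φ : (Fin k → ℕ) → ℕ} {δ ε : ℝ} {J : Finset (Fin k)} (h : BoundedOn V E φ δ J)
    (hδε : δ ≤ ε) : BoundedOn V E φ ε J := by
  obtain ⟨B, hB, hcard, hdeg⟩ := h
  exact ⟨B, hB, hcard.trans (by gcongr), fun S hS hSB l => (hdeg S hS hSB l).trans (by gcongr)⟩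

/-- A nonnegative weight, small on average, which is at least `1` on every selection
containing two equally coloured edges that agree exactly on `J`. -/
lemma BoundedOn.exists_obstruction {k : ℕ} {V : Fin k → Finset ℕ} {E : Finset (Fin k → ℕ)}
    (hE : E ⊆ Fintype.piFinset V) {φ : (Fin k → ℕ) → ℕ} {ε : ℝ} (hε : 0 ≤ ε)
    {J : Finset (Fin k)} (h : BoundedOn V E φ ε J) {m : ℕ} (hV : ∀ i, m ≤ #(V i))
    (hm : 1 ≤ m) :
    ∃ bad : (Fin k → Finset ℕ) → ℝ, (∀ U, 0 ≤ bad U) ∧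
      ∑ U ∈ selections V m, bad U ≤
        (ε * m ^ (2 * k - #J) + ε * m ^ #J) * #(selections V m) ∧
      ∀ U, bad U < 1 → ∀ e ∈ E, e ∈ Fintype.piFinset U → ∀ e' ∈ E, e' ∈ Fintype.piFinset U →
        φ e = φ e' → ¬ ∀ i, e i = e' i ↔ i ∈ J := by
  obtain ⟨B, hB, hcard, hdeg⟩ := h
  let r : (Fin k → ℕ) → Fin k → ℕ := fun e i => if i ∈ J then e i else 0
  let R : (Fin k → ℕ) → (Fin k → ℕ) → Prop :=
    fun e e' => φ e = φ e' ∧ (∀ i, e i = e' i ↔ i ∈ J) ∧ r e ∉ B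
  let : ∀ e e', Decidable (R e e') := fun _ _ => Classical.dec _
  have hBV : ∀ S ∈ B, ∀ j ∈ J, S j ∈ V j := by
    intro S hS j hj
    have := Fintype.mem_piFinset.1 (hB hS) j
    rwa [if_pos hj] at this
  have hRε : ∀ e ∈ E, (#{e' ∈ E | R e e'} : ℝ) ≤ ε * ∏ j ∈ univ \ J, (#(V j) : ℝ) := by
    intro e he
    by_cases hre : r e ∈ B
    · rw [filter_eq_empty_iff.2 fun e' _ h => h.2.2 hre, card_empty, Nat.cast_zero]
      positivity
    · refine le_trans ?_ (hdeg (r e) ?_ hre (φ e))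
      · refine Nat.cast_le.2 (card_le_card (monotone_filter_right _ fun e' _ h => ?_))
        exact ⟨fun j hj => by simp [r, hj, (h.2.1 j).2 hj], h.1.symm⟩
      · refine Fintype.mem_piFinset.2 fun i => ?_
        have := Fintype.mem_piFinset.1 (hE he) i
        simp only [r]
        split_ifs <;> simp [this]
  refine ⟨fun U => (#{p ∈ {p ∈ E ×ˢ E | R p.1 p.2} |
      p.1 ∈ Fintype.piFinset U ∧ p.2 ∈ Fintype.piFinset U} : ℝ) +
      (#{S ∈ B | ∀ j ∈ J, S j ∈ U j} : ℝ), fun U => by positivity, ?_, ?_⟩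
  · have h1 := sum_card_filter_pair_le hV hm hE (R := R) (fun e e' h => h.2.1) hε hRε
    have h2 := sum_card_filter_partial_le hV hm hBV hcard
    rw [Fintype.card_fin] at h1
    rw [sum_add_distrib, add_mul]
    refine add_le_add h1 (le_of_eq_of_le ?_ h2)
    congr!
  · intro U hU e he heU e' he' heU' hφ hJ
    have hU' : #{p ∈ {p ∈ E ×ˢ E | R p.1 p.2} |
        p.1 ∈ Fintype.piFinset U ∧ p.2 ∈ Fintype.piFinset U} +
        #{S ∈ B | ∀ j ∈ J, S j ∈ U j} < 1 := by
      simp only [] at hU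
      exact_mod_cast hU
    rw [Nat.lt_one_iff, Nat.add_eq_zero_iff, card_eq_zero, card_eq_zero] at hU'
    by_cases hre : r e ∈ B
    · refine filter_eq_empty_iff.1 hU'.2 hre fun j hj => ?_
      simpa [r, hj] using Fintype.mem_piFinset.1 heU j
    · exact filter_eq_empty_iff.1 hU'.1 (x := (e, e'))
        (mem_filter.2 ⟨mem_product.2 ⟨he, he'⟩, hφ, hJ, hre⟩) ⟨heU, heU'⟩

/-- **Dense rainbow subhypergraphs in bounded colourings.**
Let `k ≥ 2` and `H = (V 1 ∪̇ … ∪̇ V k, E)` a `k`-partite `k`-uniform hypergraph of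
density `d = |E|/∏|V i| > 0`, with a `(δ 0, …, δ (k-1))`-bounded colouring `φ`,
`δ j ∈ (0,1]`.  If `2^(k+3)/d ≤ m ≤ min |V i|` and `δ j < 1/(2^(k+1) m^(2k-j))`
for all `j ≤ k-1`, then there are `U i ⊆ V i` with `|U i| = m` such that the induced
subhypergraph has at least `(d/2) m^k` edges and `φ` is injective on its edges. -/
theorem dense_rainbow_in_bounded_colouring (k : ℕ) (hk : 2 ≤ k)
    (V : Fin k → Finset ℕ) (E : Finset (Fin k → ℕ)) (hE : E ⊆ Fintype.piFinset V)
    (d : ℝ) (hd : d = (E.card : ℝ) / ∏ i, ((V i).card : ℝ)) (hd0 : 0 < d)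
    (δ : Fin k → ℝ) (hδ : ∀ j, δ j ∈ Set.Ioc (0 : ℝ) 1)
    (φ : (Fin k → ℕ) → ℕ)
    (hbdd : ∀ j : Fin k, ∀ J : Finset (Fin k), J.card = j.1 → BoundedOn V E φ (δ j) J)
    (m : ℕ)
    (hm1 : 2 ^ (k + 3) / d ≤ (m : ℝ)) (hm2 : ∀ i, m ≤ (V i).card)
    (hδm : ∀ j : Fin k, δ j < 1 / (2 ^ (k + 1) * (m : ℝ) ^ (2 * k - j.1))) :
    ∃ U : Fin k → Finset ℕ, (∀ i, U i ⊆ V i) ∧ (∀ i, (U i).card = m) ∧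
      (d / 2) * (m : ℝ) ^ k ≤ ((E.filter fun e => e ∈ Fintype.piFinset U).card : ℝ) ∧
      ∀ e ∈ E.filter fun e => e ∈ Fintype.piFinset U,
        ∀ e' ∈ E.filter fun e => e ∈ Fintype.piFinset U,
          φ e = φ e' → e = e' := by
  have hprod : 0 < ∏ i, (#(V i) : ℝ) := by
    refine lt_of_le_of_ne (by positivity) fun h => ?_
    rw [hd, ← h, div_zero] at hd0
    exact lt_irrefl _ hd0
  have hd1 : d ≤ 1 := by
    rw [hd, div_le_one hprod]
    have := card_le_card hE
    rw [Fintype.card_piFinset] at this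
    exact_mod_cast this
  have hdm : 2 ^ (k + 3) ≤ d * m := by
    rw [div_le_iff₀ hd0] at hm1
    linarith
  have hmk : (2 : ℝ) ^ (k + 3) ≤ m :=
    hdm.trans (mul_le_of_le_one_left (by positivity) hd1)
  have hm : 1 ≤ m := by
    have : (1 : ℝ) ≤ m := (one_le_pow₀ (by norm_num)).trans hmk
    exact_mod_cast this
  have hm0 : (0 : ℝ) < m := by exact_mod_cast hm
  set N : ℝ := (#(selections V m) : ℝ) with hN
  have hN0 : 0 < N := by
    rw [hN, card_selections]
    exact_mod_cast prod_pos fun i _ => Nat.choose_pos (hm2 i)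
  set μ : ℝ := d * m ^ k with hμ
  have hμ0 : 0 < μ := by positivity
  have hμ' : μ = #E * ∏ i, (m / #(V i) : ℝ) := by
    rw [hμ, hd, prod_div_distrib, prod_const, card_univ, Fintype.card_fin]
    ring
  set X : (Fin k → Finset ℕ) → ℝ := fun U => (#{e ∈ E | e ∈ Fintype.piFinset U} : ℝ)
  have hvar : ∑ U ∈ selections V m, 4 / μ ^ 2 * (X U - μ) ^ 2 ≤
      (2 ^ k - 1) / 2 ^ (k + 1) * N := by
    have h := sum_sq_card_sub_le hE hm2 hm hμ'
    rw [Fintype.card_fin] at h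
    have h1 : (1 : ℝ) ≤ 2 ^ k := one_le_pow₀ (by norm_num)
    rw [← mul_sum]
    have h2 : ∑ U ∈ selections V m, (X U - μ) ^ 2 ≤ μ * ((2 ^ k - 1) * m ^ k) * N / m := by
      rw [le_div_iff₀ hm0, mul_comm]
      exact h
    calc _ ≤ 4 / μ ^ 2 * (μ * ((2 ^ k - 1) * m ^ k) * N / m) := by gcongr
      _ = 4 * (2 ^ k - 1) * N / (d * m) := by
        rw [hμ]
        field_simp
      _ ≤ 4 * (2 ^ k - 1) * N / 2 ^ (k + 3) := by
        have : (0 : ℝ) ≤ 4 * (2 ^ k - 1) * N :=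
          mul_nonneg (mul_nonneg (by norm_num) (by linarith)) hN0.le
        gcongr
      _ = _ := by
        rw [pow_add, pow_add]
        field_simp
        ring
  have hobs : ∀ J : Finset (Fin k), ∃ bad : (Fin k → Finset ℕ) → ℝ, J ∈ univ.ssubsets →
      (∀ U, 0 ≤ bad U) ∧
      ∑ U ∈ selections V m, bad U ≤ 1 / 2 ^ (k + 1) * (1 + 1 / 2 ^ (k + 3)) * N ∧
      ∀ U, bad U < 1 → ∀ e ∈ E, e ∈ Fintype.piFinset U → ∀ e' ∈ E, e' ∈ Fintype.piFinset U →
        φ e = φ e' → ¬ ∀ i, e i = e' i ↔ i ∈ J := by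
    intro J
    by_cases hJ : J ∈ univ.ssubsets
    swap
    · exact ⟨0, fun h => absurd h hJ⟩
    have hJk : #J < k := by
      simpa using card_lt_card (mem_ssubsets.1 hJ)
    obtain ⟨bad, h0, h1, h2⟩ := ((hbdd ⟨#J, hJk⟩ J rfl).mono
      (hδm ⟨#J, hJk⟩).le).exists_obstruction hE (by positivity) hm2 hm
    refine ⟨bad, fun _ => ⟨h0, h1.trans (mul_le_mul_of_nonneg_right ?_ hN0.le), h2⟩⟩
    have h3 : (m : ℝ) ^ #J / m ^ (2 * k - #J) ≤ 1 / 2 ^ (k + 3) := by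
      rw [div_le_div_iff₀ (by positivity) (by positivity), one_mul]
      calc (m : ℝ) ^ #J * 2 ^ (k + 3) ≤ m ^ #J * m := by gcongr
        _ = m ^ (#J + 1) := by ring
        _ ≤ _ := pow_le_pow_right₀ (by exact_mod_cast hm) (by lia)
    calc _ = 1 / 2 ^ (k + 1) * (1 + (m : ℝ) ^ #J / m ^ (2 * k - #J)) := by
          field_simp
      _ ≤ _ := by gcongr
  choose bad hbad using hobs
  obtain ⟨U, hU, hU1⟩ : ∃ U ∈ selections V m,
      4 / μ ^ 2 * (X U - μ) ^ 2 + ∑ J ∈ univ.ssubsets, bad J U < 1 := by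
    refine exists_lt_of_sum_lt ?_
    rw [sum_add_distrib, sum_comm, sum_const, nsmul_eq_mul, mul_one]
    have hbad' := sum_le_sum fun J hJ => (hbad J hJ).2.1
    rw [sum_const, ssubsets, card_erase_of_mem (mem_powerset_self _), card_powerset,
      card_univ, Fintype.card_fin, nsmul_eq_mul,
      Nat.cast_sub Nat.one_le_two_pow] at hbad'
    push_cast at hbad'
    refine (add_le_add hvar hbad').trans_lt ?_
    rw [← mul_assoc, ← add_mul]
    refine mul_lt_of_lt_one_left hN0 ?_
    have h1 : (1 : ℝ) ≤ 2 ^ k := one_le_pow₀ (by norm_num)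
    rw [pow_add, pow_add]
    generalize (2 : ℝ) ^ k = a at h1
    have : (a - 1) / (a * 2 ^ 1) + (a - 1) * (1 / (a * 2 ^ 1) * (1 + 1 / (a * 2 ^ 3))) =
        1 - (15 * a + 1) / (16 * a ^ 2) := by
      field_simp
      ring
    rw [this]
    have : 0 < (15 * a + 1) / (16 * a ^ 2) := by positivity
    linarith
  have hbad0 : ∀ J ∈ (univ : Finset (Fin k)).ssubsets, 0 ≤ bad J U :=
    fun J hJ => (hbad J hJ).1 U
  have hUmem : ∀ i, U i ⊆ V i ∧ #(U i) = m := fun i =>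
    mem_powersetCard.1 (Fintype.mem_piFinset.1 hU i)
  refine ⟨U, fun i => (hUmem i).1, fun i => (hUmem i).2, ?_, ?_⟩
  · change d / 2 * m ^ k ≤ X U
    have h1 : 4 / μ ^ 2 * (X U - μ) ^ 2 < 1 := by linarith [sum_nonneg hbad0]
    rw [div_mul_eq_mul_div, div_lt_one (by positivity)] at h1
    by_contra! hlt
    have h2 : X U < μ / 2 := by rw [hμ]; linarith
    nlinarith
  · intro e he e' he' hφ
    rw [mem_filter] at he he'
    by_contra hne
    have hJ : ({i | e i = e' i} : Finset (Fin k)) ∈ univ.ssubsets := by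
      rw [mem_ssubsets, ssubset_univ_iff]
      intro h
      refine hne (funext fun i => ?_)
      have := mem_univ i
      rw [← h] at this
      simpa using this
    refine (hbad _ hJ).2.2 U ?_ e he.1 he.2 e' he'.1 he'.2 hφ (by simp)
    refine lt_of_le_of_lt (single_le_sum hbad0 hJ) ?_
    have : 0 ≤ 4 / μ ^ 2 * (X U - μ) ^ 2 := by positivity
    linarith
end

section
/- For every integer k ≥ 2 and every ε ∈ (0,1), for all sufficiently large t the following holds: there exists a colouring φ: E(K^{(k)}_{n,…,n}) → ℕ of the complete k-partite k-uniform hypergraph with all classes of size n = ⌈t^{(1−ε)t^{k−1}}⌉ that yields no canonical copy of K^{(k)}_{t,…,t}. Consequently, ER(K^{(k)}_{t,…,t}) ≥ t^{(1−o(1))t^{k−1}} as t → ∞. (Such a colouring can be obtained by colouring edges uniformly at random with t^k − 1 colours.) -/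
/-- A union bound: if each of fewer than `|β| ^ s` indices `x` comes with a set `S x` of `s` points
and a map `r x` from `S x` to its complement, some colouring by `β` separates, for every `x`, some
point of `S x` from its image under `r x`. -/
theorem exists_forall_exists_ne_of_card_lt_pow {α β ι : Type*} [DecidableEq α] [Fintype β]
    [Nonempty β] [Fintype ι] (E : Finset α) (S : ι → Finset α) (r : ι → α → α) (s : ℕ)
    (hSE : ∀ x, S x ⊆ E) (hS : ∀ x, (S x).card = s) (hr : ∀ x, ∀ a ∈ S x, r x a ∈ E \ S x)
    (hcard : Fintype.card ι < Fintype.card β ^ s) :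
    ∃ g : α → β, ∀ x, ∃ a ∈ S x, g a ≠ g (r x a) := by
  by_contra! hcon
  let F : (Σ x : ι, ((E \ S x : Finset α) → β)) → (E → β) := fun p a =>
    if h : (a : α) ∈ S p.1 then p.2 ⟨r p.1 a, hr _ _ h⟩
    else p.2 ⟨a, Finset.mem_sdiff.2 ⟨a.2, h⟩⟩
  have hF : Function.Surjective F := by
    intro g
    obtain ⟨x, hx⟩ := hcon fun a => if h : a ∈ E then g ⟨a, h⟩ else Classical.arbitrary β
    refine ⟨⟨x, fun a => g ⟨a, (Finset.mem_sdiff.1 a.2).1⟩⟩, ?_⟩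
    funext a
    by_cases h : (a : α) ∈ S x
    · have := hx a h
      simp only [a.2, (Finset.mem_sdiff.1 (hr x a h)).1, dif_pos] at this
      simp [F, h, this]
    · simp [F, h]
  obtain ⟨x₀, -⟩ := hcon fun _ => Classical.arbitrary β
  have hle := Fintype.card_le_of_surjective F hF
  have hsE : s ≤ E.card := hS x₀ ▸ Finset.card_le_card (hSE x₀)
  have hsd : ∀ x, (E \ S x).card = E.card - s := fun x => by
    rw [Finset.card_sdiff_of_subset (hSE x), hS]
  simp only [Fintype.card_sigma, Fintype.card_fun, Fintype.card_coe, hsd, Finset.sum_const,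
    Finset.card_univ, smul_eq_mul] at hle
  have hpos : 0 < Fintype.card β ^ (E.card - s) := pow_pos Fintype.card_pos _
  have := Nat.mul_lt_mul_of_pos_right hcard hpos
  rw [← pow_add, Nat.add_sub_cancel' hsE] at this
  omega

/-- Under a counting condition, some colouring with `C` colours depends on every coordinate on
each box with sides of size `t`. -/
theorem exists_coloring_depending_on_each_coordinate {k t n C : ℕ} (ht : 0 < t) (hC : 0 < C)
    (V : Fin k → Finset ℕ) (hV : ∀ i, (V i).card = n)
    (hcard : k * (n ^ t) ^ k < C ^ (t ^ (k - 1) * (t - 1))) :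
    ∃ g : (Fin k → ℕ) → Fin C, ∀ (i : Fin k) (U : Fin k → Finset ℕ),
      (∀ j, U j ⊆ V j) → (∀ j, (U j).card = t) →
      ∃ e ∈ Fintype.piFinset U, ∃ u ∈ U i, g e ≠ g (Function.update e i u) := by
  classical
  have : Nonempty (Fin C) := ⟨⟨0, hC⟩⟩
  let P := Fintype.piFinset fun i => Finset.powersetCard t (V i)
  have hP : ∀ x : Fin k × P, ∀ j, x.2.1 j ⊆ V j ∧ (x.2.1 j).card = t := fun x j =>
    Finset.mem_powersetCard.1 (Fintype.mem_piFinset.1 x.2.2 j)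
  have hne : ∀ x : Fin k × P, ∃ u, u ∈ x.2.1 x.1 := fun x =>
    Finset.card_pos.1 ((hP x x.1).2 ▸ ht)
  choose u hu using hne
  let S : Fin k × P → Finset (Fin k → ℕ) := fun x =>
    Fintype.piFinset (Function.update x.2.1 x.1 ((x.2.1 x.1).erase (u x)))
  have hSmem : ∀ x e, e ∈ S x → e ∈ Fintype.piFinset x.2.1 := by
    intro x e he
    rw [Fintype.mem_piFinset] at he ⊢
    intro j
    have := he j
    by_cases hj : j = x.1
    · subst hj
      rw [Function.update_self] at this
      exact Finset.mem_of_mem_erase this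
    · rwa [Function.update_of_ne hj] at this
  have hPV : ∀ (x : Fin k × P) e, e ∈ Fintype.piFinset x.2.1 → e ∈ Fintype.piFinset V :=
    fun x e he => Fintype.mem_piFinset.2 fun j => (hP x j).1 (Fintype.mem_piFinset.1 he j)
  have hSr : ∀ (x : Fin k × P) e, e ∈ S x →
      Function.update e x.1 (u x) ∈ Fintype.piFinset V \ S x := by
    intro x e he
    refine Finset.mem_sdiff.2 ⟨hPV x _ (Fintype.mem_piFinset.2 fun j => ?_), fun h => ?_⟩
    · by_cases hj : j = x.1
      · subst hj
        rw [Function.update_self]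
        exact hu x
      · rw [Function.update_of_ne hj]
        exact Fintype.mem_piFinset.1 (hSmem x e he) j
    · have := Fintype.mem_piFinset.1 h x.1
      simp at this
  have hScard : ∀ x, (S x).card = t ^ (k - 1) * (t - 1) := by
    intro x
    rw [Fintype.card_piFinset, ← Finset.mul_prod_erase _ _ (Finset.mem_univ x.1),
      Function.update_self, Finset.card_erase_of_mem (hu x), (hP x x.1).2, mul_comm,
      Finset.prod_congr rfl (g := fun _ => t)]
    · simp
    · intro j hj
      rw [Function.update_of_ne (Finset.ne_of_mem_erase hj), (hP x j).2]
  have hι : Fintype.card (Fin k × P) < Fintype.card (Fin C) ^ (t ^ (k - 1) * (t - 1)) := by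
    refine lt_of_le_of_lt ?_ (hcard.trans_eq (by simp))
    simp only [Fintype.card_prod, Fintype.card_fin, Fintype.card_coe, P, Fintype.card_piFinset,
      Finset.card_powersetCard, hV, Finset.prod_const, Finset.card_univ]
    gcongr
    exact Nat.choose_le_pow n t
  obtain ⟨g, hg⟩ := exists_forall_exists_ne_of_card_lt_pow (β := Fin C) (Fintype.piFinset V) S
    (fun x e => Function.update e x.1 (u x)) _ (fun x e he => hPV x e (hSmem x e he)) hScard hSr hι
  refine ⟨g, fun i U hUV hU => ?_⟩
  have hUP : U ∈ P := Fintype.mem_piFinset.2 fun j => Finset.mem_powersetCard.2 ⟨hUV j, hU j⟩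
  obtain ⟨e, he, hne⟩ := hg (i, ⟨U, hUP⟩)
  exact ⟨e, hSmem _ e he, _, hu (i, ⟨U, hUP⟩), hne⟩

/-- The counting condition of `exists_coloring_depending_on_each_coordinate` for `t ^ k - 1`
colours. -/
theorem mul_ceil_pow_lt_pow {k t : ℕ} (hk : 2 ≤ k) {ε : ℝ} (hε : 0 < ε) (hε' : ε < 1)
    (ht : 4 / ε < Real.log t) :
    k * (⌈(t : ℝ) ^ ((1 - ε) * ((t : ℝ) ^ (k - 1)))⌉₊ ^ t) ^ k
      < (t ^ k - 1) ^ (t ^ (k - 1) * (t - 1)) := by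
  have h4 : 4 < ε * Real.log t := by rwa [div_lt_iff₀' hε] at ht
  set L := Real.log t with hL
  have hL4 : 4 < L := by nlinarith
  have htL : L < t := by
    have ht0 : (t : ℝ) ≠ 0 := by
      intro h
      rw [hL, h, Real.log_zero] at hL4
      linarith
    have := Real.log_le_sub_one_of_pos (lt_of_le_of_ne (Nat.cast_nonneg t) ht0.symm)
    linarith
  have ht4 : (4 : ℝ) < t := hL4.trans htL
  have htpos : (0 : ℝ) < t := by linarith
  have ht1 : 1 ≤ t := by exact_mod_cast (by linarith : (1 : ℝ) ≤ t)
  have hk2 : (2 : ℝ) ≤ k := by exact_mod_cast hk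
  set m : ℝ := (t : ℝ) ^ (k - 1) with hm
  have hmt : (t : ℝ) ≤ m := le_self_pow₀ (by linarith) (by omega)
  have hmk : m * t = (t : ℝ) ^ k := by rw [hm, ← pow_succ, Nat.sub_add_cancel (by omega)]
  set n := ⌈(t : ℝ) ^ ((1 - ε) * m)⌉₊ with hn
  have hx1 : 1 ≤ (t : ℝ) ^ ((1 - ε) * m) :=
    Real.one_le_rpow (by linarith) (mul_nonneg (by linarith) (by linarith))
  have hn1 : (1 : ℝ) ≤ n := hx1.trans (Nat.le_ceil _)
  have hn2 : (n : ℝ) ≤ 2 * (t : ℝ) ^ ((1 - ε) * m) := by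
    have := Nat.ceil_lt_add_one (zero_le_one.trans hx1)
    linarith
  have hlog2 : Real.log 2 ≤ 1 := by linarith [Real.log_two_lt_d9]
  have hlogn : Real.log n ≤ 1 + (1 - ε) * m * L := by
    have := Real.log_le_log (by linarith) hn2
    rw [Real.log_mul (by norm_num) (by linarith), Real.log_rpow htpos] at this
    linarith
  have hlogk : Real.log k ≤ k := by
    have := Real.log_le_sub_one_of_pos (by linarith : (0 : ℝ) < k)
    linarith
  have htk : (2 : ℝ) ≤ (t : ℝ) ^ k := by nlinarith
  have hCge : (t : ℝ) ^ k / 2 ≤ (t : ℝ) ^ k - 1 := by linarith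
  have hlogC : k * L - 1 ≤ Real.log ((t : ℝ) ^ k - 1) := by
    have := Real.log_le_log (by linarith) hCge
    rw [Real.log_div (by linarith) (by norm_num), Real.log_pow] at this
    linarith
  have hcast : ((t ^ k - 1 : ℕ) : ℝ) = (t : ℝ) ^ k - 1 := by
    rw [Nat.cast_sub (Nat.one_le_pow _ _ ht1)]
    simp
  rw [← Nat.cast_lt (α := ℝ)]
  simp only [Nat.cast_mul, Nat.cast_pow, hcast]
  rw [← Real.log_lt_log_iff (by positivity) (pow_pos (by linarith) _),
    Real.log_mul (by linarith) (by positivity), Real.log_pow, Real.log_pow, Real.log_pow]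
  simp only [Nat.cast_mul, Nat.cast_pow, Nat.cast_sub ht1, Nat.cast_one]
  rw [← hm]
  have hleft : Real.log k + k * (t * Real.log n) ≤ k + k * (t * (1 + (1 - ε) * m * L)) := by
    gcongr
  have hright : m * (t - 1) * (k * L - 1) ≤ m * (t - 1) * Real.log ((t : ℝ) ^ k - 1) :=
    mul_le_mul_of_nonneg_left hlogC (mul_nonneg (by linarith) (by linarith))
  refine lt_of_le_of_lt hleft (lt_of_lt_of_le ?_ hright)
  have hεt : 4 < ε * t := by nlinarith
  have hm0 : 0 < m := htpos.trans_le hmt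
  have hkm : (0 : ℝ) < k * m := by positivity
  have hB : 4 * (k * m) * t < k * m * t * (ε * L) := by
    have := mul_lt_mul_of_pos_left h4 (mul_pos hkm htpos)
    linarith
  nlinarith [mul_pos hkm htpos, mul_pos hm0 htpos]


/-- **Lower bound for partite canonical Ramsey numbers.**
For every `k ≥ 2` and `ε ∈ (0,1)`, for all sufficiently large `t` there is a
colouring `φ` of the complete `k`-partite `k`-uniform hypergraph with all classes of
size `n = ⌈t^((1-ε) t^(k-1))⌉` admitting no canonical copy of `K^(k)_{t,…,t}`;
consequently `ER(K^(k)_{t,…,t}) ≥ t^((1-o(1)) t^(k-1))`.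
Edges are encoded as transversals `e : Fin k → ℕ` with `e i ∈ V i`; a copy on classes
`U i ⊆ V i` of size `t` is canonical if for some `J ⊆ [k]` two of its edges get equal
colours iff they agree on the coordinates in `J`. -/
theorem canonical_ramsey_partite_lower_bound (k : ℕ) (hk : 2 ≤ k)
    (ε : ℝ) (hε : ε ∈ Set.Ioo (0 : ℝ) 1) :
    ∃ t₀ : ℕ, ∀ t : ℕ, t₀ ≤ t →
      ∀ V : Fin k → Finset ℕ,
        (∀ i, (V i).card = ⌈(t : ℝ) ^ ((1 - ε) * ((t : ℝ) ^ (k - 1)))⌉₊) →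
        ∃ φ : (Fin k → ℕ) → ℕ,
          ¬ ∃ (U : Fin k → Finset ℕ) (J : Finset (Fin k)),
              (∀ i, U i ⊆ V i) ∧ (∀ i, (U i).card = t) ∧
              ∀ e ∈ Fintype.piFinset U, ∀ e' ∈ Fintype.piFinset U,
                (φ e = φ e' ↔ ∀ j ∈ J, e j = e' j) := by
  classical
  obtain ⟨hε0, hε1⟩ := hε
  refine ⟨⌈Real.exp (4 / ε)⌉₊ + 1, fun t ht V hV => ?_⟩
  have hexp : Real.exp (4 / ε) < t := by
    have h : (⌈Real.exp (4 / ε)⌉₊ : ℝ) + 1 ≤ t := by exact_mod_cast ht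
    linarith [Nat.le_ceil (Real.exp (4 / ε))]
  have hlog : 4 / ε < Real.log t := (Real.lt_log_iff_exp_lt ((Real.exp_pos _).trans hexp)).2 hexp
  have ht2 : 2 ≤ t := by
    have : 0 < ⌈Real.exp (4 / ε)⌉₊ := Nat.ceil_pos.2 (Real.exp_pos _)
    omega
  have htk : 2 ≤ t ^ k := ht2.trans (Nat.le_self_pow (by omega) t)
  obtain ⟨g, hg⟩ := exists_coloring_depending_on_each_coordinate (C := t ^ k - 1) (by omega)
    (by omega) V hV (mul_ceil_pow_lt_pow hk hε0 hε1 hlog)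
  refine ⟨fun e => g e, ?_⟩
  rintro ⟨U, J, hUV, hU, hJ⟩
  by_cases hJu : J = Finset.univ
  · have hcard : Fintype.card (Fin (t ^ k - 1)) < (Fintype.piFinset U).card := by
      simp only [Fintype.card_fin, Fintype.card_piFinset, hU, Finset.prod_const, Finset.card_univ]
      omega
    obtain ⟨e, he, e', he', hne, heq⟩ := Finset.exists_ne_map_eq_of_card_lt_of_maps_to
      (t := Finset.univ) (f := g) hcard fun _ _ => Finset.mem_univ _
    exact hne (funext fun j => (hJ e he e' he').1 (congrArg _ heq) j (hJu ▸ Finset.mem_univ j))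
  · obtain ⟨i, hi⟩ : ∃ i, i ∉ J := by
      by_contra! h
      exact hJu (Finset.eq_univ_iff_forall.2 h)
    obtain ⟨e, he, u, hu, hne⟩ := hg i U hUV hU
    have hmem : Function.update e i u ∈ Fintype.piFinset U := Fintype.mem_piFinset.2 fun j => by
      by_cases hj : j = i
      · subst hj
        rwa [Function.update_self]
      · rw [Function.update_of_ne hj]
        exact Fintype.mem_piFinset.1 he j
    refine hne (Fin.ext ((hJ e he _ hmem).2 fun j hj => ?_))
    rw [Function.update_of_ne (ne_of_mem_of_not_mem hj hi)]
end

section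
/- Let k ≥ 2, let δ ∈ (0,1], and let t, n be positive integers satisfying (δ/4^{k−1})·√(δn) ≥ 2t and (δ/4^{k−1})^{t^{k−1}} · n ≥ 2t. Let φ: E(K^{(k)}_{n,…,n}) → ℕ be a colouring of the complete k-partite k-uniform hypergraph with classes V₁,…,V_k of size n, and suppose there is a set U ⊆ V₁ with |U| ≥ δn and a function ℓ: U → ℕ such that every u ∈ U is contained in at least δ·n^{k−1} edges e with φ(e) = ℓ(u). Then there are sets U_i ⊆ V_i with |U_i| = t for every i ∈ [k] spanning a copy of K^{(k)}_{t,…,t} on whose edges φ is either monochromatic or {1}-canonical (i.e., two edges of the copy receive the same colour if and only if they contain the same vertex of U₁). -/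
/-- A finite set has a subset of at least square-root size on which a given function is
constant or injective. -/
theorem Finset.exists_subset_constant_or_injOn {α β : Type*} [DecidableEq β]
    (s : Finset α) (f : α → β) :
    ∃ s' ⊆ s, s.card ≤ s'.card ^ 2 ∧
      ((∀ a ∈ s', ∀ b ∈ s', f a = f b) ∨ Set.InjOn f s') := by
  by_cases himg : s.card ≤ (s.image f).card ^ 2
  · obtain ⟨s', hs', hinj, himage⟩ := Finset.exists_subset_injOn_image_eq_of_surjOn (f := f)
      (s : Set α) (s.image f) (by rw [Finset.coe_image]; exact Set.surjOn_image f s)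
    refine ⟨s', Finset.coe_subset.1 hs', ?_, Or.inr hinj⟩
    rwa [← Finset.card_image_of_injOn hinj, himage]
  by_cases hfib : ∃ y ∈ s.image f, s.card ≤ (s.filter fun a => f a = y).card ^ 2
  · obtain ⟨y, -, hy⟩ := hfib
    refine ⟨_, Finset.filter_subset _ _, hy, Or.inl fun a ha b hb => ?_⟩
    rw [(Finset.mem_filter.1 ha).2, (Finset.mem_filter.1 hb).2]
  push Not at himg hfib
  have hbound := Finset.card_le_mul_card_image (f := f) s (Nat.sqrt (s.card - 1))
    (fun y hy => Nat.le_sqrt'.2 (Nat.le_sub_one_of_lt (hfib y hy)))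
  have hc : (s.image f).card ≤ Nat.sqrt (s.card - 1) :=
    Nat.le_sqrt'.2 (Nat.le_sub_one_of_lt himg)
  have hsq := Nat.sqrt_le (s.card - 1)
  have := hbound.trans ((Nat.mul_le_mul_left _ hc).trans hsq)
  omega

/-- The Kővári–Sós–Turán averaging argument: in a bipartite graph of density at least `d`, some
`t`-set on the left has at least a proportion `(d / 2) ^ t` of the right side as common
neighbours. -/
theorem exists_card_eq_le_card_common_neighbors {α β : Type*} (A : Finset α)
    (B : Finset β) (R : α → β → Prop) [∀ a b, Decidable (R a b)] {d : ℝ} (hd : 0 < d)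
    (hd1 : d ≤ 1) {t : ℕ} (ht : 1 ≤ t) (hA : 2 * (t : ℝ) ≤ d * A.card)
    (hR : d * (A.card * B.card) ≤ ∑ b ∈ B, ((A.filter fun a => R a b).card : ℝ)) :
    ∃ T ⊆ A, T.card = t ∧
      (d / 2) ^ t * B.card ≤ ((B.filter fun b => ∀ a ∈ T, R a b).card : ℝ) := by
  set D : β → Finset α := fun b => A.filter fun a => R a b with hD
  have hm : (0 : ℝ) ≤ A.card := Nat.cast_nonneg _
  have htA : t ≤ A.card := by
    have : (t : ℝ) ≤ A.card := by nlinarith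
    exact_mod_cast this
  have hcount : ∑ T ∈ A.powersetCard t, ((B.filter fun b => ∀ a ∈ T, R a b).card : ℝ)
      = ∑ b ∈ B, ((D b).card.choose t : ℝ) := by
    norm_cast
    simp_rw [← Finset.card_powersetCard]
    have key := Finset.sum_card_bipartiteAbove_eq_sum_card_bipartiteBelow
      (s := A.powersetCard t) (t := B) (fun T b => ∀ a ∈ T, R a b)
    refine key.trans (Finset.sum_congr rfl fun b _ => congrArg Finset.card ?_)
    ext T
    simp only [Finset.bipartiteBelow, Finset.mem_filter, Finset.mem_powersetCard, hD,
      Finset.subset_iff]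
    grind
  have hpow : (d / 2) ^ t * B.card * (A.card : ℝ) ^ t
      ≤ ∑ b ∈ B, (max ((D b).card - t : ℝ) 0) ^ t := by
    rcases B.eq_empty_or_nonempty with rfl | hB
    · simp
    have hBpos : (0 : ℝ) < B.card := by exact_mod_cast hB.card_pos
    obtain ⟨s, rfl⟩ : ∃ s, t = s + 1 := ⟨t - 1, by omega⟩
    refine le_trans ?_ (pow_sum_div_card_le_sum_pow (fun b _ => le_max_right _ _) s)
    have hlow : d / 2 * A.card * B.card ≤ ∑ b ∈ B, max ((D b).card - (s + 1 : ℕ) : ℝ) 0 :=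
      calc d / 2 * A.card * B.card ≤ d * (A.card * B.card) - B.card * (s + 1 : ℕ) := by
            nlinarith
        _ ≤ ∑ b ∈ B, ((D b).card - (s + 1 : ℕ) : ℝ) := by
            rw [Finset.sum_sub_distrib, Finset.sum_const, nsmul_eq_mul]
            linarith
        _ ≤ _ := Finset.sum_le_sum fun b _ => le_max_left _ _
    rw [le_div_iff₀ (by positivity)]
    calc _ = (d / 2 * A.card * B.card) ^ (s + 1) := by ring
      _ ≤ _ := by gcongr
  have hsum : ∑ _T ∈ A.powersetCard t, (d / 2) ^ t * (B.card : ℝ)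
      ≤ ∑ T ∈ A.powersetCard t, ((B.filter fun b => ∀ a ∈ T, R a b).card : ℝ) := by
    rw [hcount, Finset.sum_const, Finset.card_powersetCard, nsmul_eq_mul]
    have hfac : (0 : ℝ) < t.factorial := by exact_mod_cast t.factorial_pos
    refine le_of_mul_le_mul_left ?_ hfac
    rw [Finset.mul_sum, ← mul_assoc]
    calc _ = (A.card.descFactorial t : ℝ) * ((d / 2) ^ t * B.card) := by
          rw [Nat.descFactorial_eq_factorial_mul_choose]; push_cast; ring
      _ ≤ (A.card : ℝ) ^ t * ((d / 2) ^ t * B.card) := by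
          gcongr
          exact_mod_cast Nat.descFactorial_le_pow _ _
      _ ≤ ∑ b ∈ B, (max ((D b).card - t : ℝ) 0) ^ t := by linarith
      _ ≤ _ := by
          refine Finset.sum_le_sum fun b _ => ?_
          have h1 : ((D b).card + 1 - t) ^ t ≤ (D b).card.descFactorial t :=
            Nat.pow_sub_le_descFactorial _ _
          rw [Nat.descFactorial_eq_factorial_mul_choose] at h1
          refine le_trans ?_ (show (((D b).card + 1 - t : ℕ) : ℝ) ^ t ≤ _ by exact_mod_cast h1)
          gcongr
          refine max_le ?_ (Nat.cast_nonneg _)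
          rw [sub_le_iff_le_add]
          norm_cast
          omega
  obtain ⟨T, hT, hle⟩ := Finset.exists_le_of_sum_le
    (Finset.powersetCard_nonempty.2 htA) hsum
  exact ⟨T, (Finset.mem_powersetCard.1 hT).1, (Finset.mem_powersetCard.1 hT).2, hle⟩

/-- Erdős's theorem on complete `(r + 1)`-partite subhypergraphs of dense `(r + 1)`-partite
hypergraphs, where the first class may be much smaller than the others. -/
theorem exists_piFinset_subset_of_dense {α : Type*} {t n : ℕ} (ht : 1 ≤ t) :
    ∀ (r : ℕ) (V : Fin (r + 1) → Finset α) (H : Finset (Fin (r + 1) → α)) (d : ℝ),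
      0 < d → d ≤ 1 → H ⊆ Fintype.piFinset V →
      2 * (t : ℝ) ≤ d * (V 0).card → (∀ i : Fin r, (V i.succ).card = n) →
      2 * (t : ℝ) ≤ (d / 2 ^ r) ^ (t ^ r) * n →
      d * ((V 0).card * (n : ℝ) ^ r) ≤ H.card →
      ∃ W : Fin (r + 1) → Finset α, (∀ i, W i ⊆ V i) ∧ (∀ i, (W i).card = t) ∧
        Fintype.piFinset W ⊆ H := by
  classical
  intro r
  induction r with
  | zero =>
    intro V H d hd hd1 hHV h0 _ _ hH
    have hinj : Function.Injective (fun e : Fin 1 → α => e 0) := fun e e' h => by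
      funext i; rwa [Fin.fin_one_eq_zero i]
    have htH : t ≤ (H.image fun e => e 0).card := by
      rw [Finset.card_image_of_injective _ hinj]
      have : (t : ℝ) ≤ H.card := by
        have : (0 : ℝ) ≤ t := Nat.cast_nonneg _
        simp at hH
        linarith
      exact_mod_cast this
    obtain ⟨T, hT, hcard⟩ := Finset.exists_subset_card_eq htH
    refine ⟨fun _ => T, fun i a ha => ?_, fun _ => hcard, fun e he => ?_⟩
    · obtain ⟨e, he, rfl⟩ := Finset.mem_image.1 (hT ha)
      rw [Fin.fin_one_eq_zero i]
      exact Fintype.mem_piFinset.1 (hHV he) 0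
    · obtain ⟨e', he', h⟩ := Finset.mem_image.1 (hT (Fintype.mem_piFinset.1 he 0))
      rwa [← hinj h]
  | succ r ih =>
    intro V H d hd hd1 hHV h0 hV hn hH
    set B := Fintype.piFinset (Fin.tail V) with hB
    have hBcard : (B.card : ℝ) = (n : ℝ) ^ (r + 1) := by
      simp [hB, Fintype.card_piFinset, Fin.tail, hV]
    have hsum : ∑ b ∈ B, ((V 0).filter fun a => Fin.cons a b ∈ H).card = H.card := by
      rw [← Finset.card_sigma]
      refine Finset.card_bij' (fun x _ => (Fin.cons x.2 x.1 : Fin (r + 2) → α))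
        (fun e _ => ⟨Fin.tail e, e 0⟩) ?_ ?_ ?_ ?_
      · intro x hx
        exact (Finset.mem_filter.1 (Finset.mem_sigma.1 hx).2).2
      · intro e he
        have := Fintype.mem_piFinset.1 (hHV he)
        simp only [Finset.mem_sigma, Finset.mem_filter, Fin.cons_self_tail, hB,
          Fintype.mem_piFinset]
        exact ⟨fun i => this i.succ, this 0, he⟩
      · intro x _
        simp
      · intro e _
        simp
    obtain ⟨T, hTV, hTcard, hT⟩ := exists_card_eq_le_card_common_neighbors (V 0) B
      (fun a b => (Fin.cons a b : Fin (r + 2) → α) ∈ H) hd hd1 ht h0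
      (by rw [hBcard]; exact_mod_cast hH.trans_eq (by exact_mod_cast hsum.symm))
    have hd2 : d / 2 ≤ 1 := by linarith
    have hbase : d / 2 ^ (r + 1) ≤ d / 2 := by
      gcongr
      exact le_self_pow₀ (by norm_num) (by omega)
    have hpow1 : (d / 2 ^ (r + 1)) ^ (t ^ (r + 1)) ≤ (d / 2) ^ t :=
      (pow_le_pow_of_le_one (by positivity) (hbase.trans hd2)
        (Nat.le_self_pow (by omega) t)).trans (by gcongr)
    have hpow2 : (d / 2 ^ (r + 1)) ^ (t ^ (r + 1)) ≤ ((d / 2) ^ t / 2 ^ r) ^ (t ^ r) := by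
      rw [pow_succ' t, pow_mul]
      gcongr
      rw [pow_succ', ← div_div, div_pow (d / 2)]
      gcongr
      exact le_self_pow₀ (one_le_pow₀ (by norm_num)) (by omega)
    obtain ⟨W, hWV, hWcard, hWH⟩ := ih (Fin.tail V)
      (B.filter fun b => ∀ a ∈ T, (Fin.cons a b : Fin (r + 2) → α) ∈ H) ((d / 2) ^ t)
      (by positivity) (pow_le_one₀ (by positivity) hd2) (Finset.filter_subset _ _)
      (hn.trans (by simp only [Fin.tail, hV]; gcongr)) (fun i => hV i.succ)
      (hn.trans (by gcongr))
      (by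
        rw [hBcard, pow_succ'] at hT
        rwa [show (Fin.tail V 0).card = n from hV 0])
    refine ⟨Fin.cons T W, fun i => ?_, fun i => ?_, fun e he => ?_⟩
    · refine Fin.cases ?_ (fun j => ?_) i
      · exact hTV
      · exact hWV j
    · refine Fin.cases ?_ (fun j => ?_) i
      · exact hTcard
      · exact hWcard j
    · rw [Fintype.mem_piFinset] at he
      have htail : Fin.tail e ∈ Fintype.piFinset W :=
        Fintype.mem_piFinset.2 fun j => he j.succ
      have := (Finset.mem_filter.1 (hWH htail)).2 (e 0) (he 0)
      rwa [Fin.cons_self_tail] at this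


/-- **Monochromatic or `{1}`-canonical copies.**
Let `k ≥ 2`, `δ ∈ (0,1]`, and `t, n ≥ 1` with `(δ/4^(k-1))·√(δn) ≥ 2t` and
`(δ/4^(k-1))^(t^(k-1)) · n ≥ 2t`.  Let `φ` be a colouring of the complete
`k`-partite `k`-uniform hypergraph with classes `V 1, …, V k` of size `n` (edges are
transversals `e : Fin k → ℕ` with `e i ∈ V i`; the first class is indexed by
`⟨0, _⟩ : Fin k`).  Suppose `U ⊆ V 1` has `|U| ≥ δ n` and `ℓ : U → ℕ` is such that
every `u ∈ U` lies in at least `δ n^(k-1)` edges `e` with `φ e = ℓ u`.  Then there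
are `W i ⊆ V i` with `|W i| = t` spanning a copy of `K^(k)_{t,…,t}` on whose edges
`φ` is either monochromatic or `{1}`-canonical (equal colours iff the edges share
the same vertex of the first class). -/
theorem monochromatic_or_first_canonical (k : ℕ) (hk : 2 ≤ k)
    (δ : ℝ) (hδ : δ ∈ Set.Ioc (0 : ℝ) 1)
    (t n : ℕ) (ht : 1 ≤ t) (hn : 1 ≤ n)
    (hcond1 : (δ / 4 ^ (k - 1)) * Real.sqrt (δ * n) ≥ 2 * (t : ℝ))
    (hcond2 : (δ / 4 ^ (k - 1)) ^ (t ^ (k - 1)) * (n : ℝ) ≥ 2 * (t : ℝ))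
    (V : Fin k → Finset ℕ) (hV : ∀ i, (V i).card = n)
    (φ : (Fin k → ℕ) → ℕ)
    (U : Finset ℕ) (hUV : U ⊆ V ⟨0, by omega⟩) (hU : δ * (n : ℝ) ≤ (U.card : ℝ))
    (ℓ : ℕ → ℕ)
    (hℓ : ∀ u ∈ U, δ * (n : ℝ) ^ (k - 1) ≤
      (((Fintype.piFinset V).filter fun e =>
          e ⟨0, by omega⟩ = u ∧ φ e = ℓ u).card : ℝ)) :
    ∃ W : Fin k → Finset ℕ, (∀ i, W i ⊆ V i) ∧ (∀ i, (W i).card = t) ∧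
      ((∀ e ∈ Fintype.piFinset W, ∀ e' ∈ Fintype.piFinset W, φ e = φ e') ∨
        (∀ e ∈ Fintype.piFinset W, ∀ e' ∈ Fintype.piFinset W,
          (φ e = φ e' ↔ e ⟨0, by omega⟩ = e' ⟨0, by omega⟩))) := by
  classical
  obtain ⟨hδ0, hδ1⟩ := hδ
  obtain ⟨r, rfl⟩ : ∃ r, k = r + 1 := ⟨k - 1, by omega⟩
  simp only [Nat.add_sub_cancel] at hcond1 hcond2 hℓ
  change U ⊆ V 0 at hUV
  change ∀ u ∈ U, _ ≤ (((Fintype.piFinset V).filter fun e => e 0 = u ∧ φ e = ℓ u).card : ℝ) at hℓ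
  obtain ⟨A, hAU, hAcard, hA⟩ := U.exists_subset_constant_or_injOn ℓ
  have hsqrt : Real.sqrt (δ * n) ≤ A.card := by
    rw [Real.sqrt_le_left (Nat.cast_nonneg _)]
    exact hU.trans (by exact_mod_cast hAcard)
  set V' : Fin (r + 1) → Finset ℕ := Fin.cons A (Fin.tail V)
  have hV'V : ∀ i, V' i ⊆ V i := Fin.cases (hAU.trans hUV) fun _ => subset_rfl
  have hdiv : δ / 4 ^ r ≤ δ := div_le_self hδ0.le (one_le_pow₀ (by norm_num))
  set H := (Fintype.piFinset V').filter fun e => φ e = ℓ (e 0)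
  have hHcard : δ * (A.card * (n : ℝ) ^ r) ≤ H.card := by
    rw [Finset.card_eq_sum_card_fiberwise (f := fun e => e 0) (t := A)
      fun e he => Fintype.mem_piFinset.1 (Finset.mem_filter.1 he).1 0]
    push_cast
    calc δ * (A.card * (n : ℝ) ^ r) = ∑ _u ∈ A, δ * (n : ℝ) ^ r := by
          rw [Finset.sum_const, nsmul_eq_mul]; ring
      _ ≤ _ := by
          refine Finset.sum_le_sum fun u hu => (hℓ u (hAU hu)).trans ?_
          refine Nat.cast_le.2 (Finset.card_le_card fun e he => ?_)
          obtain ⟨heV, rfl, hφ⟩ := Finset.mem_filter.1 he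
          rw [Fintype.mem_piFinset] at heV
          refine Finset.mem_filter.2 ⟨Finset.mem_filter.2 ⟨Fintype.mem_piFinset.2 ?_, hφ⟩, rfl⟩
          exact Fin.cases hu fun j => heV j.succ
  obtain ⟨W, hWV, hWcard, hWH⟩ := exists_piFinset_subset_of_dense (n := n) ht r V' H δ hδ0 hδ1
    (Finset.filter_subset _ _)
    (hcond1.le.trans (mul_le_mul hdiv hsqrt (Real.sqrt_nonneg _) hδ0.le))
    (fun i => hV i.succ)
    (hcond2.le.trans (by gcongr; norm_num))
    hHcard
  refine ⟨W, fun i => (hWV i).trans (hV'V i), hWcard, ?_⟩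
  have hφ : ∀ e ∈ Fintype.piFinset W, e 0 ∈ A ∧ φ e = ℓ (e 0) := fun e he =>
    ⟨hWV 0 (Fintype.mem_piFinset.1 he 0), (Finset.mem_filter.1 (hWH he)).2⟩
  refine hA.imp (fun hconst e he e' he' => ?_) (fun hinj e he e' he' => ?_)
  · rw [(hφ e he).2, (hφ e' he').2]
    exact hconst _ (hφ e he).1 _ (hφ e' he').1
  · rw [(hφ e he).2, (hφ e' he').2]
    exact hinj.eq_iff (hφ e he).1 (hφ e' he').1
end
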